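/- Let D be a bounded pseudoconvex domain in ℂ^n, w ∈ ∂D, and let P be a polydisc centered at w with sup_{z ∈ D ∩ P} K_D(z) < ∞. Then for every complex (affine) line L with L ∩ P ≠ ∅, either L ∩ P ∩ D = ∅ or the set (L ∩ P) \ D is a polar subset of L (identified with ℂ). -/

import Mathlib

open MeasureTheory Filter Topology Metric Set
open scoped ENNReal NNReal

/-- Truncated circle average of an `EReal`-valued function: the average over the circle of
center `c` and radius `R` of the function truncated below at `-n`. -/
noncomputable def circleAvgTrunc (u : ℂ → EReal) (c : ℂ) (R : ℝ) (n : ℕ) : ℝ :=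
  (2 * Real.pi)⁻¹ * ∫ θ in (0:ℝ)..(2 * Real.pi),
    (max (u (c + R * Complex.exp (θ * Complex.I))) (-(n : ℝ) : EReal)).toReal

/-- `u` is subharmonic on `Ω ⊆ ℂ`: values in `[-∞, ∞)`, upper semicontinuous on `Ω`, and for
every closed disc contained in `Ω` the value at the center is at most the mean over the
boundary circle (in the extended sense, via decreasing truncations). -/
def SubharmonicOn (u : ℂ → EReal) (Ω : Set ℂ) : Prop :=
  UpperSemicontinuousOn u Ω ∧ (∀ z ∈ Ω, u z < ⊤) ∧
    ∀ c ∈ Ω, ∀ R : ℝ, 0 < R → Metric.closedBall c R ⊆ Ω →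
      u c ≤ ⨅ n : ℕ, (circleAvgTrunc u c R n : EReal)

/-- `u` is plurisubharmonic on `Ω`: values in `[-∞, ∞)`, upper semicontinuous on `Ω`, and its
restriction to every complex line is subharmonic. -/
def PlurisubharmonicOn {E : Type*} [NormedAddCommGroup E] [NormedSpace ℂ E]
    (u : E → EReal) (Ω : Set E) : Prop :=
  UpperSemicontinuousOn u Ω ∧ (∀ z ∈ Ω, u z < ⊤) ∧
    ∀ a b : E, SubharmonicOn (fun lam : ℂ => u (a + lam • b)) {lam : ℂ | a + lam • b ∈ Ω}

/-- A set `P ⊆ ℂ` is polar. -/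
def PolarSet (P : Set ℂ) : Prop :=
  ∀ z ∈ P, ∃ U : Set ℂ, IsOpen U ∧ IsConnected U ∧ z ∈ U ∧
    ∃ u : ℂ → EReal, SubharmonicOn u U ∧ (∃ x ∈ U, u x ≠ ⊥) ∧ ∀ x ∈ P ∩ U, u x = ⊥

/-- A set `P ⊆ ℂⁿ` is pluripolar. -/
def PluripolarSet {E : Type*} [NormedAddCommGroup E] [NormedSpace ℂ E] (P : Set E) : Prop :=
  ∀ z ∈ P, ∃ U : Set E, IsOpen U ∧ IsConnected U ∧ z ∈ U ∧
    ∃ u : E → EReal, PlurisubharmonicOn u U ∧ (∃ x ∈ U, u x ≠ ⊥) ∧ ∀ x ∈ P ∩ U, u x = ⊥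

/-- A domain `D` is pseudoconvex if `z ↦ -log dist(z, ∂D)` is plurisubharmonic on `D`. -/
def IsPseudoconvex {E : Type*} [NormedAddCommGroup E] [NormedSpace ℂ E] (D : Set E) : Prop :=
  PlurisubharmonicOn (fun z => ((- Real.log (Metric.infDist z Dᶜ) : ℝ) : EReal)) D

/-- The square-integrable holomorphic functions on an open set `Ω`. -/
def L2h {E : Type*} [NormedAddCommGroup E] [NormedSpace ℂ E] [MeasureSpace E]
    (Ω : Set E) : Set (E → ℂ) :=
  {f | DifferentiableOn ℂ f Ω ∧ (∫⁻ z in Ω, (‖f z‖₊ : ℝ≥0∞) ^ 2) < ⊤}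

/-- The Bergman kernel of `Ω` on the diagonal,
`K_Ω(z) = sup { |f(z)|²/‖f‖²_{L²(Ω)} : f ∈ L²ₕ(Ω), f ≢ 0 }`. -/
noncomputable def bergmanKernel {E : Type*} [NormedAddCommGroup E] [NormedSpace ℂ E]
    [MeasureSpace E] (Ω : Set E) (z : E) : ℝ≥0∞ :=
  ⨆ (f : E → ℂ) (_ : f ∈ L2h Ω) (_ : ∃ w ∈ Ω, f w ≠ 0),
    (‖f z‖₊ : ℝ≥0∞) ^ 2 / ∫⁻ w in Ω, (‖f w‖₊ : ℝ≥0∞) ^ 2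

/-- `D` is an `L²ₕ`-domain of holomorphy: there are no domains `D₀, D₁` with
`∅ ≠ D₀ ⊆ D₁ ∩ D`, `D₁ ⊄ D`, such that every `f ∈ L²ₕ(D)` extends holomorphically to `D₁`
(agreeing with `f` on `D₀`). -/
def IsL2hDomainOfHolomorphy {E : Type*} [NormedAddCommGroup E] [NormedSpace ℂ E]
    [MeasureSpace E] (D : Set E) : Prop :=
  ¬ ∃ D0 D1 : Set E, IsOpen D0 ∧ IsConnected D0 ∧ IsOpen D1 ∧ IsConnected D1 ∧
      D0 ⊆ D1 ∩ D ∧ ¬ (D1 ⊆ D) ∧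
      ∀ f ∈ L2h D, ∃ F : E → ℂ, DifferentiableOn ℂ F D1 ∧ Set.EqOn F f D0

/-- `w` is a regular boundary point of the domain `D ⊆ ℂ`. -/
def RegularBoundaryPt (D : Set ℂ) (w : ℂ) : Prop :=
  ∃ U : Set ℂ, IsOpen U ∧ w ∈ U ∧ ∃ u : ℂ → EReal, SubharmonicOn u (U ∩ D) ∧
    (∀ z ∈ U ∩ D, u z < 0) ∧ Tendsto u (𝓝[U ∩ D] w) (𝓝 (0 : EReal))

/-- The (pluricomplex) Green function of a domain `D ⊆ ℂ` with logarithmic pole at `p`. -/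
noncomputable def greenFn (D : Set ℂ) (p z : ℂ) : EReal :=
  sSup {v : EReal | ∃ u : ℂ → EReal, SubharmonicOn u D ∧ (∀ x ∈ D, u x < 0) ∧
    (∃ C : ℝ, ∀ᶠ x in 𝓝 p, u x ≤ ((Real.log ‖x - p‖ + C : ℝ) : EReal)) ∧ v = u z}

/-- A polydisc in `ℂⁿ` with centre `c` and multiradius `r`. -/
def polydisc {n : ℕ} (c : Fin n → ℂ) (r : Fin n → ℝ) : Set (Fin n → ℂ) :=
  {z | ∀ i, ‖z i - c i‖ < r i}



open scoped ContDiff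
open Complex

local notation "𝕍" n:max => Fin n → ℂ
local notation "𝕖" x:max => ((Real.exp x : ℝ) : ℂ)
local notation "rexp" => Real.exp
local notation "rlog" => Real.log
local notation "rsqrt" => Real.sqrt
local notation "π" => Real.pi
local notation "ofR" => ENNReal.ofReal
local notation "SMO" => ContDiff ℝ ∞
local notation "HCS" => HasCompactSupport
local notation "conj" => starRingEnd ℂ

noncomputable def dz {n : ℕ} (j : Fin n) (f : 𝕍 n → ℂ) (z : 𝕍 n) : ℂ :=
  (1/2) * (fderiv ℝ f z (Pi.single j 1) - I * fderiv ℝ f z (Pi.single j I))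
noncomputable def db {n : ℕ} (j : Fin n) (f : 𝕍 n → ℂ) (z : 𝕍 n) : ℂ :=
  (1/2) * (fderiv ℝ f z (Pi.single j 1) + I * fderiv ℝ f z (Pi.single j I))

section calc1
variable {n : ℕ} {f g : 𝕍 n → ℂ} {z : 𝕍 n}

lemma sm_da (hf : SMO f) (z) : DifferentiableAt ℝ f z :=
  (hf.differentiable (by simp)) z

lemma dz_congr (j : Fin n) (h : f =ᶠ[𝓝 z] g) : dz j f z = dz j g z := by
  simp [dz, h.fderiv_eq]
lemma db_congr (j : Fin n) (h : f =ᶠ[𝓝 z] g) : db j f z = db j g z := by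
  simp [db, h.fderiv_eq]

lemma dz_sm (j : Fin n) (hf : SMO f) : SMO (dz j f) := by
  have h : SMO (fderiv ℝ f) := hf.fderiv_right (by simp)
  unfold dz
  fun_prop
lemma db_sm (j : Fin n) (hf : SMO f) : SMO (db j f) := by
  have h : SMO (fderiv ℝ f) := hf.fderiv_right (by simp)
  unfold db
  fun_prop

lemma dz_mul (j : Fin n) (hf : DifferentiableAt ℝ f z) (hg : DifferentiableAt ℝ g z) :
    dz j (fun z => f z * g z) z = dz j f z * g z + f z * dz j g z := by
  simp only [dz, fderiv_fun_mul hf hg, _root_.add_apply, _root_.smul_apply, smul_eq_mul]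
  ring
lemma db_mul (j : Fin n) (hf : DifferentiableAt ℝ f z) (hg : DifferentiableAt ℝ g z) :
    db j (fun z => f z * g z) z = db j f z * g z + f z * db j g z := by
  simp only [db, fderiv_fun_mul hf hg, _root_.add_apply, _root_.smul_apply, smul_eq_mul]
  ring
lemma dz_add (j : Fin n) (hf : DifferentiableAt ℝ f z) (hg : DifferentiableAt ℝ g z) :
    dz j (fun z => f z + g z) z = dz j f z + dz j g z := by
  simp only [dz, fderiv_fun_add hf hg, _root_.add_apply]; ring
lemma db_add (j : Fin n) (hf : DifferentiableAt ℝ f z) (hg : DifferentiableAt ℝ g z) :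
    db j (fun z => f z + g z) z = db j f z + db j g z := by
  simp only [db, fderiv_fun_add hf hg, _root_.add_apply]; ring
lemma dz_sub (j : Fin n) (hf : DifferentiableAt ℝ f z) (hg : DifferentiableAt ℝ g z) :
    dz j (fun z => f z - g z) z = dz j f z - dz j g z := by
  simp only [dz, fderiv_fun_sub hf hg, _root_.sub_apply]; ring
lemma db_sub (j : Fin n) (hf : DifferentiableAt ℝ f z) (hg : DifferentiableAt ℝ g z) :
    db j (fun z => f z - g z) z = db j f z - db j g z := by
  simp only [db, fderiv_fun_sub hf hg, _root_.sub_apply]; ring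
lemma dz_const (j : Fin n) (c : ℂ) : dz j (fun _ => c) z = 0 := by simp [dz]
lemma db_const (j : Fin n) (c : ℂ) : db j (fun _ => c) z = 0 := by simp [db]
lemma dz_cmul (j : Fin n) (c : ℂ) (hf : DifferentiableAt ℝ f z) :
    dz j (fun z => c * f z) z = c * dz j f z := by
  rw [dz_mul j (by fun_prop) hf, dz_const]; ring
lemma db_cmul (j : Fin n) (c : ℂ) (hf : DifferentiableAt ℝ f z) :
    db j (fun z => c * f z) z = c * db j f z := by
  rw [db_mul j (by fun_prop) hf, db_const]; ring

lemma fderiv_conj (hf : DifferentiableAt ℝ f z) (v) :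
    fderiv ℝ (fun z => (conj) (f z)) z v = (conj) (fderiv ℝ f z v) := by
  have := (conjCLE.toContinuousLinearMap.hasFDerivAt (x := f z)).comp z hf.hasFDerivAt
  have h2 := this.fderiv
  have : (fun z => (conj) (f z)) = (⇑(conjCLE.toContinuousLinearMap) ∘ f) := by ext; simp
  rw [this, h2]; simp
lemma conj_da (hf : DifferentiableAt ℝ f z) :
    DifferentiableAt ℝ (fun z => (conj) (f z)) z :=
  (conjCLE.toContinuousLinearMap.differentiableAt (x := f z)).comp z hf
lemma conj_sm {E : Type*} [NormedAddCommGroup E] [NormedSpace ℝ E] {f : E → ℂ} (hf : SMO f) :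
    SMO (fun z => (conj) (f z)) :=
  conjCLE.toContinuousLinearMap.contDiff.comp hf
lemma dz_conj (j : Fin n) (hf : DifferentiableAt ℝ f z) :
    dz j (fun z => (conj) (f z)) z = (conj) (db j f z) := by
  simp only [dz, db, fderiv_conj hf, map_mul, map_add, conj_I, map_div₀, map_one, map_ofNat]; ring
lemma db_conj (j : Fin n) (hf : DifferentiableAt ℝ f z) :
    db j (fun z => (conj) (f z)) z = (conj) (dz j f z) := by
  simp only [dz, db, fderiv_conj hf, map_mul, map_sub, conj_I, map_div₀, map_one, map_ofNat]; ring

lemma fderiv_ofReal {h : 𝕍 n → ℝ} (hf : DifferentiableAt ℝ h z) (v) :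
    fderiv ℝ (fun z => (h z : ℂ)) z v = (fderiv ℝ h z v : ℝ) := by
  have := (ofRealCLM.hasFDerivAt (x := h z)).comp z hf.hasFDerivAt
  have h2 := this.fderiv
  have : (fun z => (h z : ℂ)) = (⇑(ofRealCLM) ∘ h) := by ext; simp
  rw [this, h2]; simp
lemma ofReal_sm {E : Type*} [NormedAddCommGroup E] [NormedSpace ℝ E] {h : E → ℝ} (hf : SMO h) :
    SMO (fun z => (h z : ℂ)) :=
  ofRealCLM.contDiff.comp hf
lemma ofReal_da {h : 𝕍 n → ℝ} (hf : DifferentiableAt ℝ h z) :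
    DifferentiableAt ℝ (fun z => (h z : ℂ)) z :=
  (ofRealCLM.differentiableAt (x := h z)).comp z hf
lemma db_real (j : Fin n) {h : 𝕍 n → ℝ} (hf : DifferentiableAt ℝ h z) :
    db j (fun z => (h z : ℂ)) z = (conj) (dz j (fun z => (h z : ℂ)) z) := by
  rw [← db_conj j (ofReal_da hf)]; simp

lemma dz_comp (j : Fin n) {G : ℝ → ℝ} {G' : ℝ} {h : 𝕍 n → ℝ} (hf : DifferentiableAt ℝ h z)
    (hG : HasDerivAt G G' (h z)) :
    dz j (fun z => (G (h z) : ℂ)) z = G' * dz j (fun z => (h z : ℂ)) z := by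
  have h1 := (hG.comp_hasFDerivAt z hf.hasFDerivAt)
  have h2 : ∀ v, fderiv ℝ (fun z => (G (h z) : ℂ)) z v = G' * (fderiv ℝ h z v : ℝ) := fun v => by
    have e : (fun z => G (h z)) = G ∘ h := rfl
    rw [fderiv_ofReal (by rw [e]; exact h1.differentiableAt), e, h1.fderiv]; simp
  simp only [dz, h2, fderiv_ofReal hf]; ring
lemma db_comp (j : Fin n) {G : ℝ → ℝ} {G' : ℝ} {h : 𝕍 n → ℝ} (hf : DifferentiableAt ℝ h z)
    (hG : HasDerivAt G G' (h z)) :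
    db j (fun z => (G (h z) : ℂ)) z = G' * db j (fun z => (h z : ℂ)) z := by
  have h1 := (hG.comp_hasFDerivAt z hf.hasFDerivAt)
  rw [db_real j (h := fun z => G (h z)) h1.differentiableAt, dz_comp j hf hG, db_real j hf]; simp

lemma fderiv_clm_comp_apply (hf : SMO f) (v w : 𝕍 n) :
    fderiv ℝ (fun y => fderiv ℝ f y v) z w = fderiv ℝ (fderiv ℝ f) z w v := by
  have h : SMO (fderiv ℝ f) := hf.fderiv_right (by simp)
  rw [fderiv_clm_apply (h.differentiable (by simp) z) (by fun_prop)]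
  simp
lemma fd_aux (e : ℂ) (k : Fin n) (hf : SMO f) (w : 𝕍 n) :
    fderiv ℝ (fun z => (1/2) * (fderiv ℝ f z (Pi.single k 1) + e * fderiv ℝ f z (Pi.single k I))) z w
      = (1/2) * (fderiv ℝ (fderiv ℝ f) z w (Pi.single k 1)
      + e * fderiv ℝ (fderiv ℝ f) z w (Pi.single k I)) := by
  have h : SMO (fderiv ℝ f) := hf.fderiv_right (by simp)
  have h1 : ∀ v, DifferentiableAt ℝ (fun y => fderiv ℝ f y v) z := fun v =>
    (h.differentiable (by simp) z).clm_apply (by fun_prop)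
  rw [fderiv_const_mul (by exact (h1 _).add ((h1 _).const_mul _)), fderiv_fun_add (h1 _) ((h1 _).const_mul _),
      fderiv_const_mul (h1 _)]
  simp [fderiv_clm_comp_apply hf]; ring
lemma dd_symm (hf : SMO f) (v w : 𝕍 n) :
    fderiv ℝ (fderiv ℝ f) z w v = fderiv ℝ (fderiv ℝ f) z v w :=
  (hf.contDiffAt.isSymmSndFDerivAt (by simp [minSmoothness]; exact WithTop.coe_le_coe.2 (show ((2:ℕ):ℕ∞) ≤ ⊤ from le_top))).eq w v
lemma dz_eq_aux (j : Fin n) : dz j f = fun z => (1/2) * (fderiv ℝ f z (Pi.single j 1) + (-I) * fderiv ℝ f z (Pi.single j I)) := by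
  ext z; simp [dz, sub_eq_add_neg]
lemma dz_db_comm (j k : Fin n) (hf : SMO f) : dz j (db k f) z = db k (dz j f) z := by
  rw [dz, db, dz_eq_aux, fd_aux _ _ hf, fd_aux _ _ hf]
  unfold db
  rw [fd_aux _ _ hf, fd_aux _ _ hf]
  rw [dd_symm hf (Pi.single j 1) (Pi.single k 1), dd_symm hf (Pi.single j 1) (Pi.single k I),
    dd_symm hf (Pi.single j I) (Pi.single k 1), dd_symm hf (Pi.single j I) (Pi.single k I)]
  ring
lemma db_db_comm (j k : Fin n) (hf : SMO f) : db j (db k f) z = db k (db j f) z := by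
  rw [db, db]
  unfold db
  rw [fd_aux _ _ hf, fd_aux _ _ hf, fd_aux _ _ hf, fd_aux _ _ hf]
  rw [dd_symm hf (Pi.single j 1) (Pi.single k 1), dd_symm hf (Pi.single j 1) (Pi.single k I),
    dd_symm hf (Pi.single j I) (Pi.single k 1), dd_symm hf (Pi.single j I) (Pi.single k I)]
  ring

lemma tsupport_fd (v : 𝕍 n) : Function.support (fun z => fderiv ℝ f z v) ⊆ tsupport f := by
  intro x hx
  by_contra h
  apply hx
  rw [notMem_tsupport_iff_eventuallyEq] at h
  simp [h.fderiv_eq]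
lemma dz_zero (j : Fin n) (hz : z ∉ tsupport f) : dz j f z = 0 := by
  rw [notMem_tsupport_iff_eventuallyEq] at hz
  simp [dz, hz.fderiv_eq]
lemma db_zero (j : Fin n) (hz : z ∉ tsupport f) : db j f z = 0 := by
  rw [notMem_tsupport_iff_eventuallyEq] at hz
  simp [db, hz.fderiv_eq]
lemma dz_tsupport (j : Fin n) : tsupport (dz j f) ⊆ tsupport f :=
  closure_minimal (fun _ hx => by by_contra h; exact hx (dz_zero j h)) (isClosed_tsupport _)
lemma db_tsupport (j : Fin n) : tsupport (db j f) ⊆ tsupport f :=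
  closure_minimal (fun _ hx => by by_contra h; exact hx (db_zero j h)) (isClosed_tsupport _)
lemma dz_cs (j : Fin n) (hf : HCS f) : HCS (dz j f) :=
  hf.of_isClosed_subset (isClosed_tsupport _) (dz_tsupport j)
lemma db_cs (j : Fin n) (hf : HCS f) : HCS (db j f) :=
  hf.of_isClosed_subset (isClosed_tsupport _) (db_tsupport j)

lemma int_fd (hf : SMO f) (hc : HCS f) (v : 𝕍 n) :
    Integrable (fun z => fderiv ℝ f z v) ∧ ∫ z, fderiv ℝ f z v = 0 := by
  have h : SMO (fderiv ℝ f) := hf.fderiv_right (by simp)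
  have hi : Integrable (fun z => fderiv ℝ f z v) :=
    (h.continuous.clm_apply continuous_const).integrable_of_hasCompactSupport
      (hc.of_isClosed_subset (isClosed_tsupport _) (closure_minimal (tsupport_fd v) (isClosed_tsupport _)))
  refine ⟨hi, ?_⟩
  have := integral_smul_fderiv_eq_neg_fderiv_smul_of_integrable (μ := volume) (𝕜 := ℝ) (f := fun _ => (1:ℝ)) (g := f) (v := v)
    (by simp) (by simpa using hi) (by simpa using hf.continuous.integrable_of_hasCompactSupport hc)
    (by intros; fun_prop) (fun x _ => sm_da hf x)
  simpa using this
lemma int_dz (j : Fin n) (hf : SMO f) (hc : HCS f) : ∫ z, dz j f z = 0 := by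
  unfold dz
  rw [integral_const_mul, integral_sub (int_fd hf hc _).1 ((int_fd hf hc _).1.const_mul _),
    integral_const_mul, (int_fd hf hc _).2, (int_fd hf hc _).2]; simp
lemma int_db (j : Fin n) (hf : SMO f) (hc : HCS f) : ∫ z, db j f z = 0 := by
  unfold db
  rw [integral_const_mul, integral_add (int_fd hf hc _).1 ((int_fd hf hc _).1.const_mul _),
    integral_const_mul, (int_fd hf hc _).2, (int_fd hf hc _).2]; simp

lemma ibp_dz (j : Fin n) (hf : SMO f) (hg : SMO g) (hc : HCS g) :
    ∫ z, f z * dz j g z = - ∫ z, dz j f z * g z := by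
  have h := int_dz j (hf.mul hg) hc.mul_left
  have e : ∀ z, dz j (fun z => f z * g z) z = dz j f z * g z + f z * dz j g z := fun z =>
    dz_mul j (sm_da hf z) (sm_da hg z)
  simp only [e] at h
  rw [integral_add] at h
  · linear_combination h
  · exact ((dz_sm j hf).continuous.mul hg.continuous).integrable_of_hasCompactSupport hc.mul_left
  · exact (hf.continuous.mul (dz_sm j hg).continuous).integrable_of_hasCompactSupport (dz_cs j hc).mul_left
lemma ibp_db (j : Fin n) (hf : SMO f) (hg : SMO g) (hc : HCS g) :
    ∫ z, f z * db j g z = - ∫ z, db j f z * g z := by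
  have h := int_db j (hf.mul hg) hc.mul_left
  have e : ∀ z, db j (fun z => f z * g z) z = db j f z * g z + f z * db j g z := fun z =>
    db_mul j (sm_da hf z) (sm_da hg z)
  simp only [e] at h
  rw [integral_add] at h
  · linear_combination h
  · exact ((db_sm j hf).continuous.mul hg.continuous).integrable_of_hasCompactSupport hc.mul_left
  · exact (hf.continuous.mul (db_sm j hg).continuous).integrable_of_hasCompactSupport (db_cs j hc).mul_left
end calc1



noncomputable def Lev {n : ℕ} (h : 𝕍 n → ℝ) (z ξ : 𝕍 n) : ℝ :=
  (∑ j, ∑ k, dz j (db k (fun z => (h z : ℂ))) z * ξ j * (conj) (ξ k)).re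
noncomputable def dl {n : ℕ} (h : 𝕍 n → ℝ) (z ξ : 𝕍 n) : ℂ :=
  ∑ j, dz j (fun z => (h z : ℂ)) z * ξ j

section twist
variable {n : ℕ}

lemma Lev_comp {h : 𝕍 n → ℝ} (hs : SMO h) {G G1 : ℝ → ℝ} {G2 : ℝ} {z : 𝕍 n}
    (h1 : ∀ᶠ t in 𝓝 (h z), HasDerivAt G (G1 t) t) (h2 : HasDerivAt G1 G2 (h z)) (ξ : 𝕍 n) :
    Lev (fun z => G (h z)) z ξ = G1 (h z) * Lev h z ξ + G2 * ‖dl h z ξ‖ ^ 2 := by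
  have hd : ∀ z, DifferentiableAt ℝ h z := fun z => hs.differentiable (by simp) z
  have hc := ofReal_sm hs
  have e : ∀ j k, dz j (db k (fun z => (G (h z) : ℂ))) z = G2 * dz j (fun z => (h z:ℂ)) z * (conj) (dz k (fun z => (h z:ℂ)) z)
      + G1 (h z) * dz j (db k (fun z => (h z : ℂ))) z := by
    intro j k
    have ev : db k (fun z => (G (h z) : ℂ)) =ᶠ[𝓝 z] fun y => (G1 (h y) : ℂ) * db k (fun z => (h z : ℂ)) y := by
      filter_upwards [hs.continuous.continuousAt.eventually h1] with y hy
      exact db_comp k (hd y) hy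
    have hG1 : DifferentiableAt ℝ (fun y => (G1 (h y))) z := (h2.comp_hasFDerivAt z (hd z).hasFDerivAt).differentiableAt
    rw [dz_congr j ev, dz_mul j (ofReal_da hG1) (sm_da (db_sm k hc) z), dz_comp j (hd z) h2, db_real k (hd z)]
  have e2 : (((‖dl h z ξ‖ ^ 2 : ℝ)) : ℂ) = dl h z ξ * (conj) (dl h z ξ) := by
    rw [mul_conj']; push_cast; rfl
  have : (∑ j, ∑ k, dz j (db k (fun z => (G (h z) : ℂ))) z * ξ j * (conj) (ξ k)) =
      (G1 (h z) : ℂ) * (∑ j, ∑ k, dz j (db k (fun z => (h z : ℂ))) z * ξ j * (conj) (ξ k)) +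
      (G2 : ℂ) * ((‖dl h z ξ‖ ^ 2 : ℝ) : ℂ) := by
    rw [e2, dl, map_sum, Finset.sum_mul_sum, Finset.mul_sum, Finset.mul_sum, ← Finset.sum_add_distrib]
    refine Finset.sum_congr rfl fun j _ => ?_
    rw [Finset.mul_sum, Finset.mul_sum, ← Finset.sum_add_distrib]
    refine Finset.sum_congr rfl fun k _ => ?_
    rw [e, map_mul]; ring
  rw [Lev, this, add_re, re_ofReal_mul, re_ofReal_mul, ofReal_re, Lev]

lemma Lev_add {h g : 𝕍 n → ℝ} (hs : SMO h) (gs : SMO g) (z ξ : 𝕍 n) :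
    Lev (fun z => h z + g z) z ξ = Lev h z ξ + Lev g z ξ := by
  have hc := ofReal_sm hs
  have gc := ofReal_sm gs
  have e : ∀ k, db k (fun z => ((h z + g z : ℝ) : ℂ)) = fun z => db k (fun z => (h z:ℂ)) z + db k (fun z => (g z:ℂ)) z := by
    intro k; ext y; rw [← db_add k (sm_da hc y) (sm_da gc y)]; simp
  simp only [Lev, e, ← add_re, ← Finset.sum_add_distrib]
  congr 1
  refine Finset.sum_congr rfl fun j _ => Finset.sum_congr rfl fun k _ => ?_
  rw [dz_add j (sm_da (db_sm k hc) z) (sm_da (db_sm k gc) z)]; ring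
lemma dl_comp {h : 𝕍 n → ℝ} (hs : SMO h) {G : ℝ → ℝ} {G1 : ℝ} {z : 𝕍 n}
    (h1 : HasDerivAt G G1 (h z)) (ξ : 𝕍 n) :
    dl (fun z => G (h z)) z ξ = G1 * dl h z ξ := by
  simp only [dl, Finset.mul_sum]
  refine Finset.sum_congr rfl fun j _ => ?_
  rw [dz_comp j (hs.differentiable (by simp) z) h1]; ring

lemma basic1 {B : 𝕍 n → ℝ} (hB : SMO B) {p r : 𝕍 n → ℂ}
    (hp : SMO p) (hr : SMO r) (cr : HCS r) (j k : Fin n) :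
    ∫ z, ((dz j p z - dz j (fun z => (B z:ℂ)) z * p z) * (conj) (dz k r z - dz k (fun z => (B z:ℂ)) z * r z) * (rexp (- B z) : ℂ)
     - (db k p z * (conj) (db j r z) + dz j (db k (fun z => (B z:ℂ))) z * p z * (conj) (r z)) * (rexp (- B z) : ℂ)) = 0 := by
  have hBd : ∀ z, DifferentiableAt ℝ B z := fun z => hB.differentiable (by simp) z
  have hBc := ofReal_sm hB
  set Bc : 𝕍 n → ℂ := fun z => (B z:ℂ) with hBcd
  set w : 𝕍 n → ℂ := fun z => (rexp (- B z) : ℂ) with hw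
  have ws : SMO w := ofReal_sm (Real.contDiff_exp.comp hB.neg)
  have hG : ∀ t, HasDerivAt (fun t => rexp (-t)) (-rexp (-t)) t := fun t => by
    simpa using (hasDerivAt_neg t).exp
  have dw : ∀ j z, dz j w z = - dz j Bc z * w z := fun j z => by
    rw [hw, dz_comp (G := fun t => rexp (-t)) j (hBd z) (hG _)]; push_cast; ring
  have bw : ∀ j z, db j w z = - db j Bc z * w z := fun j z => by
    rw [hw, db_comp (G := fun t => rexp (-t)) j (hBd z) (hG _)]; push_cast; ring
  have rs := conj_sm hr
  have crc : HCS (fun z => (conj) (r z)) := cr.comp_left (by simp)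
  set δ : 𝕍 n → ℂ := fun z => dz j p z - dz j Bc z * p z with hδ
  have δs : SMO δ := (dz_sm j hp).sub ((dz_sm j hBc).mul hp)
  have i1 := int_db k (δs.mul (rs.mul ws)) (crc.mul_right.mul_left)
  have i2 := int_dz j ((db_sm k hp).mul (rs.mul ws)) (crc.mul_right.mul_left)
  have i3 := congrArg₂ (fun x y : ℂ => x - y) i1 i2
  simp only [sub_self] at i3
  rw [← i3, ← integral_sub]
  · congr 1
    ext z
    rw [db_mul k (sm_da δs z) (sm_da (rs.mul ws) z), db_mul k (sm_da rs z) (sm_da ws z),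
      dz_mul j (sm_da (db_sm k hp) z) (sm_da (rs.mul ws) z), dz_mul j (sm_da rs z) (sm_da ws z),
      db_conj k (sm_da hr z), dz_conj j (sm_da hr z), dw, bw, hδ,
      db_sub k (sm_da (dz_sm j hp) z) (sm_da ((dz_sm j hBc).mul hp) z),
      db_mul k (sm_da (dz_sm j hBc) z) (sm_da hp z), dz_db_comm j k hp, dz_db_comm j k hBc,
      map_sub, map_mul, db_real k (hBd z)]
    ring
  · exact (db_sm k (δs.mul (rs.mul ws))).continuous.integrable_of_hasCompactSupport (db_cs k (crc.mul_right.mul_left))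
  · exact (dz_sm j ((db_sm k hp).mul (rs.mul ws))).continuous.integrable_of_hasCompactSupport (dz_cs j (crc.mul_right.mul_left))

lemma re_aux (x y : ℂ) : -(1/2) * ‖x - y‖^2 ≤ (x * (conj) y).re := by
  have h1 : ‖x - y‖^2 = (x.re-y.re)^2 + (x.im-y.im)^2 := by
    rw [← normSq_eq_norm_sq, normSq_apply]; simp; ring
  rw [h1]; simp
  nlinarith [sq_nonneg (x.re + y.re), sq_nonneg (x.im + y.im), sq_nonneg (x.re), sq_nonneg (y.re), sq_nonneg (x.im), sq_nonneg (y.im)]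

lemma basic_ineq {B : 𝕍 n → ℝ} (hB : SMO B) {b : Fin n → 𝕍 n → ℂ}
    (hb : ∀ j, SMO (b j)) (cb : ∀ j, HCS (b j)) :
    Integrable (fun z => (‖∑ j, (dz j (b j) z - dz j (fun z => (B z:ℂ)) z * b j z)‖^2 +
      (1/2) * ∑ j, ∑ k, ‖db k (b j) z - db j (b k) z‖^2 - Lev B z (fun j => b j z)) * rexp (- B z)) ∧ 0 ≤ ∫ z, (‖∑ j, (dz j (b j) z - dz j (fun z => (B z:ℂ)) z * b j z)‖^2 +
      (1/2) * ∑ j, ∑ k, ‖db k (b j) z - db j (b k) z‖^2 - Lev B z (fun j => b j z)) * rexp (- B z) := by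
  have hBc := ofReal_sm hB
  have ws : SMO (fun z => (rexp (- B z) : ℂ)) := ofReal_sm (Real.contDiff_exp.comp hB.neg)
  set w : 𝕍 n → ℂ := fun z => (rexp (- B z) : ℂ) with hw
  set Bc : 𝕍 n → ℂ := fun z => (B z:ℂ) with hBcd
  have δs : ∀ j, SMO (fun z => dz j (b j) z - dz j Bc z * b j z) := fun j =>
    (dz_sm j (hb j)).sub ((dz_sm j hBc).mul (hb j))
  have δc : ∀ j, HCS (fun z => dz j (b j) z - dz j Bc z * b j z) := fun j =>
    (dz_cs j (cb j)).sub (cb j).mul_left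
  have c1 : ∀ j k, Continuous (fun z => ((dz j (b j) z - dz j Bc z * b j z) * (conj) (dz k (b k) z - dz k Bc z * b k z) * w z
     - (db k (b j) z * (conj) (db j (b k) z) + dz j (db k Bc) z * b j z * (conj) (b k z)) * w z)) := fun j k => by
    have := (δs j).continuous; have := (conj_sm (δs k)).continuous; have := ws.continuous
    have := (db_sm k (hb j)).continuous; have := (conj_sm (db_sm j (hb k))).continuous
    have := (dz_sm j (db_sm k hBc)).continuous; have := (hb j).continuous; have := (conj_sm (hb k)).continuous
    fun_prop
  have s1 : ∀ j k, HCS (fun z => ((dz j (b j) z - dz j Bc z * b j z) * (conj) (dz k (b k) z - dz k Bc z * b k z) * w z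
     - (db k (b j) z * (conj) (db j (b k) z) + dz j (db k Bc) z * b j z * (conj) (b k z)) * w z)) := fun j k => by
    refine HasCompactSupport.sub ?_ ?_
    · exact HasCompactSupport.mul_right (HasCompactSupport.mul_right (δc j))
    · exact HasCompactSupport.mul_right (HasCompactSupport.add (HasCompactSupport.mul_right (db_cs k (cb j))) (HasCompactSupport.mul_right (HasCompactSupport.mul_left (cb j))))
  have I1 : ∀ j k, Integrable (fun z => ((dz j (b j) z - dz j Bc z * b j z) * (conj) (dz k (b k) z - dz k Bc z * b k z) * w z
     - (db k (b j) z * (conj) (db j (b k) z) + dz j (db k Bc) z * b j z * (conj) (b k z)) * w z)) := fun j k =>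
      (c1 j k).integrable_of_hasCompactSupport (s1 j k)
  have key : ∫ z, (∑ j, ∑ k, ((dz j (b j) z - dz j Bc z * b j z) * (conj) (dz k (b k) z - dz k Bc z * b k z) * w z
     - (db k (b j) z * (conj) (db j (b k) z) + dz j (db k Bc) z * b j z * (conj) (b k z)) * w z)) = 0 := by
    rw [integral_finsetSum _ (fun j _ => integrable_finsetSum _ (fun k _ => I1 j k))]
    refine Finset.sum_eq_zero fun j _ => ?_
    rw [integral_finsetSum _ (fun k _ => I1 j k)]
    exact Finset.sum_eq_zero fun k _ => basic1 hB (hb j) (hb k) (cb k) j k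
  have I2 := (integrable_finsetSum Finset.univ (fun j _ => integrable_finsetSum Finset.univ (fun k _ => I1 j k)))
  have key2 := congrArg Complex.re key
  rw [← RCLike.re_eq_complex_re, ← integral_re I2] at key2
  rw [RCLike.re_eq_complex_re, zero_re] at key2
  rw [← key2]
  have pw : ∀ z, (∑ j, ∑ k, ((dz j (b j) z - dz j Bc z * b j z) * (conj) (dz k (b k) z - dz k Bc z * b k z) * w z
     - (db k (b j) z * (conj) (db j (b k) z) + dz j (db k Bc) z * b j z * (conj) (b k z)) * w z)).re
     = (‖∑ j, (dz j (b j) z - dz j Bc z * b j z)‖^2 - (∑ j, ∑ k, (db k (b j) z * (conj) (db j (b k) z)).re) - Lev B z (fun j => b j z)) * rexp (- B z) := by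
    intro z
    have e2 : (((‖∑ j, (dz j (b j) z - dz j Bc z * b j z)‖ ^ 2 : ℝ)) : ℂ) = ∑ j, ∑ k, (dz j (b j) z - dz j Bc z * b j z) * (conj) (dz k (b k) z - dz k Bc z * b k z) := by
      rw [← Finset.sum_mul_sum, ← map_sum, mul_conj']; push_cast; rfl
    rw [← ofReal_re (‖∑ j, (dz j (b j) z - dz j Bc z * b j z)‖ ^ 2), e2, Lev]
    simp only [← re_sum, ← sub_re]
    rw [← re_mul_ofReal]
    congr 1
    simp only [sub_mul, Finset.sum_mul, ← Finset.sum_sub_distrib]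
    exact Finset.sum_congr rfl fun j _ => Finset.sum_congr rfl fun k _ => by simp only [hw]; ring
  have pw2 : ∀ z, (‖∑ j, (dz j (b j) z - dz j Bc z * b j z)‖^2 - (∑ j, ∑ k, (db k (b j) z * (conj) (db j (b k) z)).re) - Lev B z (fun j => b j z)) * rexp (- B z) ≤ (‖∑ j, (dz j (b j) z - dz j Bc z * b j z)‖^2 +
      (1/2) * ∑ j, ∑ k, ‖db k (b j) z - db j (b k) z‖^2 - Lev B z (fun j => b j z)) * rexp (- B z) := by
    intro z
    gcongr
    rw [sub_eq_add_neg]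
    gcongr
    rw [neg_le_iff_add_nonneg, Finset.mul_sum, ← Finset.sum_add_distrib]
    refine Finset.sum_nonneg fun j _ => ?_
    rw [Finset.mul_sum, ← Finset.sum_add_distrib]
    refine Finset.sum_nonneg fun k _ => ?_
    linarith [re_aux (db k (b j) z) (db j (b k) z)]
  refine (fun h => ⟨h, integral_mono I2.re h (fun z => by exact (pw z).le.trans (pw2 z))⟩) ?_
  refine Continuous.integrable_of_hasCompactSupport ?_ ?_
  · refine Continuous.mul ?_ (by have := hB.continuous; fun_prop)
    refine Continuous.sub (Continuous.add ?_ ?_) ?_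
    · exact (continuous_finsetSum _ fun j _ => (δs j).continuous).norm.pow 2
    · exact continuous_const.mul (continuous_finsetSum _ fun j _ => continuous_finsetSum _ fun k _ => ((db_sm k (hb j)).continuous.sub (db_sm j (hb k)).continuous).norm.pow 2)
    · exact continuous_re.comp (continuous_finsetSum _ fun j _ => continuous_finsetSum _ fun k _ => ((dz_sm j (db_sm k hBc)).continuous.mul (hb j).continuous).mul (conj_sm (hb k)).continuous)
  · have hK : IsCompact (⋃ j, tsupport (b j)) := isCompact_iUnion fun j => cb j
    refine HasCompactSupport.intro hK fun z hz => ?_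
    simp only [mem_iUnion, not_exists] at hz
    simp [Lev, dz_zero _ (hz _), db_zero _ (hz _), image_eq_zero_of_notMem_tsupport (hz _)]
end twist


lemma tw_aux {η lam P R : ℝ} (hη : 0 < η) (hl : 0 < lam) (x y Z : ℂ) (hP : P = ‖x - y + Z / η‖^2) 
    (hR : R = ‖Z‖^2/η^2):
    η * P ≤ η * R + ‖Z‖^2 / lam + 2 * (η + lam) * (‖x‖^2 + ‖y‖^2) := by
  subst hP hR
  have h1 : ‖x - y + Z / η‖ ≤ ‖x‖ + ‖y‖ + ‖Z‖ / η := by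
    refine (norm_add_le _ _).trans ?_
    rw [norm_div, norm_real, Real.norm_of_nonneg hη.le]
    linarith [norm_sub_le x y]
  set a := ‖x‖; set c := ‖y‖; set q := ‖Z‖
  have h2 : ‖x - y + Z / η‖^2 ≤ (a + c + q/η)^2 := by gcongr
  have e : η * (q^2/η^2) = q^2/η := by field_simp
  rw [e]
  have h3 : η * (a + c + q/η)^2 ≤ q^2/η + q^2/lam + 2*(η+lam)*(a^2+c^2) := by
    have e1 : η * (a + c + q/η)^2 = η*(a+c)^2 + 2*(a+c)*q + q^2/η := by field_simp; ring
    have e2 : 2*(a+c)*q ≤ q^2/lam + lam*(a+c)^2 := by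
      have : 0 ≤ (q - lam*(a+c))^2/lam := by positivity
      have e3 : (q - lam*(a+c))^2/lam = q^2/lam + lam*(a+c)^2 - 2*(a+c)*q := by field_simp; ring
      linarith
    have e4 : (η+lam)*(a+c)^2 ≤ (η+lam)*(2*(a^2+c^2)) := by
      gcongr; nlinarith [sq_nonneg (a-c)]
    linarith
  nlinarith [mul_le_mul_of_nonneg_left h2 hη.le]

lemma twisted {k : ℕ} {A Ψ η lam om : 𝕍 (k+1) → ℝ} (hA : SMO A) (hΨ : SMO Ψ)
    (hη : SMO η) (hl : Continuous lam) (hom : Continuous om) (η1 : ∀ z, 1 ≤ η z) (l0 : ∀ z, 0 < lam z)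
    {b : Fin (k+1) → 𝕍 (k+1) → ℂ} (hb : ∀ j, SMO (b j)) (cb : ∀ j, HCS (b j))
    {U : Set (𝕍 (k+1))} (sb : ∀ j, tsupport (b j) ⊆ U)
    (hyp : ∀ z ∈ U, ∀ ξ : 𝕍 (k+1), om z * ∑ j : Fin k, ‖ξ j.succ‖^2 ≤
      η z * (Lev A z ξ + Lev Ψ z ξ) - Lev η z ξ - ‖dl η z ξ‖^2 / lam z - 2 * (η z + lam z) * ‖dl Ψ z ξ‖^2) :
    ∫ z, (om z * ∑ j : Fin k, ‖b j.succ z‖^2) * rexp (-(A z + Ψ z)) ≤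
    ∫ z, (2 * (η z + lam z) * ‖∑ j, (dz j (b j) z - dz j (fun z => (A z:ℂ)) z * b j z)‖^2 +
      (1/2) * (η z * ∑ j, ∑ k, ‖db k (b j) z - db j (b k) z‖^2)) * rexp (-(A z + Ψ z)) := by
  have η0 : ∀ z, 0 < η z := fun z => one_pos.trans_le (η1 z)
  have hlog : SMO (fun z => -rlog (η z)) := (hη.log (fun z => (η0 z).ne')).neg
  have hB : SMO (fun z => (A z + Ψ z) + (-rlog (η z))) := (hA.add hΨ).add hlog
  have hAc := ofReal_sm hA
  have hΨc := ofReal_sm hΨ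
  have hlc := ofReal_sm hlog
  obtain ⟨hI, key⟩ := basic_ineq hB hb cb
  have dG : ∀ z, ∀ᶠ t in 𝓝 (η z), HasDerivAt (fun t => -rlog t) (-t⁻¹) t := fun z => by
    filter_upwards [lt_mem_nhds (η0 z)] with t ht
    exact (Real.hasDerivAt_log ht.ne').neg
  have dG2 : ∀ z, HasDerivAt (fun t : ℝ => -t⁻¹) (1 / (η z)^2) (η z) := fun z => by
    have := (hasDerivAt_inv (η0 z).ne').neg
    rw [neg_neg, ← one_div] at this; exact this
  have eLev : ∀ z ξ, Lev (fun z => (A z + Ψ z) + (-rlog (η z))) z ξ = Lev A z ξ + Lev Ψ z ξ - (η z)⁻¹ * Lev η z ξ + ‖dl η z ξ‖^2/(η z)^2 := by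
    intro z ξ
    rw [Lev_add (hA.add hΨ) hlog, Lev_add hA hΨ, Lev_comp hη (dG z) (dG2 z)]; ring
  have ed : ∀ z, ∑ j, (dz j (b j) z - dz j (fun z => (((A z + Ψ z) + (-rlog (η z)) : ℝ):ℂ)) z * b j z)
      = ∑ j, (dz j (b j) z - dz j (fun z => (A z:ℂ)) z * b j z) - dl Ψ z (fun j => b j z) + dl η z (fun j => b j z) / η z := by
    intro z
    rw [dl, dl, Finset.sum_div, ← Finset.sum_sub_distrib, ← Finset.sum_add_distrib]
    refine Finset.sum_congr rfl fun j _ => ?_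
    have e0 : (fun z => (((A z + Ψ z) + (-rlog (η z)) : ℝ):ℂ)) = fun z => (fun z => ((A z : ℂ) + (Ψ z : ℂ))) z + ((-rlog (η z) : ℝ) : ℂ) := by ext; push_cast; rfl
    rw [e0, dz_add j (sm_da (hAc.add hΨc) z) (sm_da hlc z), dz_add j (sm_da hAc z) (sm_da hΨc z),
      dz_comp (G := fun t => -rlog t) j (hη.differentiable (by simp) z) (dG z).self_of_nhds]
    push_cast; ring
  have ew : ∀ z, rexp (-((A z + Ψ z) + (-rlog (η z)))) = η z * rexp (-(A z + Ψ z)) := by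
    intro z
    rw [show -((A z + Ψ z) + (-rlog (η z))) = rlog (η z) + -(A z + Ψ z) by ring, Real.exp_add, Real.exp_log (η0 z)]
  simp only [eLev, ed, ew] at key hI
  have hK : IsCompact (⋃ j, tsupport (b j)) := isCompact_iUnion fun j => cb j
  have cA : Continuous (fun z => rexp (-(A z + Ψ z))) := by have := hA.continuous; have := hΨ.continuous; fun_prop
  have cη := hη.continuous
  have cbb := fun j => (hb j).continuous
  have IL : Integrable (fun z => (om z * ∑ j : Fin k, ‖b j.succ z‖^2) * rexp (-(A z + Ψ z))) := by
    refine Continuous.integrable_of_hasCompactSupport (by fun_prop) (HasCompactSupport.intro hK fun z hz => ?_)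
    simp only [mem_iUnion, not_exists] at hz
    simp [image_eq_zero_of_notMem_tsupport (hz _)]
  have IR : Integrable (fun z => (2 * (η z + lam z) * ‖∑ j, (dz j (b j) z - dz j (fun z => (A z:ℂ)) z * b j z)‖^2 +
      (1/2) * (η z * ∑ j, ∑ k, ‖db k (b j) z - db j (b k) z‖^2)) * rexp (-(A z + Ψ z))) := by
    refine Continuous.integrable_of_hasCompactSupport ?_ (HasCompactSupport.intro hK fun z hz => ?_)
    · have := fun j => (dz_sm j (hb j)).continuous
      have := fun j k => (db_sm k (hb j)).continuous
      have := fun j => (dz_sm j hAc).continuous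
      fun_prop
    · simp only [mem_iUnion, not_exists] at hz
      simp [dz_zero _ (hz _), db_zero _ (hz _), image_eq_zero_of_notMem_tsupport (hz _)]
  rw [← sub_nonneg, ← integral_sub IR IL]
  refine key.trans ?_
  refine integral_mono hI (IR.sub IL) fun z => ?_
  simp only
  by_cases hz : ∃ j, z ∈ tsupport (b j)
  · obtain ⟨j, hj⟩ := hz
    have h1 := hyp z (sb j hj) (fun j => b j z)
    have h2 := tw_aux (η0 z) (l0 z) (∑ j, (dz j (b j) z - dz j (fun z => (A z:ℂ)) z * b j z)) (dl Ψ z (fun j => b j z)) (dl η z (fun j => b j z)) rfl rfl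
    rw [← sub_mul, ← mul_assoc]
    refine mul_le_mul_of_nonneg_right ?_ (Real.exp_pos _).le
    have e5 : (η z)⁻¹ * Lev η z (fun j => b j z) * η z = Lev η z (fun j => b j z) := by
      have := (η0 z).ne'; field_simp
    nlinarith [h1, h2, e5]
  · push Not at hz
    simp [dl, Lev, dz_zero _ (hz _), db_zero _ (hz _), image_eq_zero_of_notMem_tsupport (hz _)]


section moll
lemma cs_l {α : Type*} [MeasurableSpace α] {μ : Measure α} {f g : α → ℝ≥0∞} (hf : AEMeasurable f μ) (hg : AEMeasurable g μ) :
    (∫⁻ a, f a * g a ∂μ)^2 ≤ (∫⁻ a, f a ^ 2 ∂μ) * ∫⁻ a, g a ^ 2 ∂μ := by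
  have h := ENNReal.lintegral_mul_le_Lp_mul_Lq μ (Real.HolderConjugate.two_two) hf hg
  calc _ ≤ ((∫⁻ a, f a ^ (2:ℝ) ∂μ) ^ (1 / (2:ℝ)) * (∫⁻ a, g a ^ (2:ℝ) ∂μ) ^ (1 / (2:ℝ)))^2 := by gcongr; exact h
    _ = _ := by
      rw [mul_pow, ← ENNReal.rpow_natCast, ← ENNReal.rpow_natCast, ← ENNReal.rpow_mul, ← ENNReal.rpow_mul]
      norm_num

lemma en2 {α : Type*} [MeasurableSpace α] {μ : Measure α} {F : Type*} [NormedAddCommGroup F] (f : α → F) :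
    eLpNorm f 2 μ ^ 2 = ∫⁻ x, ‖f x‖ₑ ^ 2 ∂μ := by
  have := eLpNorm_nnreal_pow_eq_lintegral (f := f) (μ := μ) (p := 2) (by simp)
  norm_num at this
  exact_mod_cast this
lemma en2r {α : Type*} [MeasurableSpace α] {μ : Measure α} {F : Type*} [NormedAddCommGroup F] {f : α → F} (hf : MemLp f 2 μ) :
    ∫ x, ‖f x‖^2 ∂μ = (eLpNorm f 2 μ).toReal ^ 2 := by
  rw [← ENNReal.toReal_pow, en2, integral_eq_lintegral_of_nonneg_ae (ae_of_all _ fun x => by positivity)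
    ((hf.1.norm.aemeasurable.pow_const 2).aestronglyMeasurable)]
  congr 1
  refine lintegral_congr fun x => ?_
  rw [ENNReal.ofReal_pow (norm_nonneg _), ofReal_norm]

variable {n : ℕ}
noncomputable def moll (g : 𝕍 n → ℝ) (f : 𝕍 n → ℂ) (x : 𝕍 n) : ℂ := ∫ t, f t * (g (x - t) : ℂ)

lemma moll_eq (g : 𝕍 n → ℝ) (f : 𝕍 n → ℂ) :
    moll g f = MeasureTheory.convolution f (fun x => (g x : ℂ)) (ContinuousLinearMap.mul ℝ ℂ) volume := by
  ext x; simp [moll, MeasureTheory.convolution]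

variable {g : 𝕍 n → ℝ} {f : 𝕍 n → ℂ}
lemma cs_ofReal (gc : HCS g) : HCS (fun x => (g x : ℂ)) :=
  HasCompactSupport.comp_left (g := fun t : ℝ => (t : ℂ)) gc (by simp)
lemma moll_sm (gs : SMO g) (gc : HCS g) (hf : LocallyIntegrable f) : SMO (moll g f) := by
  rw [moll_eq]
  exact (cs_ofReal gc).contDiff_convolution_right _ hf (ofReal_sm gs)
lemma test_refl {h : 𝕍 n → ℂ} (hs : SMO h) (x : 𝕍 n) : SMO (fun t => h (x - t)) :=
  hs.comp (contDiff_const.sub contDiff_id)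
lemma cs_refl {h : 𝕍 n → ℂ} (hc : HCS h) (x : 𝕍 n) : HCS (fun t => h (x - t)) :=
  hc.comp_homeomorph (Homeomorph.subLeft x)
lemma fd_refl {h : 𝕍 n → ℂ} (hs : SMO h) (x t v : 𝕍 n) :
    fderiv ℝ (fun t => h (x - t)) t v = - fderiv ℝ h (x - t) v := by
  have := ((sm_da hs (x - t)).hasFDerivAt).comp t ((hasFDerivAt_const x t).sub (hasFDerivAt_id t))
  rw [show (fun t => h (x - t)) = h ∘ HSub.hSub x from rfl, this.fderiv]
  simp
lemma fd_moll (gs : SMO g) (gc : HCS g) (hf : LocallyIntegrable f) (x v : 𝕍 n) :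
    fderiv ℝ (moll g f) x v = - ∫ t, f t * fderiv ℝ (fun t => (g (x - t) : ℂ)) t v := by
  have hgs := ofReal_sm gs
  have h1 : SMO (fderiv ℝ (fun x => (g x:ℂ))) := hgs.fderiv_right (by simp)
  rw [moll_eq, ((cs_ofReal gc).hasFDerivAt_convolution_right (ContinuousLinearMap.mul ℝ ℂ) hf (hgs.of_le (by simp)) x).fderiv,
    convolution_precompR_apply _ hf ((cs_ofReal gc).fderiv (𝕜 := ℝ)) h1.continuous, MeasureTheory.convolution, ← integral_neg]
  refine integral_congr_ae (ae_of_all _ fun t => ?_)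
  simp only [ContinuousLinearMap.mul_apply']
  rw [fd_refl hgs]; simp
lemma fd_int (gs : SMO g) (gc : HCS g) (hf : LocallyIntegrable f) (x v : 𝕍 n) :
    Integrable (fun t => f t * fderiv ℝ (fun t => (g (x - t) : ℂ)) t v) := by
  have hgs := test_refl (ofReal_sm gs) x
  have h1 : SMO (fderiv ℝ (fun t => (g (x-t):ℂ))) := hgs.fderiv_right (by simp)
  have := hf.integrable_smul_left_of_hasCompactSupport (g := fun t => fderiv ℝ (fun t => (g (x-t):ℂ)) t v) (h1.continuous.clm_apply continuous_const)
   ((cs_refl (cs_ofReal gc) x).of_isClosed_subset (isClosed_tsupport _) (closure_minimal (tsupport_fd v) (isClosed_tsupport _)))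
  refine this.congr (ae_of_all _ fun t => ?_)
  simp [mul_comm]
lemma dz_moll (gs : SMO g) (gc : HCS g) (hf : LocallyIntegrable f) (x : 𝕍 n) (j : Fin n) :
    dz j (moll g f) x = - ∫ t, f t * dz j (fun t => (g (x - t) : ℂ)) t := by
  have e : ∀ t, f t * dz j (fun t => (g (x - t) : ℂ)) t = (1/2) * (f t * fderiv ℝ (fun t => (g (x - t) : ℂ)) t (Pi.single j 1) - I * (f t * fderiv ℝ (fun t => (g (x - t) : ℂ)) t (Pi.single j I))) := fun t => by
    rw [dz]; ring
  simp_rw [e]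
  rw [integral_const_mul, integral_sub (fd_int gs gc hf _ _) ((fd_int gs gc hf _ _).const_mul _), integral_const_mul, dz, fd_moll gs gc hf, fd_moll gs gc hf]
  ring
lemma db_moll (gs : SMO g) (gc : HCS g) (hf : LocallyIntegrable f) (x : 𝕍 n) (j : Fin n) :
    db j (moll g f) x = - ∫ t, f t * db j (fun t => (g (x - t) : ℂ)) t := by
  have e : ∀ t, f t * db j (fun t => (g (x - t) : ℂ)) t = (1/2) * (f t * fderiv ℝ (fun t => (g (x - t) : ℂ)) t (Pi.single j 1) + I * (f t * fderiv ℝ (fun t => (g (x - t) : ℂ)) t (Pi.single j I))) := fun t => by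
    rw [db]; ring
  simp_rw [e]
  rw [integral_const_mul, integral_add (fd_int gs gc hf _ _) ((fd_int gs gc hf _ _).const_mul _), integral_const_mul, db, fd_moll gs gc hf, fd_moll gs gc hf]
  ring

lemma moll_int (gs : SMO g) (gc : HCS g) (hf : LocallyIntegrable f) (x : 𝕍 n) :
    Integrable (fun t => f t * (g (x - t) : ℂ)) := by
  have := hf.integrable_smul_left_of_hasCompactSupport (test_refl (ofReal_sm gs) x).continuous (cs_refl (cs_ofReal gc) x)
  refine this.congr (ae_of_all _ fun t => by simp [mul_comm])

lemma moll_young (gs : SMO g) (gc : HCS g) (g0 : ∀ x, 0 ≤ g x) (g1 : ∫ x, g x = 1)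
    (hf : MemLp f 2) : eLpNorm (moll g f) 2 ≤ eLpNorm f 2 := by
  have gi : Integrable g := gs.continuous.integrable_of_hasCompactSupport gc
  have G1 : ∀ x, ∫⁻ t, ofR (g (x - t)) = 1 := fun x => by
    rw [lintegral_sub_left_eq_self (fun t => ofR (g t)) x,
      ← ofReal_integral_eq_lintegral_ofReal gi (ae_of_all _ g0), g1, ENNReal.ofReal_one]
  have G2 : ∀ t, ∫⁻ x, ofR (g (x - t)) = 1 := fun t => by
    rw [lintegral_sub_right_eq_self (fun t => ofR (g t)) t,
      ← ofReal_integral_eq_lintegral_ofReal gi (ae_of_all _ g0), g1, ENNReal.ofReal_one]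
  have key : eLpNorm (moll g f) 2 ^ 2 ≤ eLpNorm f 2 ^ 2 := by
    rw [en2, en2]
    have fm : AEMeasurable (fun t => ‖f t‖ₑ) := hf.1.enorm
    have gm := gs.continuous.measurable
    have step : ∀ x, ‖moll g f x‖ₑ ^ 2 ≤ ∫⁻ t, ‖f t‖ₑ ^ 2 * ofR (g (x - t)) := fun x => by
      have a1 : ‖moll g f x‖ₑ ≤ ∫⁻ t, (‖f t‖ₑ * ofR (√(g (x-t)))) * ofR (√(g (x-t))) := by
        refine (enorm_integral_le_lintegral_enorm _).trans (le_of_eq (lintegral_congr fun t => ?_))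
        rw [enorm_mul, mul_assoc, ← ENNReal.ofReal_mul (Real.sqrt_nonneg _), Real.mul_self_sqrt (g0 _)]
        congr 1
        rw [← ofReal_norm, norm_real, Real.norm_of_nonneg (g0 _)]
      have a2 := cs_l (μ := volume) (f := fun t => (‖f t‖ₑ * ofR (√(g (x-t))))) (g := fun t => ofR (√(g (x-t)))) (by fun_prop) (by fun_prop)
      have e1 : ∀ t, ofR (√(g (x-t))) ^ 2 = ofR (g (x-t)) := fun t => by
        rw [← ENNReal.ofReal_pow (Real.sqrt_nonneg _), Real.sq_sqrt (g0 _)]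
      simp only [mul_pow, e1, G1, mul_one] at a2
      exact (pow_le_pow_left' a1 2).trans a2
    calc _ ≤ ∫⁻ x, ∫⁻ t, ‖f t‖ₑ ^ 2 * ofR (g (x - t)) := lintegral_mono step
      _ = ∫⁻ t, ∫⁻ x, ‖f t‖ₑ ^ 2 * ofR (g (x - t)) := by
        refine lintegral_lintegral_swap ?_
        exact ((fm.pow_const 2).comp_snd).mul ((gm.comp (measurable_fst.sub measurable_snd)).ennreal_ofReal.aemeasurable)
      _ = _ := by
        refine lintegral_congr fun t => ?_
        rw [lintegral_const_mul _ (by fun_prop), G2, mul_one]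
  exact (ENNReal.pow_le_pow_left_iff (two_ne_zero)).1 key

lemma moll_supp {K : Set (𝕍 n)} {r : ℝ} (hg : ∀ x, r ≤ ‖x‖ → g x = 0) (hf : ∀ x ∉ K, f x = 0) :
    ∀ x ∉ cthickening r K, moll g f x = 0 := by
  intro x hx
  rw [moll, integral_eq_zero_of_ae]
  refine ae_of_all _ fun t => ?_
  by_cases ht : t ∈ K
  · have : r ≤ ‖x - t‖ := by
      by_contra h
      push Not at h
      exact hx (mem_cthickening_of_dist_le x t r K ht (by rw [dist_eq_norm]; exact h.le))
    simp [hg _ this]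
  · simp [hf t ht]

lemma moll_unif (gs : SMO g) (gc : HCS g) (g0 : ∀ x, 0 ≤ g x) (g1 : ∫ x, g x = 1)
    {r ε : ℝ} (hg : ∀ x, r ≤ ‖x‖ → g x = 0) (hf : LocallyIntegrable f) {x : 𝕍 n}
    (hfe : ∀ t, ‖x - t‖ < r → ‖f t - f x‖ ≤ ε) : ‖moll g f x - f x‖ ≤ ε := by
  have gi : Integrable g := gs.continuous.integrable_of_hasCompactSupport gc
  have i1 : ∫ t, g (x - t) = 1 := by rw [integral_sub_left_eq_self g volume x, g1]
  have gi' : Integrable (fun t => g (x - t)) := gi.comp_sub_left x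
  have e1 : f x = ∫ t, f x * (g (x - t) : ℂ) := by
    rw [integral_const_mul]; erw [integral_ofReal]; rw [i1]; simp
  have e2 : ‖moll g f x - f x‖ ≤ ∫ t, ε * g (x - t) := by
    rw [show moll g f x - f x = moll g f x - ∫ t, f x * (g (x - t) : ℂ) by rw [← e1], moll, ← integral_sub (moll_int gs gc hf x) (show Integrable (fun t => f x * (g (x - t) : ℂ)) from gi'.ofReal.const_mul _)]
    refine norm_integral_le_of_norm_le (gi'.const_mul ε) (ae_of_all _ fun t => ?_)
    rw [← sub_mul, norm_mul, norm_real, Real.norm_of_nonneg (g0 _)]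
    by_cases h : ‖x - t‖ < r
    · exact mul_le_mul_of_nonneg_right (hfe t h) (g0 _)
    · rw [hg _ (not_lt.1 h)]; simp
  rwa [integral_const_mul, i1, mul_one] at e2
end moll


section moll2
variable {n : ℕ}
structure IsMoll (g : 𝕍 n → ℝ) (r : ℝ) : Prop where
  sm : SMO g
  cs : HCS g
  nn : ∀ x, 0 ≤ g x
  one : ∫ x, g x = 1
  supp : ∀ x, r ≤ ‖x‖ → g x = 0
  inv : ∀ (x : 𝕍 n) (c : ℂ), ‖c‖ = 1 → g (c • x) = g x

lemma normSq_sm {E : Type*} [NormedAddCommGroup E] [NormedSpace ℝ E] {f : E → ℂ} (hf : SMO f) :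
    SMO (fun x => normSq (f x)) := by
  have h : (fun x => normSq (f x)) = fun x => reCLM (f x) * reCLM (f x) + imCLM (f x) * imCLM (f x) := by
    ext x; simp [normSq_apply]
  rw [h]
  have h1 := reCLM.contDiff (n := ∞).comp hf
  have h2 := imCLM.contDiff (n := ∞).comp hf
  exact (h1.mul h1).add (h2.mul h2)
lemma exists_moll {r : ℝ} (hr : 0 < r) : ∃ g : 𝕍 n → ℝ, IsMoll g r := by
  set ψ : 𝕍 n → ℝ := fun x => Real.smoothTransition (1 - (∑ i, normSq (x i)) / r^2) with hψ
  have cd : SMO ψ := by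
    refine Real.smoothTransition.contDiff.comp (contDiff_const.sub (ContDiff.div_const ?_ _))
    exact ContDiff.sum fun i _ => normSq_sm (contDiff_apply ℝ ℂ i)
  have sp : ∀ x, r ≤ ‖x‖ → ψ x = 0 := by
    intro x hx
    apply Real.smoothTransition.zero_of_nonpos
    have : r^2 ≤ ∑ i, normSq (x i) := by
      have h1 : ‖x‖ ≤ √(∑ i, normSq (x i)) := by
        rw [pi_norm_le_iff_of_nonneg (Real.sqrt_nonneg _)]
        intro i
        apply Real.le_sqrt_of_sq_le
        rw [← normSq_eq_norm_sq]
        exact Finset.single_le_sum (f := fun i => normSq (x i)) (fun i _ => normSq_nonneg _) (Finset.mem_univ i)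
      calc r^2 ≤ (√(∑ i, normSq (x i)))^2 := by gcongr; exact hx.trans h1
        _ = _ := Real.sq_sqrt (Finset.sum_nonneg fun i _ => normSq_nonneg _)
    have := (one_le_div (by positivity : 0 < r^2)).2 this
    linarith
  have cs : HCS ψ := HasCompactSupport.intro (isCompact_closedBall 0 r) fun x hx => by
    apply sp; simp at hx; exact hx.le
  have nn : ∀ x, 0 ≤ ψ x := fun x => Real.smoothTransition.nonneg _
  have pos : 0 < ∫ x, ψ x := by
    refine cd.continuous.integral_pos_of_hasCompactSupport_nonneg_nonzero cs nn (x := 0) ?_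
    simp [hψ]
  refine ⟨fun x => (∫ x, ψ x)⁻¹ * ψ x, contDiff_const.mul cd, cs.mul_left, fun x => mul_nonneg (inv_nonneg.2 pos.le) (nn x), ?_, fun x hx => by rw [sp x hx, mul_zero], ?_⟩
  · rw [integral_const_mul, inv_mul_cancel₀ pos.ne']
  · intro x c hc
    have : normSq c = 1 := by rw [normSq_eq_norm_sq, hc]; norm_num
    simp [hψ, this]

lemma memlp_li {f : 𝕍 n → ℂ} (hf : MemLp f 2) : LocallyIntegrable f :=
  hf.locallyIntegrable (by norm_num)

lemma moll_memlp {g : 𝕍 n → ℝ} {r : ℝ} {f} (hg : IsMoll g r) (hf : MemLp f 2) : MemLp (moll g f) 2 :=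
  ⟨(moll_sm hg.sm hg.cs (memlp_li hf)).continuous.aestronglyMeasurable,
    (moll_young hg.sm hg.cs hg.nn hg.one hf).trans_lt hf.2⟩

lemma moll_conv1 {g : ℕ → 𝕍 n → ℝ} {r : ℕ → ℝ} (hg : ∀ m, IsMoll (g m) (r m)) (hr : Tendsto r atTop (𝓝 0))
    {c : 𝕍 n → ℂ} (cc : HCS c) (ccont : Continuous c) (cm : MemLp c 2) {ε : ℝ≥0∞} (hε3 : ε ≠ 0) :
    ∃ N, ∀ m ≥ N, eLpNorm (moll (g m) c - c) 2 ≤ ε := by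
  obtain ⟨K, hKd⟩ : ∃ K, K = cthickening 1 (tsupport c) := ⟨_, rfl⟩
  have hK : IsCompact K := hKd ▸ cc.isCompact.cthickening
  have huc : UniformContinuous c := cc.uniformContinuous_of_continuous ccont
  obtain ⟨e, he0, he⟩ : ∃ e : ℝ, 0 < e ∧ ofR e * volume K ^ (1 / (2:ℝ≥0∞).toReal) ≤ ε := by
    obtain ⟨e, he0, he⟩ := ENNReal.exists_nnreal_pos_mul_lt (a := volume K ^ (1 / (2:ℝ≥0∞).toReal)) (b := ε) (ENNReal.rpow_ne_top_of_nonneg (by positivity) hK.measure_ne_top) hε3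
    refine ⟨e, he0, ?_⟩
    rw [ENNReal.ofReal_coe_nnreal]; exact he.le
  obtain ⟨δ, δ0, hδ⟩ := Metric.uniformContinuous_iff.1 huc e he0
  obtain ⟨N, hN⟩ := eventually_atTop.1 (hr.eventually (gt_mem_nhds (lt_min δ0 one_pos)))
  refine ⟨N, fun m hm => ?_⟩
  have hrm := hN m hm
  refine le_trans (eLpNorm_sub_le_of_dist_bdd volume (by norm_num) hK.measurableSet he0.le (fun x => ?_) ?_ ?_) he
  · rw [dist_eq_norm]
    refine moll_unif (hg m).sm (hg m).cs (hg m).nn (hg m).one (hg m).supp (memlp_li cm) fun t ht => ?_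
    rw [← dist_eq_norm]
    refine (hδ ?_).le
    rw [dist_comm, dist_eq_norm]
    exact ht.trans (hrm.trans_le (min_le_left _ _))
  · intro x hx
    by_contra h
    apply hx
    refine moll_supp (r := 1) (K := tsupport c) (fun y hy => (hg m).supp y (le_trans (hrm.le.trans (min_le_right _ _)) hy)) (fun y hy => image_eq_zero_of_notMem_tsupport hy) x (hKd ▸ h)
  · exact hKd ▸ (subset_tsupport c).trans (self_subset_cthickening _)

lemma moll_conv {g : ℕ → 𝕍 n → ℝ} {r : ℕ → ℝ} (hg : ∀ m, IsMoll (g m) (r m)) (hr : Tendsto r atTop (𝓝 0))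
    {f : 𝕍 n → ℂ} (hf : MemLp f 2) : Tendsto (fun m => eLpNorm (moll (g m) f - f) 2) atTop (𝓝 0) := by
  rw [ENNReal.tendsto_atTop_zero]
  intro ε hε
  have hε3 : ε / 3 ≠ 0 := (ENNReal.div_pos hε.ne' (by norm_num)).ne'
  obtain ⟨c, cc, hc, ccont, cm⟩ := hf.exists_hasCompactSupport_eLpNorm_sub_le (by norm_num) hε3
  obtain ⟨N, hN⟩ := moll_conv1 hg hr cc ccont cm hε3
  refine ⟨N, fun m hm => ?_⟩
  have h1 := hN m hm
  have e1 : moll (g m) f - f = (moll (g m) (f - c) + (moll (g m) c - c)) - (f - c) := by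
    have : moll (g m) (f - c) = moll (g m) f - moll (g m) c := by
      ext x
      simp only [moll, Pi.sub_apply, sub_mul]
      exact integral_sub (moll_int (hg m).sm (hg m).cs (memlp_li hf) x) (moll_int (hg m).sm (hg m).cs (memlp_li cm) x)
    rw [this]; abel
  have m1 := moll_memlp (hg m) (hf.sub cm)
  have m2 := (moll_memlp (hg m) cm).sub cm
  have h3 := (moll_young (hg m).sm (hg m).cs (hg m).nn (hg m).one (hf.sub cm)).trans hc
  rw [e1]
  have A := eLpNorm_sub_le (m1.add m2).1 (hf.sub cm).1 (p := 2) (by norm_num)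
  have B := eLpNorm_add_le m1.1 m2.1 (p := 2) (by norm_num)
  have C := ENNReal.add_thirds ε
  refine A.trans ?_
  rw [← C]
  exact add_le_add (B.trans (add_le_add h3 h1)) hc

structure TL (K : Set (𝕍 n)) (X : ℕ → 𝕍 n → ℂ) (Y : 𝕍 n → ℂ) : Prop where
  mX : ∀ m, MemLp (X m) 2
  mY : MemLp Y 2
  zX : ∀ m, ∀ x ∉ K, X m x = 0
  zY : ∀ x ∉ K, Y x = 0
  lim : Tendsto (fun m => eLpNorm (X m - Y) 2) atTop (𝓝 0)

variable {K : Set (𝕍 n)} {X X' : ℕ → 𝕍 n → ℂ} {Y Y' : 𝕍 n → ℂ}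
lemma memlp_cmul (hK : IsCompact K) {u : 𝕍 n → ℂ} (hu : Continuous u) :
    ∃ C : ℝ, 0 ≤ C ∧ ∀ {Y : 𝕍 n → ℂ}, MemLp Y 2 → (∀ x ∉ K, Y x = 0) →
      MemLp (fun x => u x * Y x) 2 ∧ eLpNorm (fun x => u x * Y x) 2 ≤ ofR C * eLpNorm Y 2 := by
  obtain ⟨C, hC⟩ := hK.exists_bound_of_continuousOn hu.continuousOn
  refine ⟨max C 0, le_max_right _ _, fun {Y} mY zY => ?_⟩
  have hb : ∀ x, ‖u x * Y x‖ ≤ max C 0 * ‖Y x‖ := fun x => by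
    by_cases hx : x ∈ K
    · rw [norm_mul]; gcongr; exact (hC x hx).trans (le_max_left _ _)
    · simp [zY x hx]
  exact ⟨mY.of_le_mul (hu.aestronglyMeasurable.mul mY.1) (ae_of_all _ hb), eLpNorm_le_mul_eLpNorm_of_ae_le_mul (ae_of_all _ hb) 2⟩
lemma TL.cmul (hK : IsCompact K) (h : TL K X Y) {u : 𝕍 n → ℂ} (hu : Continuous u) :
    TL K (fun m x => u x * X m x) (fun x => u x * Y x) := by
  obtain ⟨C, C0, hC⟩ := memlp_cmul hK hu
  refine ⟨fun m => (hC (h.mX m) (h.zX m)).1, (hC h.mY h.zY).1, fun m x hx => by simp [h.zX m x hx], fun x hx => by simp [h.zY x hx], ?_⟩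
  have e : ∀ m, eLpNorm ((fun x => u x * X m x) - fun x => u x * Y x) 2 ≤ ofR C * eLpNorm (X m - Y) 2 := fun m => by
    have := (hC (h.mX m |>.sub h.mY) (fun x hx => by simp [h.zX m x hx, h.zY x hx])).2
    refine le_trans (le_of_eq ?_) this
    congr 1; ext x; simp; ring
  have l := ENNReal.Tendsto.const_mul (a := ofR C) h.lim (Or.inr (by simp))
  rw [mul_zero] at l
  exact tendsto_of_tendsto_of_tendsto_of_le_of_le tendsto_const_nhds l (fun _ => zero_le) e
lemma TL.sub (h : TL K X Y) (h' : TL K X' Y') : TL K (fun m x => X m x - X' m x) (fun x => Y x - Y' x) := by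
  refine ⟨fun m => (h.mX m).sub (h'.mX m), h.mY.sub h'.mY, fun m x hx => by simp [h.zX m x hx, h'.zX m x hx], fun x hx => by simp [h.zY x hx, h'.zY x hx], ?_⟩
  have l := h.lim.add h'.lim
  rw [add_zero] at l
  refine tendsto_of_tendsto_of_tendsto_of_le_of_le tendsto_const_nhds l (fun _ => zero_le) (fun m => ?_)
  refine le_trans (le_of_eq ?_) (eLpNorm_sub_le ((h.mX m).sub h.mY).1 ((h'.mX m).sub h'.mY).1 (by norm_num))
  congr 1; ext x; simp; ring
lemma TL.zero : TL K (fun _ _ => 0) (fun _ => 0) :=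
  ⟨fun _ => MemLp.zero, MemLp.zero, fun _ _ _ => rfl, fun _ _ => rfl, by simp⟩
lemma TL.neg (h : TL K X Y) : TL K (fun m x => - X m x) (fun x => - Y x) := by
  simpa using TL.zero.sub h
lemma TL.add (h : TL K X Y) (h' : TL K X' Y') : TL K (fun m x => X m x + X' m x) (fun x => Y x + Y' x) := by
  simpa using h.sub h'.neg
lemma TL.sum {ι : Type*} (s : Finset ι) {X : ι → ℕ → 𝕍 n → ℂ} {Y : ι → 𝕍 n → ℂ} (h : ∀ i, TL K (X i) (Y i)) :
    TL K (fun m x => ∑ i ∈ s, X i m x) (fun x => ∑ i ∈ s, Y i x) := by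
  classical
  induction s using Finset.induction_on with
  | empty => simpa using TL.zero
  | insert a s ha ih => simpa [Finset.sum_insert ha] using (h a).add ih
lemma TL.int0 (h : TL K X Y) : Tendsto (fun m => ∫ x, ‖X m x‖^2) atTop (𝓝 (∫ x, ‖Y x‖^2)) := by
  have e : ∀ m, ∫ x, ‖X m x‖^2 = (eLpNorm (X m) 2).toReal ^ 2 := fun m => en2r (h.mX m)
  simp only [e, en2r h.mY]
  refine Tendsto.pow ?_ 2
  have l := (ENNReal.tendsto_toReal (a := 0) (by simp)).comp h.lim
  rw [tendsto_iff_norm_sub_tendsto_zero]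
  refine squeeze_zero (fun _ => norm_nonneg _) (fun m => ?_) l
  have f1 := (h.mX m).2.ne; have f2 := h.mY.2.ne; have f3 := ((h.mX m).sub h.mY).2.ne
  rw [Real.norm_eq_abs, abs_sub_le_iff]
  constructor
  · rw [sub_le_iff_le_add, Function.comp, ← ENNReal.toReal_add f3 f2]
    refine ENNReal.toReal_mono (ENNReal.add_ne_top.2 ⟨f3, f2⟩) ?_
    have := eLpNorm_add_le ((h.mX m).sub h.mY).1 h.mY.1 (p := 2) (by norm_num)
    rwa [sub_add_cancel] at this
  · rw [sub_le_iff_le_add, Function.comp, ← ENNReal.toReal_add f3 f1]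
    refine ENNReal.toReal_mono (ENNReal.add_ne_top.2 ⟨f3, f1⟩) ?_
    have := eLpNorm_sub_le (h.mX m).1 ((h.mX m).sub h.mY).1 (p := 2) (by norm_num)
    rw [sub_sub_cancel] at this
    rwa [add_comm]
lemma memlp_wint (hK : IsCompact K) (mY : MemLp Y 2) (zY : ∀ x ∉ K, Y x = 0) {w : 𝕍 n → ℝ} (hw : Continuous w) :
    Integrable (fun x => w x * ‖Y x‖^2) := by
  have i1 : Integrable (fun x => ‖Y x‖^2) := (memLp_two_iff_integrable_sq_norm mY.1).1 mY
  obtain ⟨C, hC⟩ := hK.exists_bound_of_continuousOn hw.continuousOn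
  refine (i1.const_mul C).mono (hw.aestronglyMeasurable.mul i1.1) (ae_of_all _ fun x => ?_)
  by_cases hx : x ∈ K
  · rw [norm_mul, norm_mul]; gcongr; exact (hC x hx).trans (le_abs_self C)
  · simp [zY x hx]
lemma TL.int (hK : IsCompact K) (h : TL K X Y) {w : 𝕍 n → ℝ} (hw : Continuous w) (w0 : ∀ x, 0 ≤ w x) :
    Tendsto (fun m => ∫ x, w x * ‖X m x‖^2) atTop (𝓝 (∫ x, w x * ‖Y x‖^2)) := by
  have := (h.cmul hK (u := fun x => ((√(w x) : ℝ) : ℂ)) (by fun_prop)).int0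
  have e : ∀ x (y : ℂ), ‖((√(w x) : ℝ) : ℂ) * y‖^2 = w x * ‖y‖^2 := fun x y => by
    rw [norm_mul, mul_pow, norm_real, Real.norm_of_nonneg (Real.sqrt_nonneg _), Real.sq_sqrt (w0 x)]
  simpa only [e] using this
lemma TL.moll {g : ℕ → 𝕍 n → ℝ} {r : ℕ → ℝ} (hg : ∀ m, IsMoll (g m) (r m)) (hr0 : ∀ m, 0 < r m) (hr : Tendsto r atTop (𝓝 0))
    {s : ℝ} (hs : ∀ m, r m ≤ s) (hY : MemLp Y 2) (zY : ∀ x ∉ K, Y x = 0) : TL (cthickening s K) (fun m => moll (g m) Y) Y :=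
  ⟨fun m => moll_memlp (hg m) hY, hY, fun m => moll_supp (fun x hx => (hg m).supp x ((hs m).trans hx)) zY,
   fun x hx => zY x fun h => hx (self_subset_cthickening _ h), moll_conv hg hr hY⟩
end moll2


section tweak
variable {k : ℕ}
lemma exists_rad {s : ℝ} (s0 : 0 < s) : ∃ r : ℕ → ℝ, (∀ m, 0 < r m) ∧ (∀ m, r m ≤ s) ∧ Tendsto r atTop (𝓝 0) :=
  ⟨fun m => s / (m + 1), fun m => by positivity, fun m => div_le_self s0.le (by norm_cast; omega), by
    simpa using (tendsto_one_div_add_atTop_nhds_zero_nat (𝕜 := ℝ)).const_mul s |>.congr fun m => by ring⟩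
lemma int_wsq {K : Set (𝕍 n)} (hK : IsCompact K) {ι : Type*} (s : Finset ι) {Y : ι → 𝕍 n → ℂ} (mY : ∀ i, MemLp (Y i) 2) (zY : ∀ i, ∀ x ∉ K, Y i x = 0) {w : 𝕍 n → ℝ} (hw : Continuous w) :
    Integrable (fun x => w x * ∑ i ∈ s, ‖Y i x‖^2) ∧ ∫ x, w x * ∑ i ∈ s, ‖Y i x‖^2 = ∑ i ∈ s, ∫ x, w x * ‖Y i x‖^2 := by
  simp only [Finset.mul_sum]
  exact ⟨integrable_finsetSum _ fun i _ => memlp_wint hK (mY i) (zY i) hw, integral_finsetSum _ fun i _ => memlp_wint hK (mY i) (zY i) hw⟩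

lemma TL.ints {K : Set (𝕍 n)} (hK : IsCompact K) {ι : Type*} (s : Finset ι) {X : ι → ℕ → 𝕍 n → ℂ} {Y : ι → 𝕍 n → ℂ} (h : ∀ i, TL K (X i) (Y i)) {w : 𝕍 n → ℝ} (hw : Continuous w) (w0 : ∀ x, 0 ≤ w x) :
    Tendsto (fun m => ∫ x, w x * ∑ i ∈ s, ‖X i m x‖^2) atTop (𝓝 (∫ x, w x * ∑ i ∈ s, ‖Y i x‖^2)) := by
  rw [(int_wsq hK s (fun i => (h i).mY) (fun i => (h i).zY) hw).2]
  simp only [fun m => (int_wsq hK s (fun i => (h i).mX m) (fun i => (h i).zX m) hw).2]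
  exact tendsto_finsetSum _ fun i _ => (h i).int hK hw w0

theorem twisted_weak {A Ψ η lam om : 𝕍 (k+1) → ℝ} (hA : SMO A) (hΨ : SMO Ψ)
    (hη : SMO η) (hl : Continuous lam) (hom : Continuous om) (η1 : ∀ z, 1 ≤ η z) (l0 : ∀ z, 0 < lam z) (om0 : ∀ z, 0 ≤ om z)
    {U K : Set (𝕍 (k+1))} (hU : IsOpen U) (hK : IsCompact K) (hKU : K ⊆ U)
    (hyp : ∀ z ∈ U, ∀ ξ : 𝕍 (k+1), om z * ∑ j : Fin k, ‖ξ j.succ‖^2 ≤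
        η z * (Lev A z ξ + Lev Ψ z ξ) - Lev η z ξ - ‖dl η z ξ‖^2 / lam z - 2 * (η z + lam z) * ‖dl Ψ z ξ‖^2)
    {b : Fin (k+1) → 𝕍 (k+1) → ℂ} {d : 𝕍 (k+1) → ℂ} {c : Fin (k+1) → Fin (k+1) → 𝕍 (k+1) → ℂ}
    (mb : ∀ j, MemLp (b j) 2) (zb : ∀ j, ∀ x ∉ K, b j x = 0)
    (md : MemLp d 2) (zd : ∀ x ∉ K, d x = 0)
    (mc : ∀ i j, MemLp (c i j) 2) (zc : ∀ i j, ∀ x ∉ K, c i j x = 0)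
    (hd : ∀ τ : 𝕍 (k+1) → ℂ, SMO τ → HCS τ → ∫ x, ∑ j, b j x * dz j τ x = - ∫ x, d x * τ x)
    (hc : ∀ i j, ∀ τ : 𝕍 (k+1) → ℂ, SMO τ → HCS τ →
      ∫ x, (b i x * db j τ x - b j x * db i τ x) = - ∫ x, c i j x * τ x) :
    ∫ z, (om z * ∑ j : Fin k, ‖b j.succ z‖^2) * rexp (-(A z + Ψ z)) ≤
      ∫ z, (2 * (η z + lam z) * ‖d z - ∑ j, dz j (fun z => (A z : ℂ)) z * b j z‖^2 + (1/2) * (η z * ∑ i, ∑ j, ‖c i j z‖^2)) * rexp (-(A z + Ψ z)) := by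
  obtain ⟨s, s0, hs⟩ := hK.exists_cthickening_subset_open hU hKU
  have hK' : IsCompact (cthickening s K) := hK.cthickening
  obtain ⟨r, r0, rs, rl⟩ := exists_rad s0
  choose g hg using fun m => exists_moll (n := k+1) (r0 m)
  have tb : ∀ j, TL (cthickening s K) (fun m => moll (g m) (b j)) (b j) := fun j => TL.moll hg r0 rl rs (mb j) (zb j)
  have td : TL (cthickening s K) (fun m => moll (g m) d) d := TL.moll hg r0 rl rs md zd
  have tc : ∀ i j, TL (cthickening s K) (fun m => moll (g m) (c i j)) (c i j) := fun i j => TL.moll hg r0 rl rs (mc i j) (zc i j)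
  have hdA : ∀ j, Continuous (dz j (fun z => (A z : ℂ))) := fun j => (dz_sm j (ofReal_sm hA)).continuous
  have te : TL (cthickening s K) (fun m z => moll (g m) d z - ∑ j, dz j (fun z => (A z : ℂ)) z * moll (g m) (b j) z) (fun z => d z - ∑ j, dz j (fun z => (A z : ℂ)) z * b j z) :=
    td.sub (TL.sum _ fun j => (tb j).cmul hK' (hdA j))
  have tsm : ∀ m x, SMO (fun t => ((g m (x - t) : ℝ) : ℂ)) := fun m x => test_refl (ofReal_sm (hg m).sm) x
  have tcs : ∀ m x, HCS (fun t => ((g m (x - t) : ℝ) : ℂ)) := fun m x => cs_refl (cs_ofReal (hg m).cs) x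
  have hdm : ∀ m x, ∑ j, dz j (moll (g m) (b j)) x = moll (g m) d x := by
    intro m x
    simp only [fun j => dz_moll (hg m).sm (hg m).cs (memlp_li (mb j)) x j]
    rw [Finset.sum_neg_distrib, ← integral_finsetSum, hd _ (tsm m x) (tcs m x)]
    · rw [neg_neg]; rfl
    · exact fun j _ => (memlp_li (mb j)).integrable_smul_right_of_hasCompactSupport (dz_sm j (tsm m x)).continuous (dz_cs j (tcs m x))
  have hcm : ∀ m x i j, db j (moll (g m) (b i)) x - db i (moll (g m) (b j)) x = moll (g m) (c i j) x := by
    intro m x i j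
    simp only [fun i j => db_moll (hg m).sm (hg m).cs (memlp_li (mb j)) x i]
    have : ∀ i j, Integrable (fun t => b j t * db i (fun t => ((g m (x - t) : ℝ) : ℂ)) t) := fun i j => (memlp_li (mb j)).integrable_smul_right_of_hasCompactSupport (db_sm i (tsm m x)).continuous (db_cs i (tcs m x))
    have e := hc i j _ (tsm m x) (tcs m x)
    rw [integral_sub (this j i) (this i j)] at e
    simp only [moll]
    linear_combination - e
  have key := fun m => twisted hA hΨ hη hl hom η1 l0 (b := fun j => moll (g m) (b j)) (U := U)
    (fun j => moll_sm (hg m).sm (hg m).cs (memlp_li (mb j)))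
    (fun j => HasCompactSupport.intro hK' ((tb j).zX m))
    (fun j => (closure_minimal (Function.support_subset_iff'.2 ((tb j).zX m)) hK'.isClosed).trans hs) hyp
  simp only [hcm] at key
  have e1 : ∀ z, rexp (-(A z + Ψ z)) > 0 := fun z => Real.exp_pos _
  have cE : Continuous fun z => rexp (-(A z + Ψ z)) := Real.continuous_exp.comp (hA.continuous.add hΨ.continuous).neg
  have w1 : Continuous fun z => om z * rexp (-(A z + Ψ z)) := hom.mul cE
  have w2 : Continuous fun z => 2 * (η z + lam z) * rexp (-(A z + Ψ z)) := (continuous_const.mul (hη.continuous.add hl)).mul cE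
  have w3 : Continuous fun z => (1/2) * η z * rexp (-(A z + Ψ z)) := (continuous_const.mul hη.continuous).mul cE
  have L1 := TL.ints hK' (Finset.univ) (fun j : Fin k => tb j.succ) w1 fun z => mul_nonneg (om0 z) (e1 z).le
  have L2 := te.int hK' w2 fun z => mul_nonneg (by linarith [η1 z, l0 z]) (e1 z).le
  have L3 := TL.ints hK' (Finset.univ) (fun p : Fin (k+1) × Fin (k+1) => tc p.1 p.2) w3 fun z => mul_nonneg (by linarith [η1 z]) (e1 z).le
  have split : ∀ (d' : 𝕍 (k+1) → ℂ) (c' : Fin (k+1) → Fin (k+1) → 𝕍 (k+1) → ℂ), MemLp d' 2 → (∀ x ∉ cthickening s K, d' x = 0) →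
      (∀ p : Fin (k+1) × Fin (k+1), MemLp (c' p.1 p.2) 2) → (∀ p : Fin (k+1) × Fin (k+1), ∀ x ∉ cthickening s K, c' p.1 p.2 x = 0) →
      ∫ z, (2 * (η z + lam z) * ‖d' z‖^2 + (1/2) * (η z * ∑ i, ∑ j, ‖c' i j z‖^2)) * rexp (-(A z + Ψ z)) =
      (∫ z, 2 * (η z + lam z) * rexp (-(A z + Ψ z)) * ‖d' z‖^2) + ∫ z, (1/2) * η z * rexp (-(A z + Ψ z)) * ∑ p : Fin (k+1) × Fin (k+1), ‖c' p.1 p.2 z‖^2 := by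
    intro d' c' md zd mc zc
    rw [← integral_add (memlp_wint hK' md zd w2) (int_wsq hK' Finset.univ mc zc w3).1]
    congr 1; ext z
    rw [Fintype.sum_prod_type]; ring
  rw [split _ _ te.mY te.zY (fun p => mc p.1 p.2) (fun p => (tc p.1 p.2).zY)]
  have e3 : ∀ (b' : Fin k → 𝕍 (k+1) → ℂ), ∫ z, (om z * ∑ j : Fin k, ‖b' j z‖^2) * rexp (-(A z + Ψ z)) = ∫ z, om z * rexp (-(A z + Ψ z)) * ∑ j : Fin k, ‖b' j z‖^2 := fun b' => by
    congr 1; ext z; ring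
  rw [e3]
  refine le_of_tendsto_of_tendsto' L1 (L2.add L3) fun m => ?_
  rw [← e3, ← split _ (fun i j => moll (g m) (c i j)) (te.mX m) (te.zX m) (fun p => (tc p.1 p.2).mX m) (fun p => (tc p.1 p.2).zX m)]
  refine le_of_le_of_eq (key m) ?_
  congr 1; ext z
  rw [Finset.sum_sub_distrib, hdm]
end tweak


section proj
lemma hilb_proj {H : Type*} [NormedAddCommGroup H] [InnerProductSpace ℂ H] [CompleteSpace H] (M : Submodule ℂ H) (v : H) :
    ∃ y ∈ Mᗮ, ∃ z ∈ Mᗮᗮ, v = y + z := Submodule.exists_add_mem_mem_orthogonal (K := Mᗮ) v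
variable {κ X : Type*} [Fintype κ] [MeasurableSpace X] {μ : Measure X}
lemma l2_inner {f g : X → ℂ} (hf : MemLp f 2 μ) (hg : MemLp g 2 μ) :
    inner ℂ (hf.toLp f) (hg.toLp g) = ∫ x, conj (f x) * g x ∂μ := by
  rw [L2.inner_def]
  refine integral_congr_ae ?_
  filter_upwards [hf.coeFn_toLp, hg.coeFn_toLp] with x h1 h2
  rw [h1, h2, RCLike.inner_apply, mul_comm]
noncomputable def vl {f : κ → X → ℂ} (hf : ∀ j, MemLp (f j) 2 μ) : PiLp 2 (fun _ : κ => Lp ℂ 2 μ) :=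
  WithLp.toLp 2 fun j => (hf j).toLp (f j)
lemma vl_inner {f g : κ → X → ℂ} (hf : ∀ j, MemLp (f j) 2 μ) (hg : ∀ j, MemLp (g j) 2 μ) :
    inner ℂ (vl hf) (vl hg) = ∑ j, ∫ x, conj (f j x) * g j x ∂μ := by
  rw [PiLp.inner_apply]
  exact Finset.sum_congr rfl fun j _ => l2_inner (hf j) (hg j)
lemma vl_norm {f : κ → X → ℂ} (hf : ∀ j, MemLp (f j) 2 μ) : ‖vl hf‖^2 = ∑ j, ∫ x, ‖f j x‖^2 ∂μ := by
  have h := vl_inner hf hf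
  rw [inner_self_eq_norm_sq_to_K] at h
  have e : ∀ j x, conj (f j x) * f j x = ((‖f j x‖^2 : ℝ) : ℂ) := fun j x => by
    rw [conj_mul']; push_cast; rfl
  have h2 : ∀ j, ∫ x, conj (f j x) * f j x ∂μ = ((∫ x, ‖f j x‖^2 ∂μ : ℝ) : ℂ) := fun j => by
    simp only [e]; exact integral_ofReal
  simp only [h2] at h
  apply Complex.ofReal_injective
  push_cast
  exact h
lemma vl_surj (x : PiLp 2 (fun _ : κ => Lp ℂ 2 μ)) : ∃ (y : κ → X → ℂ) (hy : ∀ j, MemLp (y j) 2 μ), vl hy = x := by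
  refine ⟨fun j => x j, fun j => Lp.memLp _, ?_⟩
  ext1 j
  simp [vl]
lemma proj_fun {ι : Type*} {m : ι → κ → X → ℂ} (hm : ∀ i j, MemLp (m i j) 2 μ) {f : κ → X → ℂ} (hf : ∀ j, MemLp (f j) 2 μ) :
    ∃ y : κ → X → ℂ, (∀ j, MemLp (y j) 2 μ) ∧ ∑ j, ∫ x, ‖y j x‖^2 ∂μ ≤ ∑ j, ∫ x, ‖f j x‖^2 ∂μ ∧
      (∀ i, ∑ j, ∫ x, conj (m i j x) * y j x ∂μ = 0) ∧
      ∀ v : κ → X → ℂ, (∀ j, MemLp (v j) 2 μ) → (∀ i, ∑ j, ∫ x, conj (m i j x) * v j x ∂μ = 0) →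
        ∑ j, ∫ x, conj (v j x) * y j x ∂μ = ∑ j, ∫ x, conj (v j x) * f j x ∂μ := by
  obtain ⟨M, hM⟩ : ∃ M : Submodule ℂ (PiLp 2 (fun _ : κ => Lp ℂ 2 μ)), M = Submodule.span ℂ (range fun i => vl (hm i)) := ⟨_, rfl⟩
  have hMo : ∀ v, v ∈ Mᗮ ↔ ∀ i, inner ℂ (vl (hm i)) v = 0 := by
    intro v
    rw [hM, Submodule.mem_orthogonal]
    constructor
    · exact fun h i => h _ (Submodule.subset_span ⟨i, rfl⟩)
    · intro h u hu
      induction hu using Submodule.span_induction with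
      | mem x hx => obtain ⟨i, rfl⟩ := hx; exact h i
      | zero => simp
      | add x y _ _ hx hy => rw [inner_add_left, hx, hy, add_zero]
      | smul a x _ hx => rw [inner_smul_left, hx, mul_zero]
  obtain ⟨y, hy, z, hz, e⟩ := hilb_proj M (vl hf)
  have hyz : inner ℂ y z = 0 := hz y hy
  obtain ⟨y, my, rfl⟩ := vl_surj y
  refine ⟨y, my, ?_, ?_, ?_⟩
  · rw [← vl_norm my, ← vl_norm hf, e, pow_two, pow_two, norm_add_sq_eq_norm_sq_add_norm_sq_of_inner_eq_zero _ _ hyz]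
    nlinarith [norm_nonneg z]
  · intro i; rw [← vl_inner]; exact (hMo _).1 hy i
  · intro v mv hv
    have h1 : vl mv ∈ Mᗮ := (hMo _).2 fun i => by rw [vl_inner]; exact hv i
    rw [← vl_inner mv my, ← vl_inner mv hf, e, inner_add_right, hz _ h1, add_zero]
end proj


section proja
def Test (τ : 𝕍 n → ℂ) : Prop := SMO τ ∧ HCS τ
lemma Test.memlp {τ : 𝕍 n → ℂ} (h : Test τ) : MemLp τ 2 := h.1.continuous.memLp_of_hasCompactSupport h.2
lemma Test.int {τ : 𝕍 n → ℂ} (h : Test τ) : Integrable τ := h.1.continuous.integrable_of_hasCompactSupport h.2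
lemma Test.dz {τ : 𝕍 n → ℂ} (h : Test τ) (j : Fin n) : Test (dz j τ) := ⟨dz_sm j h.1, dz_cs j h.2⟩
lemma Test.db {τ : 𝕍 n → ℂ} (h : Test τ) (j : Fin n) : Test (db j τ) := ⟨db_sm j h.1, db_cs j h.2⟩
lemma Test.mul {τ σ : 𝕍 n → ℂ} (h : Test τ) (hs : SMO σ) : Test (fun x => σ x * τ x) := ⟨hs.mul h.1, h.2.mul_left⟩
lemma Test.conj {τ : 𝕍 n → ℂ} (h : Test τ) : Test (fun x => conj (τ x)) := ⟨conj_sm h.1, h.2.comp_left (by simp)⟩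
lemma cs_sum {κ X : Type*} [Fintype κ] [MeasurableSpace X] {μ : Measure X} {f g : κ → X → ℂ} (hf : ∀ j, MemLp (f j) 2 μ) (hg : ∀ j, MemLp (g j) 2 μ) :
    ‖∑ j, ∫ x, conj (f j x) * g j x ∂μ‖^2 ≤ (∑ j, ∫ x, ‖f j x‖^2 ∂μ) * ∑ j, ∫ x, ‖g j x‖^2 ∂μ := by
  rw [← vl_inner hf hg, ← vl_norm hf, ← vl_norm hg, ← mul_pow]
  gcongr
  exact norm_inner_le_norm _ _
lemma conj_conj_fun (τ : 𝕍 n → ℂ) : (fun x => conj (conj (τ x))) = τ := by ext; simp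
lemma exp_sm {A : 𝕍 n → ℝ} (hA : SMO A) (c : ℝ) : SMO (fun x => 𝕖(c * A x)) :=
  ofReal_sm (Real.contDiff_exp.comp (contDiff_const.mul hA))
lemma db_anti {σ τ : 𝕍 n → ℂ} (hs : Test σ) (ht : Test τ) (i j : Fin n) :
    ∫ x, db j σ x * db i τ x = ∫ x, db i σ x * db j τ x := by
  have h1 := ibp_db i hs.1 (ht.db j).1 (ht.db j).2
  have h2 := ibp_db j hs.1 (ht.db i).1 (ht.db i).2
  have e : ∀ x, db i (db j τ) x = db j (db i τ) x := fun x => db_db_comm i j ht.1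
  simp only [e] at h1
  rw [h2] at h1
  simpa using h1
lemma proj_a {A : 𝕍 n → ℝ} (hA : SMO A) {α : Fin n → 𝕍 n → ℂ} (hα : ∀ j, Test (α j)) :
    ∃ y : Fin n → 𝕍 n → ℂ, (∀ j, MemLp (y j) 2) ∧ ∑ j, ∫ x, ‖y j x‖^2 ≤ ∑ j, ∫ x, ‖𝕖(1/2 * A x) * α j x‖^2 ∧
      (∀ τ, Test τ → ∑ j, ∫ x, dz j τ x * 𝕖(-1/2 * A x) * y j x = ∑ j, ∫ x, dz j τ x * α j x) ∧
      ∀ τ, Test τ → ∀ i j, ∫ x, 𝕖(1/2 * A x) * db j τ x * y i x = ∫ x, 𝕖(1/2 * A x) * db i τ x * y j x := by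
  have he := exp_sm hA
  obtain ⟨m, hm⟩ : ∃ m : (Fin n × Fin n × {τ : 𝕍 n → ℂ // Test τ}) → Fin n → 𝕍 n → ℂ, ∀ i j τ l x,
    m (i, j, τ) l x = (if l = i then 𝕖(1/2 * A x) * conj (db j τ.1 x) else 0) - (if l = j then 𝕖(1/2 * A x) * conj (db i τ.1 x) else 0) :=
    ⟨fun p l x => (if l = p.1 then 𝕖(1/2 * A x) * conj (db p.2.1 p.2.2.1 x) else 0) - (if l = p.2.1 then 𝕖(1/2 * A x) * conj (db p.1 p.2.2.1 x) else 0), fun _ _ _ _ _ => rfl⟩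
  have t1 : ∀ j (τ : {τ : 𝕍 n → ℂ // Test τ}), Test (fun x => 𝕖(1/2 * A x) * conj (db j τ.1 x)) := fun j τ => ((τ.2.db j).conj).mul (he _)
  have mm : ∀ p l, MemLp (m p l) 2 := by
    rintro ⟨i, j, τ⟩ l
    have e : m (i, j, τ) l = fun x => (if l = i then 𝕖(1/2 * A x) * conj (db j τ.1 x) else 0) - (if l = j then 𝕖(1/2 * A x) * conj (db i τ.1 x) else 0) := funext fun x => hm _ _ _ _ _
    rw [e]
    refine MemLp.sub (f := fun x => if l = i then 𝕖(1/2 * A x) * conj (db j τ.1 x) else 0) (g := fun x => if l = j then 𝕖(1/2 * A x) * conj (db i τ.1 x) else 0) ?_ ?_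
    · split_ifs
      · exact (t1 j τ).memlp
      · exact MemLp.zero
    · split_ifs
      · exact (t1 i τ).memlp
      · exact MemLp.zero
  have mi : ∀ i j τ (v : Fin n → 𝕍 n → ℂ), (∀ l, MemLp (v l) 2) → ∑ l, ∫ x, conj (m (i, j, τ) l x) * v l x =
      (∫ x, 𝕖(1/2 * A x) * db j τ.1 x * v i x) - ∫ x, 𝕖(1/2 * A x) * db i τ.1 x * v j x := by
    intro i j τ v mv
    have hi : ∀ j l, Integrable (fun x => 𝕖(1/2 * A x) * db j τ.1 x * v l x) := fun j l => (((τ.2.db j).mul (he _)).memlp.integrable_mul (mv l))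
    have e : ∀ l, ∫ x, conj (m (i, j, τ) l x) * v l x = (if l = i then ∫ x, 𝕖(1/2 * A x) * db j τ.1 x * v l x else 0) - (if l = j then ∫ x, 𝕖(1/2 * A x) * db i τ.1 x * v l x else 0) := by
      intro l
      simp only [hm]
      split_ifs <;> simp only [map_sub, map_mul, map_neg, conj_ofReal, conj_conj, map_zero, zero_mul, sub_zero, zero_sub, sub_mul, neg_mul, integral_zero, integral_neg]
      exact integral_sub (hi _ _) (hi _ _)
    simp only [e, Finset.sum_sub_distrib, Finset.sum_ite_eq', Finset.mem_univ, if_true]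
  obtain ⟨y, my, hy, h1, h2⟩ := proj_fun mm (f := fun j x => 𝕖(1/2 * A x) * α j x) (fun j => ((hα j).mul (he _)).memlp)
  refine ⟨y, my, hy, ?_, ?_⟩
  · intro τ hτ
    have := h2 (fun j x => 𝕖(-1/2 * A x) * db j (fun x => conj (τ x)) x) (fun j => ((hτ.conj.db j).mul (he _)).memlp) ?_
    · have ee : ∀ x, 𝕖(-1/2 * A x) * 𝕖(1/2 * A x) = 1 := fun x => by
        rw [← ofReal_mul, ← Real.exp_add]; ring_nf; simp
      have e1 : ∀ j x, conj (𝕖(-1/2 * A x) * db j (fun x => conj (τ x)) x) = dz j τ x * 𝕖(-1/2 * A x) := by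
        intro j x
        rw [map_mul, conj_ofReal, db_conj j (sm_da hτ.1 x), conj_conj, mul_comm]
      simp only [e1] at this
      rw [this]
      refine Finset.sum_congr rfl fun j _ => integral_congr_ae (ae_of_all _ fun x => ?_)
      linear_combination (dz j τ x * α j x) * ee x
    · rintro ⟨i, j, σ⟩
      rw [mi _ _ _ _ (fun j => ((hτ.conj.db j).mul (he _)).memlp)]
      have ee : ∀ x, 𝕖(1/2 * A x) * 𝕖(-1/2 * A x) = 1 := fun x => by
        rw [← ofReal_mul, ← Real.exp_add]; ring_nf; simp
      have e : ∀ i j x, 𝕖(1/2 * A x) * db j σ.1 x * (𝕖(-1/2 * A x) * db i (fun x => conj (τ x)) x) = db j σ.1 x * db i (fun x => conj (τ x)) x := fun i j x => by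
        linear_combination (db j σ.1 x * db i (fun x => conj (τ x)) x) * ee x
      simp only [e]
      rw [db_anti σ.2 hτ.conj, sub_self]
  · intro τ hτ i j
    have := h1 (i, j, ⟨τ, hτ⟩)
    rw [mi _ _ _ _ my] at this
    exact sub_eq_zero.1 this
end proja


section wk
variable {k : ℕ}
lemma int_add3 {f g h : 𝕍 n → ℂ} (hf : Integrable f) (hg : Integrable g) (hh : Integrable h) :
    ∫ x, (f x + (g x + h x)) = (∫ x, f x) + ((∫ x, g x) + ∫ x, h x) := by
  rw [← integral_add hg hh]; exact integral_add hf (hg.add hh)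
lemma dz_exp {A : 𝕍 n → ℝ} (hA : SMO A) (j : Fin n) (x : 𝕍 n) :
    dz j (fun x => 𝕖(1 * A x)) x = 𝕖(1 * A x) * dz j (fun x => (A x : ℂ)) x := by
  simp only [one_mul]
  exact dz_comp j (hA.differentiable (by simp) x) (Real.hasDerivAt_exp (A x))

lemma wk_div {A κ : 𝕍 n → ℝ} (hA : SMO A) (hκ : SMO κ)
    {α y : Fin n → 𝕍 n → ℂ} (hα : ∀ j, Test (α j)) (my : ∀ j, MemLp (y j) 2)
    (h1 : ∀ τ, Test τ → ∑ j, ∫ x, dz j τ x * 𝕖(-1/2 * A x) * y j x = ∑ j, ∫ x, dz j τ x * α j x)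
    {τ : 𝕍 n → ℂ} (hτ : Test τ) :
    ∫ x, ∑ j, ((κ x : ℂ) * 𝕖(1/2 * A x) * y j x) * dz j τ x =
    - ∫ x, ((κ x : ℂ) * 𝕖(1 * A x) * (∑ j, dz j (α j) x) + (∑ j, dz j (fun x => (κ x : ℂ)) x * 𝕖(1/2 * A x) * y j x) + ∑ j, dz j (fun x => (A x : ℂ)) x * ((κ x : ℂ) * 𝕖(1/2 * A x) * y j x)) * τ x := by
  have he := exp_sm hA
  have hk := ofReal_sm hκ
  have hAc := ofReal_sm hA
  have tm : Test (fun x => ((κ x : ℂ) * 𝕖(1 * A x)) * τ x) := hτ.mul (hk.mul (he 1))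
  have h := h1 _ tm
  have eA : ∀ x, 𝕖(1 * A x) * 𝕖(-1/2 * A x) = 𝕖(1/2 * A x) := fun x => by
    rw [← ofReal_mul, ← Real.exp_add]; ring_nf
  have ed : ∀ j x, dz j (fun x => ((κ x : ℂ) * 𝕖(1 * A x)) * τ x) x =
      (κ x : ℂ) * 𝕖(1 * A x) * dz j τ x + (dz j (fun x => (κ x : ℂ)) x + κ x * dz j (fun x => (A x : ℂ)) x) * 𝕖(1 * A x) * τ x := by
    intro j x
    rw [dz_mul j (sm_da (hk.mul (he 1)) x) (sm_da hτ.1 x), dz_mul j (sm_da hk x) (sm_da (he 1) x), dz_exp hA]; ring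
  have hb : ∀ j, ∫ x, dz j (fun x => ((κ x : ℂ) * 𝕖(1 * A x)) * τ x) x * α j x = - ∫ x, ((κ x : ℂ) * 𝕖(1 * A x) * τ x) * dz j (α j) x := by
    intro j
    rw [ibp_dz j tm.1 (hα j).1 (hα j).2, neg_neg]
  have T1 : ∀ j, Test (fun x => ((κ x : ℂ) * 𝕖(1/2 * A x)) * dz j τ x) := fun j => (hτ.dz j).mul (hk.mul (he _))
  have T2 : ∀ j, Test (fun x => ((dz j (fun x => (κ x : ℂ)) x) * 𝕖(1/2 * A x)) * τ x) := fun j => hτ.mul ((dz_sm j hk).mul (he _))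
  have T3 : ∀ j, Test (fun x => (dz j (fun x => (A x : ℂ)) x * ((κ x : ℂ) * 𝕖(1/2 * A x))) * τ x) := fun j => hτ.mul ((dz_sm j hAc).mul (hk.mul (he _)))
  have T4 : ∀ j, Test (fun x => ((κ x : ℂ) * 𝕖(1 * A x) * τ x) * dz j (α j) x) := fun j => ((hα j).dz j).mul tm.1
  have I1 := fun j => (T1 j).memlp.integrable_mul (my j)
  have I2 := fun j => (T2 j).memlp.integrable_mul (my j)
  have I3 := fun j => (T3 j).memlp.integrable_mul (my j)
  have I4 := fun j => (T4 j).int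
  simp only [hb, Finset.sum_neg_distrib] at h
  have e1 : ∀ j, ∫ x, dz j (fun x => ((κ x : ℂ) * 𝕖(1 * A x)) * τ x) x * 𝕖(-1/2 * A x) * y j x =
      (∫ x, ((κ x : ℂ) * 𝕖(1/2 * A x)) * dz j τ x * y j x) + ((∫ x, ((dz j (fun x => (κ x : ℂ)) x) * 𝕖(1/2 * A x)) * τ x * y j x) + ∫ x, (dz j (fun x => (A x : ℂ)) x * ((κ x : ℂ) * 𝕖(1/2 * A x))) * τ x * y j x) := by
    intro j
    have I1 := I1 j
    have I2 := I2 j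
    have I3 := I3 j
    simp only [Pi.mul_def] at I1 I2 I3
    rw [← int_add3 I1 I2 I3]
    refine integral_congr_ae (ae_of_all _ fun x => ?_)
    simp only
    rw [ed]
    linear_combination ((κ x : ℂ) * dz j τ x + (dz j (fun x => (κ x : ℂ)) x + κ x * dz j (fun x => (A x : ℂ)) x) * τ x) * y j x * eA x
  simp only [e1, Finset.sum_add_distrib] at h
  have J1 := integral_finsetSum Finset.univ (fun j _ => I1 j)
  have J2 := integral_finsetSum Finset.univ (fun j _ => I2 j)
  have J3 := integral_finsetSum Finset.univ (fun j _ => I3 j)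
  have J4 := integral_finsetSum Finset.univ (fun j _ => I4 j)
  simp only [Pi.mul_apply] at J1 J2 J3
  rw [← J1, ← J2, ← J3, ← J4] at h
  have K2 := integrable_finsetSum Finset.univ (fun j _ => I2 j)
  have K3 := integrable_finsetSum Finset.univ (fun j _ => I3 j)
  have K4 := integrable_finsetSum Finset.univ (fun j _ => I4 j)
  simp only [Pi.mul_apply] at K2 K3
  have L : ∫ x, ((κ x : ℂ) * 𝕖(1 * A x) * (∑ j, dz j (α j) x) + (∑ j, dz j (fun x => (κ x : ℂ)) x * 𝕖(1/2 * A x) * y j x) + ∑ j, dz j (fun x => (A x : ℂ)) x * ((κ x : ℂ) * 𝕖(1/2 * A x) * y j x)) * τ x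
    = (∫ x, ∑ j, ((κ x : ℂ) * 𝕖(1 * A x) * τ x) * dz j (α j) x) + ((∫ x, ∑ j, ((dz j (fun x => (κ x : ℂ)) x) * 𝕖(1/2 * A x)) * τ x * y j x) + ∫ x, ∑ j, (dz j (fun x => (A x : ℂ)) x * ((κ x : ℂ) * 𝕖(1/2 * A x))) * τ x * y j x) := by
    rw [← int_add3 K4 K2 K3]
    refine integral_congr_ae (ae_of_all _ fun x => ?_)
    simp only [Pi.add_apply, add_mul, Finset.mul_sum, Finset.sum_mul, ← Finset.sum_add_distrib]
    exact Finset.sum_congr rfl fun j _ => by ring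
  rw [L]
  have L1 : ∫ x, ∑ j, ((κ x : ℂ) * 𝕖(1/2 * A x) * y j x) * dz j τ x = ∫ x, ∑ j, ((κ x : ℂ) * 𝕖(1/2 * A x)) * dz j τ x * y j x :=
    integral_congr_ae (ae_of_all _ fun x => Finset.sum_congr rfl fun j _ => by ring)
  rw [L1]
  linear_combination h

lemma wk_curl {A κ : 𝕍 n → ℝ} (hA : SMO A) (hκ : SMO κ)
    {y : Fin n → 𝕍 n → ℂ} (my : ∀ j, MemLp (y j) 2)
    (h1 : ∀ τ, Test τ → ∀ i j, ∫ x, 𝕖(1/2 * A x) * db j τ x * y i x = ∫ x, 𝕖(1/2 * A x) * db i τ x * y j x)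
    {τ : 𝕍 n → ℂ} (hτ : Test τ) (i j : Fin n) :
    ∫ x, (((κ x : ℂ) * 𝕖(1/2 * A x) * y i x) * db j τ x - ((κ x : ℂ) * 𝕖(1/2 * A x) * y j x) * db i τ x) =
    - ∫ x, (db j (fun x => (κ x : ℂ)) x * (𝕖(1/2 * A x) * y i x) - db i (fun x => (κ x : ℂ)) x * (𝕖(1/2 * A x) * y j x)) * τ x := by
  have he := exp_sm hA (1/2)
  have hk := ofReal_sm hκ
  have h := h1 _ (hτ.mul hk) i j
  have I : ∀ i j, Integrable (fun x => 𝕖(1/2 * A x) * db j (fun x => (κ x : ℂ) * τ x) x * y i x) := fun i j =>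
    (((hτ.mul hk).db j).mul he).memlp.integrable_mul (my i)
  have T1 : ∀ j, Test (fun x => ((κ x : ℂ) * 𝕖(1/2 * A x)) * db j τ x) := fun j => (hτ.db j).mul (hk.mul he)
  have T2 : ∀ j, Test (fun x => (db j (fun x => (κ x : ℂ)) x * 𝕖(1/2 * A x)) * τ x) := fun j => hτ.mul ((db_sm j hk).mul he)
  have I1 := fun i j => (T1 j).memlp.integrable_mul (my i)
  have I2 := fun i j => (T2 j).memlp.integrable_mul (my i)
  simp only [Pi.mul_def] at I1 I2
  rw [← sub_eq_zero, ← integral_sub (I i j) (I j i)] at h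
  have e1 : ∫ x, (((κ x : ℂ) * 𝕖(1/2 * A x) * y i x) * db j τ x - ((κ x : ℂ) * 𝕖(1/2 * A x) * y j x) * db i τ x) = ∫ x, (((κ x : ℂ) * 𝕖(1/2 * A x)) * db j τ x * y i x - ((κ x : ℂ) * 𝕖(1/2 * A x)) * db i τ x * y j x) :=
    integral_congr_ae (ae_of_all _ fun x => by ring)
  have e2 : ∫ x, (db j (fun x => (κ x : ℂ)) x * (𝕖(1/2 * A x) * y i x) - db i (fun x => (κ x : ℂ)) x * (𝕖(1/2 * A x) * y j x)) * τ x =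
     ∫ x, ((db j (fun x => (κ x : ℂ)) x * 𝕖(1/2 * A x)) * τ x * y i x - (db i (fun x => (κ x : ℂ)) x * 𝕖(1/2 * A x)) * τ x * y j x) :=
    integral_congr_ae (ae_of_all _ fun x => by ring)
  rw [e1, e2, eq_neg_iff_add_eq_zero, ← h]
  refine (integral_add ((I1 i j).sub (I1 j i)) ((I2 i j).sub (I2 j i))).symm.trans ?_
  refine integral_congr_ae (ae_of_all _ fun x => ?_)
  simp only [Pi.sub_apply]
  rw [db_mul j (sm_da hk x) (sm_da hτ.1 x), db_mul i (sm_da hk x) (sm_da hτ.1 x)]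
  ring
end wk


section wkest
variable {k : ℕ}
lemma memlp_tmul {u y : 𝕍 n → ℂ} (hu : Continuous u) (hc : HCS u) (my : MemLp y 2) : MemLp (fun x => u x * y x) 2 := by
  obtain ⟨C, hC⟩ := hc.exists_bound_of_continuous hu
  exact my.of_le_mul (hu.aestronglyMeasurable.mul my.1) (ae_of_all _ fun x => by rw [norm_mul]; gcongr; exact hC x)

lemma alg_err {m : ℕ} (e : ℝ) (a y : Fin m → ℂ) (D : ℂ) (η l E : ℝ) (η1 : 1 ≤ η) (l0 : 0 < l) (E0 : 0 ≤ E) :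
    (2 * (η + l) * ‖D + ∑ j, a j * (e : ℂ) * y j‖^2 + (1/2) * (η * ∑ i, ∑ j, ‖conj (a j) * ((e : ℂ) * y i) - conj (a i) * ((e : ℂ) * y j)‖^2)) * E
    ≤ 4 * (η + l) * ‖D‖^2 * E + ((6 * η + 4 * l) * ∑ j, ‖a j‖^2) * (e^2 * E) * ∑ j, ‖y j‖^2 := by
  have h1 : ‖∑ j, a j * (e : ℂ) * y j‖^2 ≤ e^2 * ((∑ j, ‖a j‖^2) * ∑ j, ‖y j‖^2) := by
    have e1 : ∑ j, a j * (e : ℂ) * y j = e * ∑ j, a j * y j := by rw [Finset.mul_sum]; exact Finset.sum_congr rfl fun j _ => by ring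
    rw [e1, norm_mul, mul_pow, norm_real, Real.norm_eq_abs, sq_abs]
    gcongr
    calc ‖∑ j, a j * y j‖^2 ≤ (∑ j, ‖a j‖ * ‖y j‖)^2 := by gcongr; exact (norm_sum_le _ _).trans (le_of_eq (by simp))
      _ ≤ _ := Finset.sum_mul_sq_le_sq_mul_sq _ _ _
  have h2 : ‖D + ∑ j, a j * (e : ℂ) * y j‖^2 ≤ 2 * ‖D‖^2 + 2 * ‖∑ j, a j * (e : ℂ) * y j‖^2 := by
    have := norm_add_le D (∑ j, a j * (e : ℂ) * y j)
    nlinarith [norm_nonneg (D + ∑ j, a j * (e : ℂ) * y j), sq_nonneg (‖D‖ - ‖∑ j, a j * (e : ℂ) * y j‖)]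
  have h3 : ∑ i, ∑ j, ‖conj (a j) * ((e : ℂ) * y i) - conj (a i) * ((e : ℂ) * y j)‖^2 ≤ 4 * (e^2 * ((∑ j, ‖a j‖^2) * ∑ j, ‖y j‖^2)) := by
    have : ∀ i j, ‖conj (a j) * ((e : ℂ) * y i) - conj (a i) * ((e : ℂ) * y j)‖^2 ≤ 2 * e^2 * (‖y i‖^2 * ‖a j‖^2) + 2 * e^2 * (‖a i‖^2 * ‖y j‖^2) := by
      intro i j
      have t := norm_sub_le (conj (a j) * ((e : ℂ) * y i)) (conj (a i) * ((e : ℂ) * y j))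
      have p : ‖conj (a j) * ((e : ℂ) * y i)‖^2 = e^2 * (‖y i‖^2 * ‖a j‖^2) := by
        rw [norm_mul, norm_mul, norm_real, Real.norm_eq_abs, RCLike.norm_conj, mul_pow, mul_pow, sq_abs]; ring
      have q : ‖conj (a i) * ((e : ℂ) * y j)‖^2 = e^2 * (‖a i‖^2 * ‖y j‖^2) := by
        rw [norm_mul, norm_mul, norm_real, Real.norm_eq_abs, RCLike.norm_conj, mul_pow, mul_pow, sq_abs]; ring
      nlinarith [norm_nonneg (conj (a j) * ((e : ℂ) * y i) - conj (a i) * ((e : ℂ) * y j)), sq_nonneg (‖conj (a j) * ((e : ℂ) * y i)‖ - ‖conj (a i) * ((e : ℂ) * y j)‖)]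
    refine (Finset.sum_le_sum fun i _ => Finset.sum_le_sum fun j _ => this i j).trans (le_of_eq ?_)
    simp only [Finset.sum_add_distrib, ← Finset.mul_sum, ← Finset.sum_mul]
    ring
  have P : 2 * (η + l) * ‖D + ∑ j, a j * (e : ℂ) * y j‖^2 + (1/2) * (η * ∑ i, ∑ j, ‖conj (a j) * ((e : ℂ) * y i) - conj (a i) * ((e : ℂ) * y j)‖^2) ≤
      4 * (η + l) * ‖D‖^2 + (6 * η + 4 * l) * (e^2 * ((∑ j, ‖a j‖^2) * ∑ j, ‖y j‖^2)) := by
    have a1 := mul_le_mul_of_nonneg_left (h2.trans (by gcongr : _ ≤ 2 * ‖D‖^2 + 2 * (e^2 * ((∑ j, ‖a j‖^2) * ∑ j, ‖y j‖^2)))) (by linarith : 0 ≤ 2 * (η + l))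
    have a2 := mul_le_mul_of_nonneg_left h3 (by linarith : 0 ≤ η)
    linarith
  calc _ ≤ _ := mul_le_mul_of_nonneg_right P E0
    _ = _ := by ring

theorem wk_est {A Ψ η lam om κ : 𝕍 (k+1) → ℝ} (hA : SMO A) (hΨ : SMO Ψ)
    (hη : SMO η) (hl : Continuous lam) (hom : Continuous om) (η1 : ∀ z, 1 ≤ η z) (l0 : ∀ z, 0 < lam z) (om0 : ∀ z, 0 ≤ om z)
    {U K : Set (𝕍 (k+1))} (hU : IsOpen U) (hK : IsCompact K) (hKU : K ⊆ U)
    (hyp : ∀ z ∈ U, ∀ ξ : 𝕍 (k+1), om z * ∑ j : Fin k, ‖ξ j.succ‖^2 ≤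
        η z * (Lev A z ξ + Lev Ψ z ξ) - Lev η z ξ - ‖dl η z ξ‖^2 / lam z - 2 * (η z + lam z) * ‖dl Ψ z ξ‖^2)
    (hκ : SMO κ) (κK : ∀ x ∉ K, κ x = 0)
    {α y : Fin (k+1) → 𝕍 (k+1) → ℂ} (hα : ∀ j, Test (α j)) (my : ∀ j, MemLp (y j) 2)
    (κα : ∀ x, (κ x : ℂ) * ∑ j, dz j (α j) x = ∑ j, dz j (α j) x)
    (h1 : ∀ τ, Test τ → ∑ j, ∫ x, dz j τ x * 𝕖(-1/2 * A x) * y j x = ∑ j, ∫ x, dz j τ x * α j x)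
    (h2 : ∀ τ, Test τ → ∀ i j, ∫ x, 𝕖(1/2 * A x) * db j τ x * y i x = ∫ x, 𝕖(1/2 * A x) * db i τ x * y j x)
    {M : ℝ} (hM : ∀ x, ((6 * η x + 4 * lam x) * ∑ j, ‖dz j (fun x => (κ x : ℂ)) x‖^2) * rexp (-Ψ x) ≤ M) :
    ∫ z, (om z * ∑ j : Fin k, ‖(κ z : ℂ) * 𝕖(1/2 * A z) * y j.succ z‖^2) * rexp (-(A z + Ψ z)) ≤
      (∫ z, 4 * (η z + lam z) * ‖∑ j, dz j (α j) z‖^2 * rexp (A z - Ψ z)) + M * ∑ j, ∫ x, ‖y j x‖^2 := by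
  have he := exp_sm hA
  have hk := ofReal_sm hκ
  have hAc := ofReal_sm hA
  have kcs : HCS (fun x => (κ x : ℂ)) := HasCompactSupport.intro hK fun x hx => by simp [κK x hx]
  have kts : tsupport (fun x => (κ x : ℂ)) ⊆ K := closure_minimal (Function.support_subset_iff'.2 fun x hx => by simp [κK x hx]) hK.isClosed
  have Tk : Test (fun x => (κ x : ℂ)) := ⟨hk, kcs⟩
  have dzk : ∀ j, ∀ x ∉ K, dz j (fun x => (κ x : ℂ)) x = 0 := fun j x hx => dz_zero j fun h => hx (kts h)
  have dbk : ∀ j, ∀ x ∉ K, db j (fun x => (κ x : ℂ)) x = 0 := fun j x hx => db_zero j fun h => hx (kts h)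
  have mb : ∀ j, MemLp (fun x => (κ x : ℂ) * 𝕖(1/2 * A x) * y j x) 2 := fun j =>
    memlp_tmul (hk.mul (he _)).continuous kcs.mul_right (my j)
  have mdk : ∀ j, MemLp (fun x => dz j (fun x => (κ x : ℂ)) x * 𝕖(1/2 * A x) * y j x) 2 := fun j =>
    memlp_tmul ((Tk.dz j).1.mul (he _)).continuous (Tk.dz j).2.mul_right (my j)
  have mdb : ∀ i j, MemLp (fun x => db j (fun x => (κ x : ℂ)) x * (𝕖(1/2 * A x) * y i x)) 2 := fun i j => by
    have := memlp_tmul ((Tk.db j).1.mul (he (1/2))).continuous (Tk.db j).2.mul_right (my i)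
    simpa only [mul_assoc] using this
  have mAb : ∀ j, MemLp (fun x => dz j (fun x => (A x : ℂ)) x * ((κ x : ℂ) * 𝕖(1/2 * A x) * y j x)) 2 := fun j => by
    have := memlp_tmul (u := fun x => dz j (fun x => (A x : ℂ)) x * ((κ x : ℂ) * 𝕖(1/2 * A x))) ((dz_sm j hAc).mul (hk.mul (he _))).continuous (kcs.mul_right.mul_left) (my j)
    simpa only [mul_assoc] using this
  have mD : MemLp (fun x => (κ x : ℂ) * 𝕖(1 * A x) * ∑ j, dz j (α j) x) 2 := by
    simp only [Finset.mul_sum]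
    exact memLp_finsetSum _ fun j _ => (((hα j).dz j).mul (hk.mul (he _))).memlp
  have md := (mD.add (memLp_finsetSum Finset.univ fun j _ => mdk j)).add (memLp_finsetSum Finset.univ fun j _ => mAb j)
  have key := twisted_weak hA hΨ hη hl hom η1 l0 om0 hU hK hKU hyp
    (b := fun j x => (κ x : ℂ) * 𝕖(1/2 * A x) * y j x)
    (d := fun x => (κ x : ℂ) * 𝕖(1 * A x) * (∑ j, dz j (α j) x) + (∑ j, dz j (fun x => (κ x : ℂ)) x * 𝕖(1/2 * A x) * y j x) + ∑ j, dz j (fun x => (A x : ℂ)) x * ((κ x : ℂ) * 𝕖(1/2 * A x) * y j x))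
    (c := fun i j x => db j (fun x => (κ x : ℂ)) x * (𝕖(1/2 * A x) * y i x) - db i (fun x => (κ x : ℂ)) x * (𝕖(1/2 * A x) * y j x))
    mb (fun j x hx => by simp [κK x hx]) md (fun x hx => by simp [κK x hx, dzk _ x hx]) (fun i j => (mdb i j).sub (mdb j i))
    (fun i j x hx => by simp [dbk _ x hx])
    (fun τ h h' => wk_div hA hκ hα my h1 ⟨h, h'⟩) (fun i j τ h h' => wk_curl hA hκ my h2 ⟨h, h'⟩ i j)
  refine key.trans ?_
  have I1 : Integrable (fun z => 4 * (η z + lam z) * ‖∑ j, dz j (α j) z‖^2 * rexp (A z - Ψ z)) := by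
    refine Continuous.integrable_of_hasCompactSupport ?_ ?_
    · have c1 : Continuous fun z => ∑ j, dz j (α j) z := continuous_finsetSum _ fun j _ => ((hα j).dz j).1.continuous
      exact ((continuous_const.mul (hη.continuous.add hl)).mul (c1.norm.pow 2)).mul (Real.continuous_exp.comp (hA.continuous.sub hΨ.continuous))
    · refine HasCompactSupport.mul_right (HasCompactSupport.mul_left ?_)
      have : HCS fun z => ∑ j, dz j (α j) z := HasCompactSupport.intro hK fun x hx => by rw [← κα, κK x hx]; simp
      exact this.comp_left (g := fun w => ‖w‖^2) (by simp)
  have I2 : Integrable (fun z => M * ∑ j, ‖y j z‖^2) := (integrable_finsetSum _ fun j _ => (my j).integrable_norm_pow (by norm_num)).const_mul M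
  rw [← integral_finsetSum _ fun j _ => (my j).integrable_norm_pow (by norm_num), ← integral_const_mul, ← integral_add I1 I2]
  refine integral_mono_of_nonneg (ae_of_all _ fun x => ?_) (I1.add I2) (ae_of_all _ fun x => ?_)
  · have := η1 x
    have := l0 x
    simp only [Pi.zero_apply]
    positivity
  · simp only [Pi.add_apply]
    have dbr : ∀ j, db j (fun x => (κ x : ℂ)) x = conj (dz j (fun x => (κ x : ℂ)) x) := fun j => db_real j (hκ.differentiable (by simp) x)
    simp only [dbr, add_sub_cancel_right]
    refine (alg_err (rexp (1/2 * A x)) (fun j => dz j (fun x => (κ x : ℂ)) x) (fun j => y j x) _ (η x) (lam x) _ (η1 x) (l0 x) (Real.exp_pos _).le).trans ?_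
    have e1 : rexp (1/2 * A x)^2 * rexp (-(A x + Ψ x)) = rexp (-Ψ x) := by
      rw [← Real.exp_nat_mul, ← Real.exp_add]; congr 1; push_cast; ring
    rw [e1]
    refine add_le_add (le_of_eq ?_) ?_
    · rw [mul_right_comm (κ x : ℂ), κα, norm_mul, norm_real, Real.norm_of_nonneg (Real.exp_pos _).le]
      have e2 : rexp (1 * A x)^2 * rexp (-(A x + Ψ x)) = rexp (A x - Ψ x) := by
        rw [← Real.exp_nat_mul, ← Real.exp_add]; congr 1; push_cast; ring
      rw [← e2]; ring
    · gcongr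
      exact hM x
end wkest


section tdual
variable {k : ℕ}
lemma sq_ofR_mul (a : ℝ) (w : ℂ) : ‖(a : ℂ) * w‖^2 = a^2 * ‖w‖^2 := by
  rw [norm_mul, mul_pow, norm_real, Real.norm_eq_abs, sq_abs]

lemma hyp_tw {φ ρ η lam om : 𝕍 (k+1) → ℝ} (hφ : SMO φ) (hρ : SMO ρ)
    {c N : ℝ} (c0 : 0 ≤ c) (hN : 0 ≤ N) {z ξ : 𝕍 (k+1)} (η1 : 1 ≤ η z) (l0 : 0 < lam z) (hc : c^2 * (η z + lam z) ≤ 1)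
    (h1 : 0 ≤ Lev ρ z ξ) (h2 : 0 ≤ Lev φ z ξ)
    (h3 : om z * ∑ j : Fin k, ‖ξ j.succ‖^2 ≤ - Lev η z ξ - ‖dl η z ξ‖^2 / lam z) :
    om z * ∑ j : Fin k, ‖ξ j.succ‖^2 ≤
        η z * (Lev (fun z => φ z + rexp (N * ρ z)) z ξ + Lev (fun z => c * rexp (N / 2 * ρ z)) z ξ) - Lev η z ξ - ‖dl η z ξ‖^2 / lam z - 2 * (η z + lam z) * ‖dl (fun z => c * rexp (N / 2 * ρ z)) z ξ‖^2 := by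
  have d1 : ∀ (a b t : ℝ), HasDerivAt (fun t => a * rexp (b * t)) (a * b * rexp (b * t)) t := fun a b t => by
    have := (((hasDerivAt_id t).const_mul b).exp).const_mul a
    refine HasDerivAt.congr_deriv (f := fun t => a * rexp (b * t)) this ?_
    simp only [id, mul_one]; ring
  have e1 : Lev (fun z => φ z + rexp (N * ρ z)) z ξ = Lev φ z ξ + (N * rexp (N * ρ z) * Lev ρ z ξ + N * N * rexp (N * ρ z) * ‖dl ρ z ξ‖^2) := by
    have hs : SMO (fun z => rexp (N * ρ z)) := Real.contDiff_exp.comp (contDiff_const.mul hρ)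
    rw [Lev_add hφ hs]
    congr 1
    exact Lev_comp hρ (G := fun t => rexp (N * t)) (G1 := fun t => N * rexp (N * t)) (Eventually.of_forall fun t => by simpa using d1 1 N t) (d1 N N _) ξ
  have e2 : Lev (fun z => c * rexp (N / 2 * ρ z)) z ξ = c * (N/2) * rexp (N/2 * ρ z) * Lev ρ z ξ + c * (N/2) * (N/2) * rexp (N/2 * ρ z) * ‖dl ρ z ξ‖^2 :=
    Lev_comp hρ (G := fun t => c * rexp (N/2 * t)) (G1 := fun t => c * (N/2) * rexp (N/2 * t)) (Eventually.of_forall fun t => d1 c (N/2) t) (d1 (c * (N/2)) (N/2) _) ξ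
  have e3 : ‖dl (fun z => c * rexp (N / 2 * ρ z)) z ξ‖^2 = c^2 * (N^2/4) * rexp (N * ρ z) * ‖dl ρ z ξ‖^2 := by
    rw [dl_comp hρ (d1 c (N/2) (ρ z)), sq_ofR_mul]
    have : rexp (N * ρ z) = rexp (N/2 * ρ z)^2 := by rw [← Real.exp_nat_mul]; congr 1; push_cast; ring
    rw [this]; ring
  rw [e1, e2, e3]
  have p1 : 0 ≤ η z * (Lev φ z ξ + N * rexp (N * ρ z) * Lev ρ z ξ) := by positivity
  have p2 : 0 ≤ η z * (c * (N/2) * rexp (N/2 * ρ z) * Lev ρ z ξ + c * (N/2) * (N/2) * rexp (N/2 * ρ z) * ‖dl ρ z ξ‖^2) := by positivity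
  have p3 : 2 * (η z + lam z) * (c^2 * (N^2/4) * rexp (N * ρ z) * ‖dl ρ z ξ‖^2) ≤ η z * (N * N * rexp (N * ρ z) * ‖dl ρ z ξ‖^2) := by
    have q : 0 ≤ N * N * rexp (N * ρ z) * ‖dl ρ z ξ‖^2 := by positivity
    calc _ = (c^2 * (η z + lam z)) / 2 * (N * N * rexp (N * ρ z) * ‖dl ρ z ξ‖^2) := by ring
      _ ≤ η z * (N * N * rexp (N * ρ z) * ‖dl ρ z ξ‖^2) := by gcongr; linarith
  linarith

set_option maxHeartbeats 400000 in
theorem tdualN {φ ρ η lam om κ κ2 : 𝕍 (k+1) → ℝ} (hφ : SMO φ) (hρ : SMO ρ)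
    (hη : SMO η) (hl : Continuous lam) (hom : Continuous om) (η1 : ∀ z, 1 ≤ η z) (l0 : ∀ z, 0 < lam z) (om0 : ∀ z, 0 < om z)
    (hK : IsCompact {z | ρ z ≤ 1})
    (hyp1 : ∀ z, ρ z < 1 → ∀ ξ, 0 ≤ Lev ρ z ξ) (hyp2 : ∀ z, ρ z < 1 → ∀ ξ, 0 ≤ Lev φ z ξ)
    (hyp3 : ∀ z, ρ z < 1 → ∀ ξ : 𝕍 (k+1), om z * ∑ j : Fin k, ‖ξ j.succ‖^2 ≤ - Lev η z ξ - ‖dl η z ξ‖^2 / lam z)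
    {h0 : 𝕍 (k+1) → ℂ} (Th : Test h0) (hh0 : ∀ z, ρ z < 1 → db 0 h0 z = 0) {Cg : ℝ}
    (hCg : ∫ z in {z | ρ z < 1}, (om z)⁻¹ * (∑ j : Fin k, ‖db j.succ h0 z‖^2) * rexp (- φ z) ≤ Cg)
    {α : Fin (k+1) → 𝕍 (k+1) → ℂ} (hα : ∀ j, Test (α j)) (sα : ∀ j, tsupport (α j) ⊆ {z | ρ z < 0})
    {N c M0 : ℝ} (hN : 0 ≤ N) (c0 : 0 ≤ c) (c1 : c ≤ 1) (hc : ∀ z, ρ z < 1 → c^2 * (η z + lam z) ≤ 1)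
    (sκ : SMO κ) (κ0 : ∀ x, 2/3 ≤ ρ x → κ x = 0) (κ1 : ∀ x, ρ x ≤ 1/3 → κ x = 1) (κn : ∀ x, 0 ≤ κ x) (κu : ∀ x, κ x ≤ 1)
    (sκ2 : SMO κ2) (κ20 : ∀ x, 1 ≤ ρ x → κ2 x = 0) (κ21 : ∀ x, ρ x ≤ 2/3 → κ2 x = 1) (κ2n : ∀ x, 0 ≤ κ2 x) (κ2u : ∀ x, κ2 x ≤ 1)
    (hM0 : ∀ x, (6 * η x + 4 * lam x) * ∑ j, ‖dz j (fun x => (κ x : ℂ)) x‖^2 ≤ M0) :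
    ‖∑ j, ∫ x, conj (db j h0 x) * α j x‖ ≤
      √((rexp 1 * Cg) * (4 * rexp 1 * (∫ z, (η z + lam z) * ‖∑ j, dz j (α j) z‖^2 * rexp (φ z)) + M0 * rexp (-(c * rexp (N / 6))) * ∑ j, ∫ x, rexp (φ x + 1) * ‖α j x‖^2)) +
      √(((∑ j, ∫ x, rexp (- φ x) * ‖db j h0 x‖^2) * rexp (-rexp (N / 3))) * ∑ j, ∫ x, rexp (φ x + 1) * ‖α j x‖^2) := by
  have hA : SMO (fun z => φ z + rexp (N * ρ z)) := hφ.add (Real.contDiff_exp.comp (contDiff_const.mul hρ))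
  have hΨ : SMO (fun z => c * rexp (N / 2 * ρ z)) := contDiff_const.mul (Real.contDiff_exp.comp (contDiff_const.mul hρ))
  obtain ⟨A, eA⟩ : ∃ A : 𝕍 (k+1) → ℝ, A = (fun z => φ z + rexp (N * ρ z)) := ⟨_, rfl⟩
  obtain ⟨Ψ, eΨ⟩ : ∃ A : 𝕍 (k+1) → ℝ, A = (fun z => c * rexp (N / 2 * ρ z)) := ⟨_, rfl⟩
  have hyp : ∀ z ∈ {z | ρ z < 1}, ∀ ξ : 𝕍 (k+1), om z * ∑ j : Fin k, ‖ξ j.succ‖^2 ≤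
        η z * (Lev A z ξ + Lev Ψ z ξ) - Lev η z ξ - ‖dl η z ξ‖^2 / lam z - 2 * (η z + lam z) * ‖dl Ψ z ξ‖^2 := fun z hz ξ => by
    rw [eA, eΨ]
    exact hyp_tw hφ hρ c0 hN (η1 z) (l0 z) (hc z hz) (hyp1 z hz ξ) (hyp2 z hz ξ) (hyp3 z hz ξ)
  rw [← eA] at hA
  rw [← eΨ] at hΨ
  have eAx : ∀ x, A x = φ x + rexp (N * ρ x) := fun x => by rw [eA]
  have eΨx : ∀ x, Ψ x = c * rexp (N / 2 * ρ x) := fun x => by rw [eΨ]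
  have esq : ∀ x, rexp (N * ρ x) = rexp (N/2 * ρ x)^2 := fun x => by rw [← Real.exp_nat_mul]; congr 1; push_cast; ring
  have Ψ0 : ∀ x, 0 ≤ Ψ x := fun x => by rw [eΨx]; positivity
  have hE := exp_sm hA
  have hEΨ := exp_sm hΨ
  have oU : IsOpen {z | ρ z < 1} := isOpen_lt hρ.continuous continuous_const
  have cK : IsCompact {z | ρ z ≤ 2/3} := hK.of_isClosed_subset (isClosed_le hρ.continuous continuous_const) fun z (hz : ρ z ≤ 2/3) => (show ρ z ≤ 1 by linarith)
  have kcs : HCS (fun x => (κ x : ℂ)) := HasCompactSupport.intro cK fun x hx => by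
    rw [κ0 x (by simp only [mem_ofPred_eq, not_le] at hx; exact hx.le)]; simp
  have k2cs : HCS (fun x => (κ2 x : ℂ)) := HasCompactSupport.intro hK fun x hx => by
    rw [κ20 x (by simp only [mem_ofPred_eq, not_le] at hx; exact hx.le)]; simp
  have hk := ofReal_sm sκ
  have hk2 := ofReal_sm sκ2
  obtain ⟨y, my, hy, y1, y2⟩ := proj_a hA hα
  have α0 : ∀ j x, 0 ≤ ρ x → α j x = 0 := fun j x hx => image_eq_zero_of_notMem_tsupport fun h => by
    have := sα j h; simp only [mem_ofPred_eq] at this; linarith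
  have dα0 : ∀ j x, 0 ≤ ρ x → dz j (α j) x = 0 := fun j x hx => dz_zero j fun h => by
    have := sα j h; simp only [mem_ofPred_eq] at this; linarith
  have X1 : ∀ x, ρ x < 0 → rexp (N * ρ x) ≤ 1 := fun x hx => Real.exp_le_one_iff.2 (mul_nonpos_of_nonneg_of_nonpos hN hx.le)
  have hY : ∑ j, ∫ x, ‖y j x‖^2 ≤ ∑ j, ∫ x, rexp (φ x + 1) * ‖α j x‖^2 := by
    refine hy.trans (Finset.sum_le_sum fun j _ => integral_mono_of_nonneg (ae_of_all _ fun x => by positivity) ?_ (ae_of_all _ fun x => ?_))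
    · refine Continuous.integrable_of_hasCompactSupport ((Real.continuous_exp.comp (hφ.continuous.add continuous_const)).mul ((hα j).1.continuous.norm.pow 2)) ?_
      exact ((hα j).2.comp_left (g := fun w => ‖w‖^2) (by simp)).mul_left
    · dsimp only
      rw [sq_ofR_mul, ← Real.exp_nat_mul]
      by_cases hx : ρ x < 0
      · gcongr
        have := X1 x hx
        rw [eAx]; push_cast; linarith
      · rw [α0 j x (not_lt.1 hx)]; simp
  have Y0 : 0 ≤ ∑ j, ∫ x, ‖y j x‖^2 := Finset.sum_nonneg fun j _ => integral_nonneg fun x => by positivity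
  have M00 : 0 ≤ M0 := by
    have := hM0 0
    have := η1 0
    have := l0 0
    refine le_trans ?_ (hM0 0)
    positivity
  have est := wk_est hA hΨ hη hl hom η1 l0 (fun z => (om0 z).le) oU cK (fun z (hz : ρ z ≤ 2/3) => (show ρ z < 1 by linarith)) hyp sκ
    (fun x hx => κ0 x (by simp only [mem_ofPred_eq, not_le] at hx; exact hx.le)) hα my (fun x => by
      by_cases hx : ρ x < 0
      · rw [κ1 x (by linarith)]; simp
      · simp [dα0 _ x (not_lt.1 hx)]) y1 y2 (M := M0 * rexp (-(c * rexp (N / 6)))) (fun x => by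
      by_cases hx : ρ x < 1/3
      · have : ∀ j, dz j (fun x => (κ x : ℂ)) x = 0 := fun j => by
          have ev : (fun x => (κ x : ℂ)) =ᶠ[𝓝 x] fun _ => (1:ℂ) := by
            filter_upwards [(isOpen_lt hρ.continuous continuous_const).mem_nhds hx] with t ht
            rw [κ1 t (le_of_lt ht)]; simp
          rw [dz_congr j ev, dz_const]
        simp only [this]
        simp
        positivity
      · have := hM0 x
        gcongr
        rw [eΨx]
        gcongr
        rw [not_lt] at hx
        nlinarith)
  have T1 : (∫ z, 4 * (η z + lam z) * ‖∑ j, dz j (α j) z‖^2 * rexp (A z - Ψ z)) ≤ 4 * rexp 1 * ∫ z, (η z + lam z) * ‖∑ j, dz j (α j) z‖^2 * rexp (φ z) := by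
    rw [← integral_const_mul]
    refine integral_mono_of_nonneg (ae_of_all _ fun x => ?_) ?_ (ae_of_all _ fun x => ?_)
    · have := η1 x
      have := l0 x
      simp only [Pi.zero_apply]
      positivity
    · refine Continuous.integrable_of_hasCompactSupport ?_ ?_
      · have c1 : Continuous fun z => ∑ j, dz j (α j) z := continuous_finsetSum _ fun j _ => ((hα j).dz j).1.continuous
        exact continuous_const.mul (((hη.continuous.add hl).mul (c1.norm.pow 2)).mul (Real.continuous_exp.comp hφ.continuous))
      · refine HasCompactSupport.mul_left (HasCompactSupport.mul_right (HasCompactSupport.mul_left ?_))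
        have : HCS fun z => ∑ j, dz j (α j) z := HasCompactSupport.intro hK fun x hx => by
          refine Finset.sum_eq_zero fun j _ => dα0 j x ?_
          simp only [mem_ofPred_eq, not_le] at hx; linarith
        exact this.comp_left (g := fun w => ‖w‖^2) (by simp)
    · dsimp only
      have h1 := η1 x
      have h2 := l0 x
      by_cases hx : ρ x < 0
      · have : rexp (A x - Ψ x) ≤ rexp 1 * rexp (φ x) := by
          rw [← Real.exp_add]; gcongr
          have := X1 x hx
          have := Ψ0 x
          rw [eAx]; linarith
        calc _ ≤ 4 * (η x + lam x) * ‖∑ j, dz j (α j) x‖^2 * (rexp 1 * rexp (φ x)) := by gcongr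
          _ = _ := by ring
      · simp [dα0 _ x (not_lt.1 hx)]
  have est2 := est.trans (add_le_add T1 (mul_le_mul_of_nonneg_left hY (by positivity)))
  have mg : ∀ j, Continuous (db j h0) := fun j => (Th.db j).1.continuous
  have soc : Continuous fun x => √(om x) := Real.continuous_sqrt.comp hom
  have sop : ∀ x, 0 < √(om x) := fun x => Real.sqrt_pos.2 (om0 x)
  have ec : ∀ (a b : ℝ), Continuous fun x => 𝕖(a * A x + b * Ψ x) := fun a b =>
    continuous_ofReal.comp (Real.continuous_exp.comp ((continuous_const.mul hA.continuous).add (continuous_const.mul hΨ.continuous)))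
  have mp : ∀ j : Fin k, MemLp (fun x => ((κ2 x : ℝ) : ℂ) * (((((√(om x))⁻¹ : ℝ)) : ℂ) * 𝕖(-1/2 * A x + 1/2 * Ψ x) * db j.succ h0 x)) 2 := fun j =>
    Continuous.memLp_of_hasCompactSupport (hk2.continuous.mul (((continuous_ofReal.comp (soc.inv₀ fun x => (sop x).ne')).mul (ec _ _)).mul (mg _))) (k2cs.mul_right)
  have mq : ∀ j : Fin k, MemLp (fun x => (((√(om x) : ℝ) : ℂ) * 𝕖(-1/2 * A x + (-1/2) * Ψ x) * ((κ x : ℂ) * 𝕖(1/2 * A x))) * y j.succ x) 2 := fun j =>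
    memlp_tmul (((continuous_ofReal.comp soc).mul (ec _ _)).mul (hk.continuous.mul (hE _).continuous)) ((kcs.mul_right).mul_left) (my _)
  have cs1 := cs_sum mp mq
  have mr : ∀ j, MemLp (fun x => 𝕖(-1/2 * A x) * ((1 - (κ x : ℂ)) * db j h0 x)) 2 := fun j =>
    Continuous.memLp_of_hasCompactSupport ((hE _).continuous.mul ((continuous_const.sub hk.continuous).mul (mg j))) ((Th.db j).2.mul_left.mul_left)
  have cs2 := cs_sum mr my
  have kk : ∀ x, κ2 x * κ x = κ x := fun x => by
    by_cases hx : ρ x ≤ 2/3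
    · rw [κ21 x hx, one_mul]
    · rw [κ0 x (not_le.1 hx).le, mul_zero]
  have dec : ∑ j, ∫ x, conj (db j h0 x) * α j x = (∑ j : Fin k, ∫ x, conj (((κ2 x : ℝ) : ℂ) * (((((√(om x))⁻¹ : ℝ)) : ℂ) * 𝕖(-1/2 * A x + 1/2 * Ψ x) * db j.succ h0 x)) *
      ((((√(om x) : ℝ) : ℂ) * 𝕖(-1/2 * A x + (-1/2) * Ψ x) * ((κ x : ℂ) * 𝕖(1/2 * A x))) * y j.succ x)) +
      ∑ j, ∫ x, conj (𝕖(-1/2 * A x) * ((1 - (κ x : ℂ)) * db j h0 x)) * y j x := by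
    have h := y1 _ Th.conj
    have e : ∀ j x, dz j (fun x => conj (h0 x)) x = conj (db j h0 x) := fun j x => dz_conj j (sm_da Th.1 x)
    simp only [e] at h
    rw [← h]
    have s1 : ∀ j, Integrable (fun x => conj (𝕖(-1/2 * A x) * ((1 - (κ x : ℂ)) * db j h0 x)) * y j x) := fun j => MemLp.integrable_mul (p := 2) (q := 2) (mr j).star (my j)
    have mk' : ∀ j, MemLp (fun x => (κ x : ℂ) * (𝕖(-1/2 * A x) * conj (db j h0 x))) 2 := fun j =>
      Continuous.memLp_of_hasCompactSupport (hk.continuous.mul ((hE _).continuous.mul (continuous_conj.comp (mg j)))) kcs.mul_right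
    have s2 : ∀ j, Integrable (fun x => (κ x : ℂ) * (𝕖(-1/2 * A x) * conj (db j h0 x)) * y j x) := fun j => MemLp.integrable_mul (p := 2) (q := 2) (mk' j) (my j)
    have s3 : ∀ j, ∫ x, conj (db j h0 x) * 𝕖(-1/2 * A x) * y j x = (∫ x, (κ x : ℂ) * (𝕖(-1/2 * A x) * conj (db j h0 x)) * y j x) +
        ∫ x, conj (𝕖(-1/2 * A x) * ((1 - (κ x : ℂ)) * db j h0 x)) * y j x := fun j => by
      rw [← integral_add (s2 j) (s1 j)]
      congr 1; ext x
      simp only [map_mul, map_sub, map_one, conj_ofReal]; ring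
    simp only [s3, Finset.sum_add_distrib]
    congr 1
    rw [Fin.sum_univ_succ]
    have z0 : ∫ x, (κ x : ℂ) * (𝕖(-1/2 * A x) * conj (db 0 h0 x)) * y 0 x = 0 := by
      refine (integral_congr_ae (ae_of_all _ fun x => ?_)).trans (integral_zero _ _)
      by_cases hx : ρ x < 1
      · rw [hh0 x hx]; simp
      · rw [κ0 x (by linarith)]; simp
    rw [z0, zero_add]
    refine Finset.sum_congr rfl fun j _ => ?_
    congr 1; ext x
    simp only [map_mul, conj_ofReal]
    have r1 : (κ x : ℂ) * 𝕖(-1/2 * A x) = ((κ2 x * (√(om x))⁻¹ * rexp (-1/2 * A x + 1/2 * Ψ x) * (√(om x) * rexp (-1/2 * A x + (-1/2) * Ψ x) * (κ x * rexp (1/2 * A x))) : ℝ) : ℂ) := by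
      rw [← ofReal_mul]
      congr 1
      calc κ x * rexp (-1/2 * A x) = κ2 x * κ x * (rexp (-1/2 * A x + 1/2 * Ψ x) * rexp (-1/2 * A x + (-1/2) * Ψ x) * rexp (1/2 * A x)) := by
            rw [kk, ← Real.exp_add, ← Real.exp_add]; congr 2; ring
        _ = _ := by have := (sop x).ne'; field_simp
    rw [← mul_assoc, r1]
    push_cast
    ring
  rw [dec]
  refine (norm_add_le _ _).trans (add_le_add (Real.le_sqrt_of_sq_le (cs1.trans ?_)) (Real.le_sqrt_of_sq_le (cs2.trans ?_)))
  · refine mul_le_mul ?_ ?_ (Finset.sum_nonneg fun j _ => integral_nonneg fun x => by positivity) ?_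
    · rw [← integral_finsetSum _ fun j _ => (mp j).integrable_norm_pow (by norm_num)]
      have ion : IntegrableOn (fun z => (om z)⁻¹ * (∑ j : Fin k, ‖db j.succ h0 z‖^2) * rexp (- φ z)) {z | ρ z < 1} := by
        refine Integrable.integrableOn (Continuous.integrable_of_hasCompactSupport ?_ ?_)
        · exact ((hom.inv₀ fun x => (om0 x).ne').mul (continuous_finsetSum _ fun j _ => (mg _).norm.pow 2)).mul (Real.continuous_exp.comp hφ.continuous.neg)
        · refine HasCompactSupport.mul_right (HasCompactSupport.mul_left (HasCompactSupport.intro Th.2 fun x hx => Finset.sum_eq_zero fun j _ => ?_))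
          rw [db_zero _ hx]; simp
      refine le_trans ?_ (mul_le_mul_of_nonneg_left hCg (Real.exp_pos 1).le)
      rw [← integral_const_mul, ← integral_indicator oU.measurableSet]
      refine integral_mono_of_nonneg (ae_of_all _ fun x => by simp only [Pi.zero_apply]; positivity) ((integrable_indicator_iff oU.measurableSet).2 (ion.const_mul _)) (ae_of_all _ fun x => ?_)
      dsimp only
      by_cases hx : ρ x < 1
      · rw [indicator_of_mem (show x ∈ {z | ρ z < 1} from hx)]
        have f1 : ∀ j : Fin k, ‖((κ2 x : ℝ) : ℂ) * (((((√(om x))⁻¹ : ℝ)) : ℂ) * 𝕖(-1/2 * A x + 1/2 * Ψ x) * db j.succ h0 x)‖^2 = κ2 x^2 * ((om x)⁻¹ * (rexp (-A x + Ψ x) * ‖db j.succ h0 x‖^2)) := fun j => by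
          rw [sq_ofR_mul, mul_assoc, sq_ofR_mul, sq_ofR_mul, inv_pow, Real.sq_sqrt (om0 x).le, ← Real.exp_nat_mul]
          congr 4; push_cast; ring
        simp only [f1, ← Finset.mul_sum]
        have f2 : rexp (-A x + Ψ x) ≤ rexp 1 * rexp (-φ x) := by
          rw [← Real.exp_add, eAx, eΨx, esq]
          apply Real.exp_le_exp.2
          have := Real.exp_pos (N/2 * ρ x)
          nlinarith [sq_nonneg (rexp (N/2 * ρ x) - c/2)]
        have f3 : κ2 x^2 ≤ 1 := pow_le_one₀ (κ2n x) (κ2u x)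
        have om0' := om0 x
        calc _ ≤ 1 * ((om x)⁻¹ * (rexp 1 * rexp (-φ x) * ∑ j : Fin k, ‖db j.succ h0 x‖^2)) := by gcongr
          _ = _ := by ring
      · rw [indicator_of_notMem (show x ∉ {z | ρ z < 1} from hx), κ20 x (not_lt.1 hx)]; simp
    · refine le_trans (le_of_eq ?_) est2
      rw [← integral_finsetSum _ fun j _ => (mq j).integrable_norm_pow (by norm_num)]
      congr 1; ext x
      rw [Finset.mul_sum, Finset.sum_mul]
      refine Finset.sum_congr rfl fun j _ => ?_
      rw [mul_assoc _ _ (y j.succ x), mul_assoc, sq_ofR_mul, sq_ofR_mul, Real.sq_sqrt (om0 x).le, ← Real.exp_nat_mul]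
      have : ((2:ℕ):ℝ) * (-1/2 * A x + (-1/2) * Ψ x) = -(A x + Ψ x) := by push_cast; ring
      rw [this]; ring
    · have : 0 ≤ Cg := le_trans (integral_nonneg fun x => by have := om0 x; simp only [Pi.zero_apply]; positivity) hCg
      positivity
  · refine mul_le_mul ?_ hY Y0 (mul_nonneg (Finset.sum_nonneg fun j _ => integral_nonneg fun x => by positivity) (Real.exp_pos _).le)
    rw [Finset.sum_mul]
    refine Finset.sum_le_sum fun j _ => ?_
    rw [← integral_mul_const]
    refine integral_mono_of_nonneg (ae_of_all _ fun x => by simp only [Pi.zero_apply]; positivity) ?_ (ae_of_all _ fun x => ?_)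
    · refine Integrable.mul_const (Continuous.integrable_of_hasCompactSupport ((Real.continuous_exp.comp hφ.continuous.neg).mul ((mg j).norm.pow 2)) ?_) _
      exact HasCompactSupport.intro Th.2 fun x hx => by simp [db_zero _ hx]
    · dsimp only
      have g1 : 1 - (κ x : ℂ) = ((1 - κ x : ℝ) : ℂ) := by push_cast; ring
      rw [sq_ofR_mul, ← Real.exp_nat_mul, g1, sq_ofR_mul]
      have g2 : ((2:ℕ):ℝ) * (-1/2 * A x) = -φ x + -rexp (N * ρ x) := by rw [eAx]; push_cast; ring
      rw [g2, Real.exp_add]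
      by_cases hx : ρ x ≤ 1/3
      · rw [κ1 x hx]; simp; positivity
      · have g3 : (1 - κ x)^2 ≤ 1 := pow_le_one₀ (by linarith [κu x]) (by linarith [κn x])
        have g4 : rexp (-rexp (N * ρ x)) ≤ rexp (-rexp (N/3)) := by gcongr; rw [not_le] at hx; nlinarith
        calc _ ≤ rexp (-φ x) * rexp (-rexp (N/3)) * (1 * ‖db j h0 x‖^2) := by gcongr
          _ = _ := by ring
end tdual


section tdual2
variable {k : ℕ}
lemma st_facts {ρ : 𝕍 n → ℝ} (hρ : SMO ρ) (a : ℝ) :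
    SMO (fun x => Real.smoothTransition (a - 3 * ρ x)) ∧ (∀ x, a/3 ≤ ρ x → Real.smoothTransition (a - 3 * ρ x) = 0) ∧
    (∀ x, ρ x ≤ (a-1)/3 → Real.smoothTransition (a - 3 * ρ x) = 1) :=
  ⟨Real.smoothTransition.contDiff.comp (contDiff_const.sub (contDiff_const.mul hρ)), fun x hx => Real.smoothTransition.zero_of_nonpos (by linarith),
    fun x hx => Real.smoothTransition.one_of_one_le (by linarith)⟩

theorem tdual {φ ρ η lam om : 𝕍 (k+1) → ℝ} (hφ : SMO φ) (hρ : SMO ρ)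
    (hη : SMO η) (hl : Continuous lam) (hom : Continuous om) (η1 : ∀ z, 1 ≤ η z) (l0 : ∀ z, 0 < lam z) (om0 : ∀ z, 0 < om z)
    (hK : IsCompact {z | ρ z ≤ 1})
    (hyp1 : ∀ z, ρ z < 1 → ∀ ξ, 0 ≤ Lev ρ z ξ) (hyp2 : ∀ z, ρ z < 1 → ∀ ξ, 0 ≤ Lev φ z ξ)
    (hyp3 : ∀ z, ρ z < 1 → ∀ ξ : 𝕍 (k+1), om z * ∑ j : Fin k, ‖ξ j.succ‖^2 ≤ - Lev η z ξ - ‖dl η z ξ‖^2 / lam z)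
    {h0 : 𝕍 (k+1) → ℂ} (Th : Test h0) (hh0 : ∀ z, ρ z < 1 → db 0 h0 z = 0) {Cg : ℝ}
    (hCg : ∫ z in {z | ρ z < 1}, (om z)⁻¹ * (∑ j : Fin k, ‖db j.succ h0 z‖^2) * rexp (- φ z) ≤ Cg)
    {α : Fin (k+1) → 𝕍 (k+1) → ℂ} (hα : ∀ j, Test (α j)) (sα : ∀ j, tsupport (α j) ⊆ {z | ρ z < 0}) :
    ‖∑ j, ∫ x, conj (db j h0 x) * α j x‖^2 ≤
      4 * rexp 1 ^2 * Cg * ∫ z, (η z + lam z) * ‖∑ j, dz j (α j) z‖^2 * rexp (φ z) := by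
  obtain ⟨B, hB⟩ := hK.exists_bound_of_continuousOn (f := fun z => η z + lam z) (hη.continuous.add hl).continuousOn
  have cK : IsCompact {z | ρ z ≤ 2/3} := hK.of_isClosed_subset (isClosed_le hρ.continuous continuous_const) fun z (hz : ρ z ≤ 2/3) => (show ρ z ≤ 1 by linarith)
  obtain ⟨a1, a2, a3⟩ := st_facts hρ 2
  obtain ⟨b1, b2, b3⟩ := st_facts hρ 3
  have kcs : HCS (fun x => ((Real.smoothTransition (2 - 3 * ρ x) : ℝ) : ℂ)) := HasCompactSupport.intro cK fun x hx => by
    rw [a2 x (by simp only [mem_ofPred_eq, not_le] at hx; exact hx.le)]; simp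
  obtain ⟨M0, hM0⟩ : ∃ M0, ∀ x, (6 * η x + 4 * lam x) * ∑ j, ‖dz j (fun x => ((Real.smoothTransition (2 - 3 * ρ x) : ℝ) : ℂ)) x‖^2 ≤ M0 := by
    have c1 : Continuous fun x => (6 * η x + 4 * lam x) * ∑ j, ‖dz j (fun x => ((Real.smoothTransition (2 - 3 * ρ x) : ℝ) : ℂ)) x‖^2 :=
      ((continuous_const.mul hη.continuous).add (continuous_const.mul hl)).mul (continuous_finsetSum _ fun j _ => (dz_sm j (ofReal_sm a1)).continuous.norm.pow 2)
    have c2 : HCS fun x => (6 * η x + 4 * lam x) * ∑ j, ‖dz j (fun x => ((Real.smoothTransition (2 - 3 * ρ x) : ℝ) : ℂ)) x‖^2 :=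
      HasCompactSupport.intro kcs fun x hx => by simp [dz_zero _ hx]
    obtain ⟨C, hC⟩ := c2.exists_bound_of_continuous c1
    exact ⟨C, fun x => (Real.le_norm_self _).trans (hC x)⟩
  have m1 : 1 ≤ max B 1 := le_max_right _ _
  have c0 : 0 ≤ (max B 1)⁻¹ := by positivity
  have c1 : (max B 1)⁻¹ ≤ 1 := inv_le_one_of_one_le₀ m1
  have hc : ∀ z, ρ z < 1 → (max B 1)⁻¹^2 * (η z + lam z) ≤ 1 := fun z hz => by
    have h1 : η z + lam z ≤ max B 1 := (Real.le_norm_self _).trans ((hB z hz.le).trans (le_max_left _ _))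
    calc _ ≤ (max B 1)⁻¹^2 * max B 1 := by gcongr
      _ = (max B 1)⁻¹ := by field_simp
      _ ≤ 1 := c1
  have bd := fun N : ℕ => tdualN hφ hρ hη hl hom η1 l0 om0 hK hyp1 hyp2 hyp3 Th hh0 hCg hα sα (Nat.cast_nonneg N) c0 c1 hc a1 a2 (fun x hx => a3 x (by linarith))
    (fun x => Real.smoothTransition.nonneg _) (fun x => Real.smoothTransition.le_one _) b1 (fun x hx => b2 x (by linarith)) (fun x hx => b3 x (by linarith)) (fun x => Real.smoothTransition.nonneg _) (fun x => Real.smoothTransition.le_one _) hM0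
  have Nt : Tendsto (fun N : ℕ => (N : ℝ)) atTop atTop := tendsto_natCast_atTop_atTop
  have t1 : Tendsto (fun N : ℕ => rexp (-((max B 1)⁻¹ * rexp ((N : ℝ) / 6)))) atTop (𝓝 0) :=
    Real.tendsto_exp_neg_atTop_nhds_zero.comp (Tendsto.const_mul_atTop (by positivity) (Real.tendsto_exp_atTop.comp (Nt.atTop_div_const (by norm_num))))
  have t2 : Tendsto (fun N : ℕ => rexp (-rexp ((N : ℝ) / 3))) atTop (𝓝 0) :=
    Real.tendsto_exp_neg_atTop_nhds_zero.comp (Real.tendsto_exp_atTop.comp (Nt.atTop_div_const (by norm_num)))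
  have lim := ge_of_tendsto' (((((t1.const_mul M0).mul_const (∑ j, ∫ x, rexp (φ x + 1) * ‖α j x‖^2)).const_add (4 * rexp 1 * (∫ z, (η z + lam z) * ‖∑ j, dz j (α j) z‖^2 * rexp (φ z)))).const_mul (rexp 1 * Cg)).sqrt.add
    (((t2.const_mul (∑ j, ∫ x, rexp (- φ x) * ‖db j h0 x‖^2)).mul_const (∑ j, ∫ x, rexp (φ x + 1) * ‖α j x‖^2)).sqrt)) bd
  simp only [mul_zero, zero_mul, add_zero, Real.sqrt_zero] at lim
  have Cg0 : 0 ≤ Cg := le_trans (integral_nonneg fun x => by have := om0 x; simp only [Pi.zero_apply]; positivity) hCg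
  have T0 : 0 ≤ ∫ z, (η z + lam z) * ‖∑ j, dz j (α j) z‖^2 * rexp (φ z) := integral_nonneg fun x => by
    have := η1 x
    have := l0 x
    simp only [Pi.zero_apply]; positivity
  calc _ ≤ _ := pow_le_pow_left₀ (norm_nonneg _) lim 2
    _ = _ := by rw [Real.sq_sqrt (by positivity)]; ring
end tdual2


section weyl
variable {n : ℕ}
structure SW (W : 𝕍 n → ℂ) (z0 : 𝕍 n) (r : ℝ) : Prop where
  mem : MemLp W 2
  supp : ∀ x, r < ‖x - z0‖ → W x = 0
  inv : ∀ (c : ℂ), ‖c‖ = 1 → ∀ y, W (z0 + c • y) = W (z0 + y)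

lemma rot_mp {c : ℂ} (hc : ‖c‖ = 1) : MeasurePreserving (fun y : 𝕍 n => c • y) := by
  have h1 : MeasurePreserving (fun z : ℂ => c * z) := by
    have := (rotation (⟨c, by simp [Submonoid.unitSphere, hc]⟩ : Circle)).measurePreserving
    exact this
  exact volume_preserving_pi (f := fun _ z => c * z) fun _ => h1

lemma int_rot {c : ℂ} (hc : ‖c‖ = 1) (f : 𝕍 n → ℂ) : ∫ y, f (c • y) = ∫ y, f y := by
  have c0 : c ≠ 0 := fun h => by simp [h] at hc
  exact (rot_mp hc).integral_comp ((Homeomorph.smulOfNeZero c c0).measurableEmbedding) f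

lemma SW.int {W : 𝕍 n → ℂ} {z0 r} (h : SW W z0 r) : Integrable W := by
  haveI : IsFiniteMeasure (volume.restrict (closedBall z0 r)) := ⟨by simpa using (isCompact_closedBall z0 r).measure_lt_top⟩
  have : IntegrableOn W (closedBall z0 r) := (h.mem.restrict _).integrable (by norm_num) |>.mono_measure le_rfl
  refine (integrableOn_iff_integrable_of_support_subset fun x hx => ?_).1 this
  by_contra hh
  rw [mem_closedBall, dist_eq_norm, not_le] at hh
  exact hx (h.supp x hh)

lemma mv {G W : 𝕍 n → ℂ} {z0 : 𝕍 n} {r : ℝ} (hG : Continuous G) (dG : ∀ z ∈ closedBall z0 r, DifferentiableAt ℂ G z) (hW : SW W z0 r) :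
    ∫ z, G z * W z = G z0 * ∫ z, W z := by
  have cmn : ∀ θ, ‖circleMap 0 1 θ‖ = 1 := fun θ => by simp
  have hWi : Integrable (fun y => W (z0 + y)) := hW.int.comp_add_left z0
  have e1 : ∀ θ, ∫ y, G (z0 + circleMap 0 1 θ • y) * W (z0 + y) = ∫ z, G z * W z := fun θ => by
    rw [← integral_add_left_eq_self (fun z => G z * W z) z0, ← int_rot (cmn θ) fun y => G (z0 + y) * W (z0 + y)]
    congr 1; ext y; rw [hW.inv _ (cmn θ)]
  obtain ⟨B, hB⟩ := (isCompact_closedBall z0 r).exists_bound_of_continuousOn hG.continuousOn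
  haveI : IsFiniteMeasure (volume.restrict (uIoc 0 (2 * π))) := ⟨by simp [uIoc]⟩
  have sw := intervalIntegral_integral_swap (a := 0) (b := 2 * π) (f := fun θ y => G (z0 + circleMap 0 1 θ • y) * W (z0 + y)) (μ := volume) (by
    refine Integrable.mono' (g := fun p : ℝ × (𝕍 n) => B * ‖W (z0 + p.2)‖) ((hWi.norm.const_mul B).comp_snd _) ?_ (ae_of_all _ fun p => ?_)
    · refine AEStronglyMeasurable.mul (Continuous.aestronglyMeasurable ?_) hWi.1.comp_snd
      exact hG.comp (continuous_const.add (((continuous_circleMap 0 1).comp continuous_fst).smul continuous_snd))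
    · simp only [Function.uncurry, norm_mul]
      by_cases hp : ‖p.2‖ ≤ r
      · gcongr
        refine hB _ ?_
        rw [mem_closedBall, dist_eq_norm, add_sub_cancel_left, norm_smul, cmn, one_mul]; exact hp
      · rw [hW.supp (z0 + p.2) (by simpa using hp)]; simp)
  simp only [e1] at sw
  have e2 : ∀ y, ∫ θ in (0:ℝ)..2 * π, G (z0 + circleMap 0 1 θ • y) * W (z0 + y) = (2 * π : ℝ) * (G z0 * W (z0 + y)) := fun y => by
    by_cases hy : ‖y‖ ≤ r
    · rw [intervalIntegral.integral_mul_const]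
      have hd : DiffContOnCl ℂ (fun ζ : ℂ => G (z0 + ζ • y)) (ball 0 |1|) := by
        refine ⟨fun ζ hζ => ?_, ?_⟩
        · refine DifferentiableAt.differentiableWithinAt ?_
          have : z0 + ζ • y ∈ closedBall z0 r := by
            rw [mem_closedBall, dist_eq_norm, add_sub_cancel_left, norm_smul]
            simp at hζ
            nlinarith [norm_nonneg y, norm_nonneg ζ]
          exact (dG _ this).comp ζ ((differentiableAt_const _).add (differentiableAt_id.smul_const y))
        · exact (hG.comp (continuous_const.add (continuous_id.smul continuous_const))).continuousOn
      have := hd.circleAverage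
      rw [Real.circleAverage_def, inv_smul_eq_iff₀ (by positivity)] at this
      rw [this]
      simp; ring
    · rw [hW.supp (z0 + y) (by simpa using hy)]; simp
  simp only [e2] at sw
  rw [intervalIntegral.integral_const, integral_const_mul, integral_const_mul, integral_add_left_eq_self W z0] at sw
  have p0 : ((2 * π : ℝ) : ℂ) ≠ 0 := by exact_mod_cast (by positivity : (2 * π : ℝ) ≠ 0)
  refine mul_left_cancel₀ p0 (Eq.trans ?_ sw)
  simp

lemma holo_of_db {G : 𝕍 n → ℂ} {z : 𝕍 n} (hG : DifferentiableAt ℝ G z) (h : ∀ j, db j G z = 0) : DifferentiableAt ℂ G z := by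
  have hs : ∀ j, fderiv ℝ G z (Pi.single j I) = I * fderiv ℝ G z (Pi.single j 1) := fun j => by
    have := h j
    rw [db] at this
    have h2 : fderiv ℝ G z (Pi.single j 1) + I * fderiv ℝ G z (Pi.single j I) = 0 := by simpa using this
    have : fderiv ℝ G z (Pi.single j 1) = - (I * fderiv ℝ G z (Pi.single j I)) := by linear_combination h2
    rw [this]; ring_nf; simp
  have lin : ∀ v : 𝕍 n, fderiv ℝ G z v = ∑ j, v j * fderiv ℝ G z (Pi.single j 1) := fun v => by
    have ev : v = ∑ j, ((v j).re • (Pi.single j 1 : 𝕍 n) + (v j).im • (Pi.single j I : 𝕍 n)) := by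
      ext i
      simp [Finset.sum_apply, Pi.single_apply, Finset.sum_add_distrib]
    conv_lhs => rw [ev]
    rw [map_sum]
    refine Finset.sum_congr rfl fun j _ => ?_
    rw [map_add, map_smul, map_smul, hs, real_smul, real_smul]
    conv_rhs => rw [← re_add_im (v j)]
    ring
  let L : 𝕍 n →L[ℂ] ℂ := ∑ j, (fderiv ℝ G z (Pi.single j 1)) • (ContinuousLinearMap.proj j : 𝕍 n →L[ℂ] ℂ)
  refine (hasFDerivAt_of_restrictScalars ℝ hG.hasFDerivAt (f' := L) ?_).differentiableAt
  ext v
  simp [L, lin v, ContinuousLinearMap.sum_apply, mul_comm]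

def WH (F : 𝕍 n → ℂ) (U : Set (𝕍 n)) : Prop := ∀ τ, Test τ → tsupport τ ⊆ U → ∀ j, ∫ x, F x * db j τ x = 0

lemma moll_holo {F : 𝕍 n → ℂ} {U : Set (𝕍 n)} (hF : WH F U) (mF : MemLp F 2) {g r} (hg : IsMoll g r) {z : 𝕍 n} (hz : closedBall z r ⊆ U) :
    DifferentiableAt ℂ (moll g F) z := by
  refine holo_of_db (sm_da (moll_sm hg.sm hg.cs (memlp_li mF)) z) fun j => ?_
  rw [db_moll hg.sm hg.cs (memlp_li mF), hF _ ⟨test_refl (ofReal_sm hg.sm) z, cs_refl (cs_ofReal hg.cs) z⟩ ?_ j, neg_zero]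
  refine (closure_minimal (fun t ht => ?_) isClosed_closedBall).trans hz
  rw [mem_closedBall, dist_eq_norm]
  by_contra hh
  rw [not_le] at hh
  refine ht ?_
  simp only [ofReal_eq_zero]
  exact hg.supp _ (by rw [norm_sub_rev]; exact hh.le)

lemma tend_pair {F : 𝕍 n → ℂ} (mF : MemLp F 2) {g : ℕ → 𝕍 n → ℝ} {r : ℕ → ℝ} (hg : ∀ m, IsMoll (g m) (r m)) (hr : Tendsto r atTop (𝓝 0))
    {W : 𝕍 n → ℂ} (mW : MemLp W 2) : Tendsto (fun m => ∫ x, moll (g m) F x * W x) atTop (𝓝 (∫ x, F x * W x)) := by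
  have h1 := moll_conv hg hr mF
  have mm : ∀ m, MemLp (moll (g m) F - F) 2 := fun m => (moll_memlp (hg m) mF).sub mF
  rw [tendsto_iff_norm_sub_tendsto_zero]
  have bd : ∀ m, ‖(∫ x, moll (g m) F x * W x) - ∫ x, F x * W x‖ ≤ (eLpNorm (moll (g m) F - F) 2).toReal * (eLpNorm W 2).toReal := fun m => by
    have is := integral_sub (f := fun x => moll (g m) F x * W x) (g := fun x => F x * W x) ((moll_memlp (hg m) mF).integrable_mul mW) (mF.integrable_mul mW)
    rw [← is]
    have e : ∀ x, moll (g m) F x * W x - F x * W x = W x * (moll (g m) F - F) x := fun x => by simp [Pi.sub_apply]; ring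
    simp only [e]
    have := norm_inner_le_norm (𝕜 := ℂ) ((mW.star).toLp _) ((mm m).toLp _)
    rw [L2.inner_def] at this
    have e2 : ∫ x, inner ℂ ((mW.star).toLp _ x) ((mm m).toLp _ x) = ∫ x, W x * (moll (g m) F - F) x := by
      refine integral_congr_ae ?_
      filter_upwards [(mW.star).coeFn_toLp, (mm m).coeFn_toLp] with x h1 h2
      rw [h1, h2]; simp [inner, mul_comm]
    rw [e2, Lp.norm_toLp, Lp.norm_toLp] at this
    refine this.trans (le_of_eq ?_)
    rw [mul_comm]
    congr 2
    exact eLpNorm_congr_norm_ae (ae_of_all _ fun x => by simp)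
  refine squeeze_zero (fun _ => norm_nonneg _) bd ?_
  have := (ENNReal.tendsto_toReal ENNReal.zero_ne_top).comp h1
  simpa using this.mul_const _

lemma exists_mollseq : ∃ (g : ℕ → 𝕍 n → ℝ) (r : ℕ → ℝ), (∀ m, 0 < r m) ∧ (∀ m, IsMoll (g m) (r m)) ∧ Tendsto r atTop (𝓝 0) := by
  obtain ⟨r, h1, -, h3⟩ := exists_rad (zero_lt_one (α := ℝ))
  choose g hg using fun m => exists_moll (n := n) (h1 m)
  exact ⟨g, r, h1, hg, h3⟩

lemma near_cb {U : Set (𝕍 n)} (hU : IsOpen U) {K : Set (𝕍 n)} (hK : IsCompact K) (hKU : K ⊆ U) {r : ℕ → ℝ} (hr : Tendsto r atTop (𝓝 0)) :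
    ∀ᶠ m in atTop, ∀ z ∈ K, closedBall z (r m) ⊆ U := by
  obtain ⟨δ, d0, hδ⟩ := hK.exists_cthickening_subset_open hU hKU
  filter_upwards [hr.eventually_lt_const d0] with m hm z hz
  exact (closedBall_subset_closedBall hm.le).trans ((closedBall_subset_cthickening hz δ).trans hδ)

lemma wh_mv {F : 𝕍 n → ℂ} {U : Set (𝕍 n)} (hU : IsOpen U) (hF : WH F U) (mF : MemLp F 2) {g : ℕ → 𝕍 n → ℝ} {r : ℕ → ℝ} (hg : ∀ m, IsMoll (g m) (r m)) (hr : Tendsto r atTop (𝓝 0))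
    {z0 : 𝕍 n} {s : ℝ} (hs : closedBall z0 s ⊆ U) {W : 𝕍 n → ℂ} (hW : SW W z0 s) (W1 : ∫ x, W x = 1) :
    Tendsto (fun m => moll (g m) F z0) atTop (𝓝 (∫ x, F x * W x)) := by
  refine (tend_pair mF hg hr hW.mem).congr' ?_
  filter_upwards [near_cb hU (isCompact_closedBall z0 s) hs hr] with m hm
  rw [mv (moll_sm (hg m).sm (hg m).cs (memlp_li mF)).continuous (fun z hz => moll_holo hF mF (hg m) (hm z hz)) hW, W1, mul_one]

lemma wh_indep {F : 𝕍 n → ℂ} {U : Set (𝕍 n)} (hU : IsOpen U) (hF : WH F U) (mF : MemLp F 2)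
    {z0 : 𝕍 n} {s t : ℝ} (hs : closedBall z0 s ⊆ U) (ht : closedBall z0 t ⊆ U) {W V : 𝕍 n → ℂ} (hW : SW W z0 s) (hV : SW V z0 t) (V1 : ∫ x, V x = 1) :
    ∫ x, F x * W x = (∫ x, F x * V x) * ∫ x, W x := by
  obtain ⟨g, r, r0, hg, hr⟩ := exists_mollseq (n := n)
  have h1 := wh_mv hU hF mF hg hr ht hV V1
  refine tendsto_nhds_unique (tend_pair mF hg hr hW.mem) ((h1.mul_const _).congr' ?_)
  filter_upwards [near_cb hU (isCompact_closedBall z0 s) hs hr] with m hm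
  rw [mv (moll_sm (hg m).sm (hg m).cs (memlp_li mF)).continuous (fun z hz => moll_holo hF mF (hg m) (hm z hz)) hW]

lemma IsMoll.sw {g : 𝕍 n → ℝ} {r : ℝ} (hg : IsMoll g r) (z0 : 𝕍 n) : SW (fun t => (g (z0 - t) : ℂ)) z0 r :=
  ⟨(test_refl (ofReal_sm hg.sm) z0).continuous.memLp_of_hasCompactSupport (cs_refl (cs_ofReal hg.cs) z0),
    fun x hx => by rw [hg.supp _ (by rw [norm_sub_rev]; exact hx.le)]; simp,
    fun c hc y => by
      have : z0 - (z0 + c • y) = c • (-y) := by simp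
      rw [this, hg.inv _ c hc]; simp⟩

theorem weyl {F : 𝕍 n → ℂ} {U : Set (𝕍 n)} (hU : IsOpen U) (hF : WH F U) (mF : MemLp F 2) :
    ∃ H : 𝕍 n → ℂ, DifferentiableOn ℂ H U ∧ (∀ᵐ x ∂volume.restrict U, H x = F x) ∧
      ∀ z0 s, closedBall z0 s ⊆ U → ∀ W, SW W z0 s → ∫ x, W x = 1 → H z0 = ∫ x, F x * W x := by
  obtain ⟨g, r, r0, hg, hr⟩ := exists_mollseq (n := n)
  have i1 : ∀ m z, ∫ t, (g m (z - t) : ℂ) = 1 := fun m z => by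
    rw [integral_complex_ofReal, integral_sub_left_eq_self (g m) volume z, (hg m).one]; simp
  have key : ∀ m z, closedBall z (r m) ⊆ U → Tendsto (fun m => moll (g m) F z) atTop (𝓝 (moll (g m) F z)) := fun m z hz =>
    wh_mv hU hF mF hg hr hz ((hg m).sw z) (i1 m z)
  refine ⟨fun z => limUnder atTop fun m => moll (g m) F z, ?_, ?_, ?_⟩
  · intro z hz
    obtain ⟨δ, d0, hδ⟩ := Metric.isOpen_iff.1 hU z hz
    obtain ⟨m, hm⟩ := (hr.eventually_lt_const (half_pos d0)).exists
    refine (DifferentiableAt.congr_of_eventuallyEq (moll_holo hF mF (hg m) (z := z) ((closedBall_subset_ball (by linarith)).trans hδ)) ?_).differentiableWithinAt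
    filter_upwards [ball_mem_nhds z (half_pos d0)] with w hw
    refine (key m w fun t ht => hδ ?_).limUnder_eq
    rw [mem_ball] at hw ⊢
    rw [mem_closedBall] at ht
    linarith [dist_triangle t w z]
  · obtain ⟨ns, hmono, hns⟩ := (tendstoInMeasure_of_tendsto_eLpNorm (p := 2) (by norm_num) (fun m => (moll_memlp (hg m) mF).1) mF.1 (moll_conv hg hr mF)).exists_seq_tendsto_ae
    refine (ae_restrict_iff' hU.measurableSet).2 ?_
    filter_upwards [hns] with z hz hzU
    obtain ⟨δ, d0, hδ⟩ := Metric.isOpen_iff.1 hU z hzU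
    obtain ⟨m, hm⟩ := (hr.eventually_lt_const d0).exists
    have k := key m z ((closedBall_subset_ball hm).trans hδ)
    rw [k.limUnder_eq]
    exact tendsto_nhds_unique (k.comp hmono.tendsto_atTop) hz
  · intro z0 s hs W hW W1
    exact (wh_mv hU hF mF hg hr hs hW W1).limUnder_eq
end weyl


section exh
variable {n : ℕ}
lemma lev_eq {h : 𝕍 n → ℝ} (hs : SMO h) (z ξ : 𝕍 n) :
    4 * Lev h z ξ = fderiv ℝ (fderiv ℝ h) z ξ ξ + fderiv ℝ (fderiv ℝ h) z (I • ξ) (I • ξ) := by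
  have cs := ofReal_sm hs
  have h1 : SMO (fderiv ℝ h) := hs.fderiv_right (by simp)
  have key : ∀ v w, fderiv ℝ (fderiv ℝ (fun z => (h z : ℂ))) z v w = (fderiv ℝ (fderiv ℝ h) z v w : ℝ) := by
    intro v w
    rw [← fderiv_clm_comp_apply cs]
    have : (fun y => fderiv ℝ (fun z => (h z : ℂ)) y w) = fun y => ((fderiv ℝ h y w : ℝ) : ℂ) := by
      ext y; exact fderiv_ofReal (hs.differentiable (by simp) y) w
    rw [this, fderiv_ofReal ((h1.differentiable (by simp) z).clm_apply (by fun_prop)),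
      fderiv_clm_apply (h1.differentiable (by simp) z) (by fun_prop)]
    simp
  generalize hB : fderiv ℝ (fderiv ℝ h) z = B at key
  have ex : ∀ ζ : 𝕍 n, ζ = ∑ j, ((ζ j).re • (Pi.single j 1 : 𝕍 n) + (ζ j).im • (Pi.single j I : 𝕍 n)) := by
    intro ζ; ext i
    simp [Finset.sum_apply, Pi.single_apply, Finset.sum_add_distrib]
  have bil : ∀ ζ : 𝕍 n, B ζ ζ = ∑ j, ∑ k, ((ζ j).re * (ζ k).re * B (Pi.single j 1) (Pi.single k 1)
      + (ζ j).re * (ζ k).im * B (Pi.single j 1) (Pi.single k I) + (ζ j).im * (ζ k).re * B (Pi.single j I) (Pi.single k 1)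
      + (ζ j).im * (ζ k).im * B (Pi.single j I) (Pi.single k I)) := by
    intro ζ
    conv_lhs => rw [ex ζ]
    simp only [map_sum, map_add, map_smul, ContinuousLinearMap.sum_apply, ContinuousLinearMap.add_apply,
      ContinuousLinearMap.smul_apply, smul_eq_mul]
    rw [Finset.sum_comm]
    refine Finset.sum_congr rfl fun j _ => ?_
    simp only [Finset.mul_sum, ← Finset.sum_add_distrib]
    refine Finset.sum_congr rfl fun k _ => ?_
    ring
  rw [bil, bil, Lev]
  simp only [re_sum, Finset.mul_sum, ← Finset.sum_add_distrib]
  refine Finset.sum_congr rfl fun j _ => Finset.sum_congr rfl fun k _ => ?_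
  have : dz j (db k (fun z => (h z : ℂ))) z = (1/2) * ((1/2) * ((B (Pi.single j 1) (Pi.single k 1) : ℝ) + I * (B (Pi.single j 1) (Pi.single k I) : ℝ))
     - I * ((1/2) * ((B (Pi.single j I) (Pi.single k 1) : ℝ) + I * (B (Pi.single j I) (Pi.single k I) : ℝ)))) := by
    rw [dz]; unfold db; rw [fd_aux _ _ cs, fd_aux _ _ cs, key, key, key, key]
  rw [this]
  simp
  ring

lemma lev_nonneg {h : 𝕍 n → ℝ} (hs : SMO h) (z ξ : 𝕍 n) {t0 : ℝ} (ht0 : 0 < t0)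
    (hsub : ∀ t : ℝ, 0 < t → t < t0 → h z ≤ (2 * π)⁻¹ * ∫ θ in (0:ℝ)..(2 * π), h (z + (t * exp (θ * I)) • ξ)) :
    0 ≤ Lev h z ξ := by
  by_contra hn
  have h4 := lev_eq hs z ξ
  have h1 : SMO (fderiv ℝ h) := hs.fderiv_right (by simp)
  have hB := (h1.differentiable (by simp) z).hasFDerivAt
  generalize fderiv ℝ (fderiv ℝ h) z = B at h4 hB
  generalize hT : B ξ ξ + B (I • ξ) (I • ξ) = T at h4
  have T0 : T < 0 := by linarith
  have hd := hB.isLittleO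
  obtain ⟨ε, e0, he⟩ : ∃ ε : ℝ, 0 < ε ∧ 4 * ε * ‖ξ‖^2 ≤ -T :=
    ⟨-T / (4 * (‖ξ‖^2+1)), by have := neg_pos.2 T0; positivity, by
      rw [mul_div_assoc', div_mul_eq_mul_div, div_le_iff₀ (by positivity)]; nlinarith [sq_nonneg ‖ξ‖]⟩
  obtain ⟨d, d0, hd⟩ := Metric.eventually_nhds_iff.1 (hd.bound e0)
  have hd' : ∀ x : 𝕍 n, ‖x‖ < d → ‖fderiv ℝ h (z + x) - fderiv ℝ h z - B x‖ ≤ ε * ‖x‖ := by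
    intro x hx
    have := @hd (z + x) (by simpa [dist_eq_norm] using hx)
    simpa using this
  obtain ⟨t, tp, tt, td⟩ : ∃ t : ℝ, 0 < t ∧ t < t0 ∧ t * ‖ξ‖ < d := by
    refine ⟨min (t0/2) (d / (2*(‖ξ‖+1))), by positivity, (min_le_left _ _).trans_lt (by linarith), ?_⟩
    refine (mul_le_mul_of_nonneg_right (min_le_right _ _) (norm_nonneg _)).trans_lt ?_
    rw [div_mul_eq_mul_div, div_lt_iff₀ (by positivity)]; nlinarith [norm_nonneg ξ]
  have main : ∀ θ : ℝ, h (z + (t * exp (θ * I)) • ξ) + h (z + (t * exp ((θ + π/2 : ℝ) * I)) • ξ)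
      + h (z + (t * exp ((θ + π : ℝ) * I)) • ξ) + h (z + (t * exp ((θ + (π + π/2) : ℝ) * I)) • ξ) ≤ 4 * h z + T * t^2 / 2 := by
    intro θ
    have e1 : exp (π * I) = -1 := exp_pi_mul_I
    have e2 : exp ((π / 2 : ℝ) * I) = I := by push_cast; exact exp_pi_div_two_mul_I
    simp only [ofReal_add, add_mul, Complex.exp_add, e1, e2]
    have cn : ‖exp (θ * I)‖ = 1 := norm_exp_ofReal_mul_I θ
    generalize exp (θ * I) = c at cn
    have hcs : c.re^2 + c.im^2 = 1 := by
      have := Complex.sq_norm c; rw [cn, normSq_apply] at this; nlinarith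
    have Tv : B (c • ξ) (c • ξ) + B ((c * I) • ξ) ((c * I) • ξ) = T := by
      have ea : c • ξ = c.re • ξ + c.im • (I • ξ) := by
        ext i; simp; conv_lhs => rw [← re_add_im c]
        ring
      have eb : (c * I) • ξ = (-c.im) • ξ + c.re • (I • ξ) := by
        ext i; simp; conv_lhs => rw [← re_add_im c]
        linear_combination (c.im : ℂ) * ξ i * I_mul_I
      rw [ea, eb, ← hT]
      simp only [map_add, map_smul, ContinuousLinearMap.add_apply, ContinuousLinearMap.smul_apply, smul_eq_mul]
      linear_combination (B ξ ξ + B (I • ξ) (I • ξ)) * hcs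
    generalize hv : c • ξ = v at Tv
    generalize hw : (c * I) • ξ = w at Tv
    have nv : ‖v‖ = ‖ξ‖ := by rw [← hv, norm_smul, cn, one_mul]
    have nw : ‖w‖ = ‖ξ‖ := by rw [← hw, norm_smul, norm_mul, cn]; simp
    have r1 : (↑t * c) • ξ = t • v := by rw [← hv]; ext i; simp [mul_assoc]
    have r2 : (↑t * (c * I)) • ξ = t • w := by rw [← hw]; ext i; simp [mul_assoc]
    have r3 : (↑t * (c * -1)) • ξ = t • (-v) := by rw [← hv]; ext i; simp [mul_assoc]
    have r4 : (↑t * (c * (-1 * I))) • ξ = t • (-w) := by rw [← hw]; ext i; simp [mul_assoc]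
    rw [r1, r2, r3, r4]
    let τ : ℝ → ℝ := fun s => h (z + s • v) + h (z + s • w) + h (z + s • (-v)) + h (z + s • (-w)) - T * s^2/2
    have dr : ∀ (u : 𝕍 n) (s : ℝ), HasDerivAt (fun s : ℝ => h (z + s • u)) (fderiv ℝ h (z + s • u) u) s := by
      intro u s
      have a : HasDerivAt (fun s : ℝ => z + s • u) u s := by
        simpa using ((hasDerivAt_id s).smul_const u).const_add z
      exact (hs.differentiable (by simp) (z + s • u)).hasFDerivAt.comp_hasDerivAt s a
    have dτ : ∀ s, HasDerivAt τ (fderiv ℝ h (z + s • v) v + fderiv ℝ h (z + s • w) w + fderiv ℝ h (z + s • (-v)) (-v) + fderiv ℝ h (z + s • (-w)) (-w) - T * s) s := by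
      intro s
      have := ((((dr v s).add (dr w s)).add (dr (-v) s)).add (dr (-w) s)).sub (((hasDerivAt_pow 2 s).const_mul T).div_const 2)
      refine this.congr_deriv ?_
      norm_num; ring
    have est : ∀ (u : 𝕍 n) (s : ℝ), ‖u‖ = ‖ξ‖ → 0 < s → s < t → fderiv ℝ h (z + s • u) u ≤ fderiv ℝ h z u + s * B u u + ε * s * ‖ξ‖^2 := by
      intro u s hu s0 st
      have nn : ‖s • u‖ = s * ‖ξ‖ := by rw [norm_smul, hu, Real.norm_of_nonneg s0.le]
      have a := hd' (s • u) (by rw [nn]; exact (mul_le_mul_of_nonneg_right st.le (norm_nonneg _)).trans_lt td)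
      have b := (ContinuousLinearMap.le_opNorm (fderiv ℝ h (z + s • u) - fderiv ℝ h z - B (s • u)) u).trans (mul_le_mul_of_nonneg_right a (norm_nonneg _))
      have := (le_abs_self _).trans b
      rw [nn, hu] at this
      simp only [ContinuousLinearMap.sub_apply, map_smul, ContinuousLinearMap.smul_apply, smul_eq_mul] at this
      nlinarith
    have anti : AntitoneOn τ (Icc 0 t) := by
      refine antitoneOn_of_deriv_nonpos (convex_Icc 0 t) (fun s _ => (dτ s).continuousAt.continuousWithinAt)
        (fun s _ => (dτ s).differentiableAt.differentiableWithinAt) fun s hs' => ?_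
      rw [interior_Icc] at hs'
      rw [(dτ s).deriv]
      have a1 := est v s nv hs'.1 hs'.2
      have a2 := est w s nw hs'.1 hs'.2
      have a3 := est (-v) s (by rw [norm_neg, nv]) hs'.1 hs'.2
      have a4 := est (-w) s (by rw [norm_neg, nw]) hs'.1 hs'.2
      simp only [map_neg, ContinuousLinearMap.neg_apply, neg_neg] at a1 a2 a3 a4 ⊢
      have hsp := hs'.1
      have : s * (4 * ε * ‖ξ‖^2) ≤ s * (-T) := mul_le_mul_of_nonneg_left he hsp.le
      have h5 : s * B v v + s * B w w = s * T := by rw [← Tv]; ring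
      nlinarith
    have := anti (left_mem_Icc.2 tp.le) (right_mem_Icc.2 tp.le) tp.le
    simp only [τ] at this
    simp at this
    simp only [smul_neg]
    linarith
  let f : ℝ → ℝ := fun θ => h (z + (t * exp (θ * I)) • ξ)
  have fc : Continuous f := hs.continuous.comp (by fun_prop)
  have fp : Function.Periodic f (2 * π) := by
    intro θ; simp only [f]; congr 4
    push_cast; rw [add_mul]; exact exp_periodic (θ * I)
  have sh : ∀ a : ℝ, ∫ θ in (0:ℝ)..(2 * π), f (θ + a) = ∫ θ in (0:ℝ)..(2 * π), f θ := by
    intro a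
    rw [intervalIntegral.integral_comp_add_right, zero_add, add_comm (2 * π) a, fp.intervalIntegral_add_eq a 0, zero_add]
  have fi : ∀ a : ℝ, IntervalIntegrable (fun θ => f (θ + a)) volume 0 (2 * π) := fun a =>
    (fc.comp (by fun_prop)).intervalIntegrable _ _
  have fi0 : IntervalIntegrable f volume 0 (2 * π) := fc.intervalIntegrable _ _
  have le := intervalIntegral.integral_mono (μ := volume) (a := 0) (b := 2 * π) (by positivity)
    (((fi0.add (fi (π/2))).add (fi π)).add (fi (π + π/2))) (intervalIntegrable_const) main
  rw [intervalIntegral.integral_add ((fi0.add (fi (π/2))).add (fi π)) (fi _),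
    intervalIntegral.integral_add (fi0.add (fi (π/2))) (fi _), intervalIntegral.integral_add fi0 (fi _), sh, sh, sh] at le
  have s1 := hsub t tp tt
  rw [intervalIntegral.integral_const, smul_eq_mul, sub_zero] at le
  rw [inv_mul_eq_div, le_div_iff₀ (by positivity)] at s1
  have pp := Real.pi_pos
  change h z * _ ≤ ∫ θ in (0:ℝ)..(2 * π), f θ at s1
  have : T * t^2 < 0 := mul_neg_of_neg_of_pos T0 (by positivity)
  nlinarith
end exh


section exh2
variable {n : ℕ}
structure Exh (D : Set (𝕍 n)) (ρ0 : 𝕍 n → ℝ) : Prop where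
  op : IsOpen D
  cont : ContinuousOn ρ0 D
  cpt : ∀ c : ℝ, IsCompact {z | z ∈ D ∧ ρ0 z ≤ c}
  sub : ∀ z ξ : 𝕍 n, (∀ l : ℂ, ‖l‖ ≤ 1 → z + l • ξ ∈ D) →
    ρ0 z ≤ (2 * π)⁻¹ * ∫ θ in (0:ℝ)..(2 * π), ρ0 (z + exp (θ * I) • ξ)

lemma Exh.smooth {D K0 : Set (𝕍 n)} {ρ0 : 𝕍 n → ℝ} (hD : Exh D ρ0) (hK : IsCompact K0) (KD : K0 ⊆ D) :
    ∃ ρ : 𝕍 n → ℝ, SMO ρ ∧ (∀ z ∈ K0, ρ z < 0) ∧ IsCompact {z | ρ z ≤ 2} ∧ {z | ρ z ≤ 2} ⊆ D ∧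
      ∀ z, ρ z < 2 → ∀ ξ, 0 ≤ Lev ρ z ξ := by
  classical
  obtain ⟨c, hc⟩ := (hK.image_of_continuousOn (hD.cont.mono KD)).bddAbove
  let v : 𝕍 n → ℝ := fun z => if z ∈ D then max (c + 5 - ρ0 z) 0 else 0
  have K5 := hD.cpt (c + 5)
  have v0 : ∀ z, ¬ (z ∈ D ∧ ρ0 z ≤ c + 5) → v z = 0 := by
    intro z hz
    by_cases h : z ∈ D
    · simp only [v, h, if_true]
      have : ¬ ρ0 z ≤ c + 5 := fun h' => hz ⟨h, h'⟩
      exact max_eq_right (by linarith)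
    · simp [v, h]
  have vp : ∀ z, 0 < v z → z ∈ D ∧ v z = c + 5 - ρ0 z := by
    intro z hz
    by_cases h : z ∈ D
    · refine ⟨h, ?_⟩
      simp only [v, h, if_true] at hz ⊢
      rcases max_cases (c + 5 - ρ0 z) 0 with h' | h'
      · exact h'.1
      · linarith [h'.1]
    · simp [v, h] at hz
  have vn : ∀ z, 0 ≤ v z := by
    intro z; by_cases h : z ∈ D <;> simp [v, h]
  have vc : Continuous v := by
    rw [continuous_iff_continuousAt]
    intro z
    by_cases h : z ∈ D
    · have : v =ᶠ[𝓝 z] fun z => max (c + 5 - ρ0 z) 0 := by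
        filter_upwards [hD.op.mem_nhds h] with y hy
        simp [v, hy]
      exact ContinuousAt.congr_of_eventuallyEq (((continuousAt_const.sub (hD.cont.continuousAt (hD.op.mem_nhds h))).max continuousAt_const)) this
    · have : v =ᶠ[𝓝 z] fun _ => 0 := by
        filter_upwards [K5.isClosed.isOpen_compl.mem_nhds (show z ∈ {z | z ∈ D ∧ ρ0 z ≤ c + 5}ᶜ from fun h' => h h'.1)] with y hy
        exact v0 y hy
      exact continuousAt_const.congr_of_eventuallyEq this
  have vs : HCS v := HasCompactSupport.intro K5 fun x hx => v0 x hx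
  have vu := vs.uniformContinuous_of_continuous vc
  obtain ⟨d, d0, hd⟩ := Metric.uniformContinuous_iff.1 vu (1/2) (by norm_num)
  obtain ⟨g, hg⟩ := exists_moll (n := n) (half_pos d0)
  obtain ⟨M, hM⟩ := vs.exists_bound_of_continuous vc
  have vl : LocallyIntegrable (fun z => (v z : ℂ)) := (continuous_ofReal.comp vc).locallyIntegrable
  let m : 𝕍 n → ℝ := fun x => ∫ s, v (x - s) * g s
  have gi : Integrable g := hg.sm.continuous.integrable_of_hasCompactSupport hg.cs
  have mi : ∀ x, Integrable (fun s => v (x - s) * g s) := fun x =>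
    ((vc.comp (by fun_prop)).mul hg.sm.continuous).integrable_of_hasCompactSupport hg.cs.mul_left
  have hm : ∀ x, moll g (fun z => (v z : ℂ)) x = m x := by
    intro x
    simp only [moll, m]
    rw [← integral_sub_left_eq_self _ volume x, ← integral_complex_ofReal]
    congr 1; ext s; simp
  have ms : SMO m := by
    have : m = fun x => reCLM (moll g (fun z => (v z : ℂ)) x) := by ext x; rw [hm]; simp
    rw [this]; exact reCLM.contDiff.comp (moll_sm hg.sm hg.cs vl)
  have mv : ∀ x, |m x - v x| ≤ 1/2 := by
    intro x
    have := moll_unif hg.sm hg.cs hg.nn hg.one (ε := 1/2) hg.supp vl (x := x) (by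
      intro t ht
      rw [← ofReal_sub, norm_real, ← dist_eq_norm]
      exact (hd (by rw [dist_comm, dist_eq_norm]; linarith)).le)
    rwa [hm, ← ofReal_sub, norm_real] at this
  refine ⟨fun z => 4 - m z, contDiff_const.sub ms, ?_, ?_, ?_, ?_⟩
  · intro z hz
    have h1 : v z = max (c + 5 - ρ0 z) 0 := by simp [v, KD hz]
    have h2 := le_max_left (c + 5 - ρ0 z) 0
    have h3 : ρ0 z ≤ c := hc ⟨z, hz, rfl⟩
    have := abs_le.1 (mv z)
    linarith
  · refine K5.of_isClosed_subset (isClosed_le (continuous_const.sub ms.continuous) continuous_const) ?_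
    intro z (hz : 4 - m z ≤ 2)
    by_contra h
    have := abs_le.1 (mv z); rw [v0 z h] at this; linarith
  · intro z (hz : 4 - m z ≤ 2)
    have := abs_le.1 (mv z)
    exact (vp z (by linarith)).1
  · intro z hz ξ
    have h0 := abs_le.1 (mv z)
    refine lev_nonneg (contDiff_const.sub ms) z ξ (t0 := d / (2 * (‖ξ‖ + 1))) (by positivity) fun t tp tt => ?_
    have tx : t * ‖ξ‖ < d / 2 := by
      rw [lt_div_iff₀ (by positivity)] at tt; nlinarith [norm_nonneg ξ]
    have near : ∀ s, ‖s‖ < d / 2 → ∀ l : ℂ, ‖l‖ ≤ 1 → 0 < v (z - s + l • (t • ξ)) := by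
      intro s hs l hl
      have : dist (z - s + l • (t • ξ)) z < d := by
        rw [dist_eq_norm]
        have e : z - s + l • (t • ξ) - z = l • (t • ξ) - s := by abel
        rw [e]
        refine (norm_sub_le _ _).trans_lt ?_
        rw [norm_smul, norm_smul, Real.norm_of_nonneg tp.le]
        have : ‖l‖ * (t * ‖ξ‖) ≤ 1 * (t * ‖ξ‖) := mul_le_mul_of_nonneg_right hl (by positivity)
        linarith
      have := hd this
      rw [Real.dist_eq] at this
      have := abs_lt.1 this
      linarith
    have conv : ∀ θ : ℝ, ∀ x : 𝕍 n, x + (t * exp (θ * I)) • ξ = x + exp (θ * I) • (t • ξ) := by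
      intro θ x; ext i; simp; ring
    have Fc : Continuous (fun p : ℝ × (𝕍 n) => v (z + (t * exp (p.1 * I)) • ξ - p.2) * g p.2) :=
      (vc.comp (by fun_prop)).mul (hg.sm.continuous.comp continuous_snd)
    have Fi : Integrable (fun p : ℝ × (𝕍 n) => v (z + (t * exp (p.1 * I)) • ξ - p.2) * g p.2) ((volume.restrict (Ioc 0 (2 * π))).prod volume) := by
      have c1 : Integrable (fun _ : ℝ => M) (volume.restrict (Ioc 0 (2 * π))) := integrable_const M
      refine (c1.mul_prod gi).mono' Fc.aestronglyMeasurable (ae_of_all _ fun p => ?_)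
      rw [norm_mul, Real.norm_of_nonneg (hg.nn _)]
      exact mul_le_mul_of_nonneg_right (hM _) (hg.nn _)
    have key : ∫ θ in (0:ℝ)..(2 * π), m (z + (t * exp (θ * I)) • ξ) ≤ (2 * π) * m z := by
      rw [intervalIntegral.integral_of_le (by positivity)]
      simp only [m]
      rw [integral_integral_swap (f := fun (θ : ℝ) s => v (z + (t * exp (θ * I)) • ξ - s) * g s) Fi, ← integral_const_mul]
      refine integral_mono Fi.integral_prod_right ((mi z).const_mul _) fun s => ?_
      simp only
      rw [integral_mul_const, ← mul_assoc]
      by_cases hs : d / 2 ≤ ‖s‖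
      · rw [hg.supp s hs]; simp
      push Not at hs
      refine mul_le_mul_of_nonneg_right ?_ (hg.nn s)
      have sb := hD.sub (z - s) (t • ξ) fun l hl => (vp _ (near s hs l hl)).1
      have v1 : v (z - s) = c + 5 - ρ0 (z - s) := (vp _ (by simpa using near s hs 0 (by simp))).2
      have v2 : ∀ θ : ℝ, ρ0 (z - s + exp (θ * I) • (t • ξ)) = c + 5 - v (z + (t * exp (θ * I)) • ξ - s) := by
        intro θ
        have := (vp _ (near s hs (exp (θ * I)) (by rw [norm_exp_ofReal_mul_I]))).2
        rw [conv, show z + exp (θ * I) • (t • ξ) - s = z - s + exp (θ * I) • (t • ξ) by abel]; linarith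
      simp only [v2] at sb
      rw [intervalIntegral.integral_sub intervalIntegrable_const ((Continuous.intervalIntegrable (u := fun θ : ℝ => v (z + (t * exp (θ * I)) • ξ - s)) (vc.comp (by fun_prop))) _ _),
        intervalIntegral.integral_const, inv_mul_eq_div, le_div_iff₀ (by positivity)] at sb
      rw [← intervalIntegral.integral_of_le (by positivity), v1]
      simp only [smul_eq_mul, sub_zero] at sb
      linarith
    rw [intervalIntegral.integral_sub intervalIntegrable_const ((Continuous.intervalIntegrable (u := fun θ : ℝ => m (z + (t * exp (θ * I)) • ξ)) (ms.continuous.comp (by fun_prop))) _ _),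
        intervalIntegral.integral_const, inv_mul_eq_div, le_div_iff₀ (by positivity)]
    simp only [smul_eq_mul, sub_zero]
    linarith
end exh2


section ot
lemma riesz_abs {H V : Type*} [NormedAddCommGroup H] [InnerProductSpace ℂ H] [CompleteSpace H] [AddCommGroup V] [Module ℂ V]
    (A : V →ₗ[ℂ] H) (l : V →ₗ[ℂ] ℂ) {C : ℝ} (C0 : 0 ≤ C) (h : ∀ v, ‖l v‖ ≤ C * ‖A v‖) :
    ∃ U : H, ‖U‖ ≤ C ∧ ∀ v, l v = inner ℂ U (A v) := by
  obtain ⟨g, hg⟩ := LinearMap.exists_rightInverse_of_surjective A.rangeRestrict (LinearMap.range_rangeRestrict A)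
  have hg' : ∀ y : A.range, A (g y) = y := fun y => by
    have := LinearMap.congr_fun hg y
    simpa using congrArg Subtype.val this
  let f : A.range →L[ℂ] ℂ := (l ∘ₗ g).mkContinuous C (fun y => by simpa [hg' y] using h (g y))
  obtain ⟨F, hF, nF⟩ := exists_extension_norm_eq A.range f
  refine ⟨(InnerProductSpace.toDual ℂ H).symm F, ?_, fun v => ?_⟩
  · rw [LinearIsometryEquiv.norm_map, nF]; exact LinearMap.mkContinuous_norm_le _ C0 _
  · rw [InnerProductSpace.toDual_symm_apply]
    have := hF ⟨A v, v, rfl⟩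
    rw [this]
    have e : l (v - g ⟨A v, v, rfl⟩) = 0 := by
      have := h (v - g ⟨A v, v, rfl⟩)
      rw [map_sub A, hg'] at this
      simpa using this
    rw [map_sub, sub_eq_zero] at e
    exact e
variable {n : ℕ}
lemma Test.add {σ τ : 𝕍 n → ℂ} (hs : Test σ) (ht : Test τ) : Test (σ + τ) := ⟨hs.1.add ht.1, hs.2.add ht.2⟩
lemma riesz_u {U : Set (𝕍 n)} {g : Fin n → 𝕍 n → ℂ} (hg : ∀ j, Test (g j)) {m : 𝕍 n → ℝ} (hm : Continuous m)
    (m0 : ∀ z, 0 < m z) {K : ℝ} (K0 : 0 ≤ K)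
    (hb : ∀ α : Fin n → 𝕍 n → ℂ, (∀ j, Test (α j)) → (∀ j, tsupport (α j) ⊆ U) →
      ‖∑ j, ∫ x, conj (g j x) * α j x‖^2 ≤ K * ∫ z, m z * ‖∑ j, dz j (α j) z‖^2) :
    ∃ V : 𝕍 n → ℂ, MemLp V 2 ∧ ∫ z, ‖V z‖^2 ≤ K ∧ ∀ (j) (τ : 𝕍 n → ℂ), Test τ → tsupport τ ⊆ U →
      ∫ x, g j x * τ x = ∫ x, (rsqrt (m x) : ℂ) * V x * db j τ x := by
  let S : Submodule ℂ (Fin n → 𝕍 n → ℂ) :=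
    { carrier := {α | ∀ j, Test (α j) ∧ tsupport (α j) ⊆ U}
      add_mem' := fun {a b} ha hb j => ⟨(ha j).1.add (hb j).1, (tsupport_add _ _).trans (union_subset (ha j).2 (hb j).2)⟩
      zero_mem' := fun j => ⟨⟨contDiff_const, HasCompactSupport.zero⟩, by
        have : tsupport ((0 : Fin n → 𝕍 n → ℂ) j) = ∅ := by rw [tsupport_eq_empty_iff]; rfl
        rw [this]; exact empty_subset _⟩
      smul_mem' := fun c {a} ha j => ⟨(ha j).1.mul (σ := fun _ => c) contDiff_const,
        (tsupport_mul_subset_right (f := fun _ => c) (g := a j)).trans (ha j).2⟩ }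
  have sc : Continuous (fun x => (rsqrt (m x) : ℂ)) := by fun_prop
  have dl2 : ∀ α ∈ S, Test (fun x => ∑ j, dz j (α j) x) := fun α ha => by
    refine ⟨ContDiff.sum fun j _ => dz_sm j (ha j).1.1, ?_⟩
    have := HasCompactSupport.finset_sum (s := Finset.univ) (f := fun j => dz j (α j)) (fun j _ => dz_cs j (ha j).1.2)
    refine (congrArg HCS ?_).mp this; ext x; simp
  have mem : ∀ α ∈ S, MemLp (fun x => (rsqrt (m x) : ℂ) * ∑ j, dz j (α j) x) 2 := fun α ha =>
    (sc.mul (dl2 α ha).1.continuous).memLp_of_hasCompactSupport (dl2 α ha).2.mul_left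
  let A : S →ₗ[ℂ] Lp ℂ 2 (volume : Measure (𝕍 n)) :=
    { toFun := fun α => (mem α.1 α.2).toLp _
      map_add' := fun a b => by
        rw [← MemLp.toLp_add]
        congr 1; ext x
        simp only [Pi.add_apply, Submodule.coe_add, ← mul_add, ← Finset.sum_add_distrib]
        congr 1; refine Finset.sum_congr rfl fun j _ => ?_
        exact dz_add j (sm_da (a.2 j).1.1 x) (sm_da (b.2 j).1.1 x)
      map_smul' := fun c a => by
        rw [RingHom.id_apply, ← MemLp.toLp_const_smul]
        congr 1; ext x
        simp only [Pi.smul_apply, Submodule.coe_smul, smul_eq_mul, Finset.mul_sum]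
        refine Finset.sum_congr rfl fun j _ => ?_
        rw [show dz j (c • a.1 j) x = c * dz j (a.1 j) x from dz_cmul j c (sm_da (a.2 j).1.1 x)]; ring }
  have gi : ∀ α ∈ S, ∀ j, Integrable (fun x => conj (g j x) * α j x) := fun α ha j =>
    ((ha j).1.mul (conj_sm (hg j).1)).int
  let l : S →ₗ[ℂ] ℂ :=
    { toFun := fun α => ∑ j, ∫ x, conj (g j x) * α.1 j x
      map_add' := fun a b => by
        rw [← Finset.sum_add_distrib]
        refine Finset.sum_congr rfl fun j _ => ?_
        rw [← integral_add (gi a.1 a.2 j) (gi b.1 b.2 j)]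
        congr 1; ext x; simp [mul_add]
      map_smul' := fun c a => by
        rw [RingHom.id_apply, smul_eq_mul, Finset.mul_sum]
        refine Finset.sum_congr rfl fun j _ => ?_
        rw [← integral_const_mul]
        congr 1; ext x; simp; ring }
  have nA : ∀ α : S, ‖A α‖^2 = ∫ z, m z * ‖∑ j, dz j (α.1 j) z‖^2 := fun α => by
    have := l2_inner (mem α.1 α.2) (mem α.1 α.2)
    rw [inner_self_eq_norm_sq_to_K] at this
    have h2 : ((‖A α‖^2 : ℝ) : ℂ) = ((∫ z, m z * ‖∑ j, dz j (α.1 j) z‖^2 : ℝ) : ℂ) := by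
      rw [← integral_complex_ofReal]
      refine Eq.trans ?_ (this.trans ?_)
      · simp [A]
      · congr 1; ext x
        rw [conj_mul', norm_mul, norm_real, ← ofReal_pow, mul_pow, Real.norm_eq_abs, sq_abs, Real.sq_sqrt (m0 x).le]
    exact_mod_cast h2
  obtain ⟨V, nV, hV⟩ := riesz_abs A l (Real.sqrt_nonneg K) (fun α => by
    refine abs_le_of_sq_le_sq' ?_ (by positivity) |>.2
    rw [mul_pow, Real.sq_sqrt K0, nA]
    exact hb α.1 (fun j => (α.2 j).1) (fun j => (α.2 j).2))
  have VL : MemLp (V : 𝕍 n → ℂ) 2 := Lp.memLp V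
  have Ve : VL.toLp V = V := Lp.toLp_coeFn V VL
  refine ⟨V, VL, ?_, fun j τ ht hs => ?_⟩
  · have := l2_inner VL VL
    rw [Ve, inner_self_eq_norm_sq_to_K] at this
    have h2 : ((‖V‖^2 : ℝ) : ℂ) = ((∫ z, ‖V z‖^2 : ℝ) : ℂ) := by
      rw [← integral_complex_ofReal]
      refine Eq.trans ?_ (this.trans ?_)
      · simp
      · congr 1; ext x
        rw [conj_mul']; push_cast; rfl
    have h3 : ‖V‖^2 = ∫ z, ‖V z‖^2 := by exact_mod_cast h2
    rw [← h3]
    calc ‖V‖^2 ≤ rsqrt K^2 := by gcongr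
      _ = K := Real.sq_sqrt K0
  · let α : Fin n → 𝕍 n → ℂ := fun i => if i = j then (fun x => conj (τ x)) else fun _ => 0
    have ha : α ∈ S := by
      intro i
      by_cases h : i = j
      · simp only [α, h, if_true]
        refine ⟨ht.conj, ?_⟩
        refine (closure_mono ?_ : _ ⊆ tsupport τ).trans hs
        intro x hx; simpa using hx
      · simp only [α, h, if_false]
        exact S.zero_mem i
    have e := hV ⟨α, ha⟩
    rw [← Ve] at e
    have e2 : l ⟨α, ha⟩ = ∫ x, conj (g j x) * conj (τ x) := by
      change ∑ i, ∫ x, conj (g i x) * α i x = _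
      rw [Finset.sum_eq_single j (fun i _ h => by simp [α, h]) (by simp)]
      simp [α]
    rw [e2] at e
    have e3 := e.trans (l2_inner VL (mem α ha))
    have e4 : ∀ x, ∑ i, dz i (α i) x = conj (db j τ x) := by
      intro x
      rw [Finset.sum_eq_single j (fun i _ h => by simp only [α, h, if_false]; exact dz_const i 0) (by simp)]
      simp only [α, if_true]
      exact dz_conj j (sm_da ht.1 x)
    simp only [e4] at e3
    have e5 := congrArg (conj) e3
    rw [← integral_conj, ← integral_conj] at e5
    simp only [map_mul, conj_conj, conj_ofReal] at e5
    rw [e5]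
    congr 1; ext x; ring
end ot


section qq
variable {k : ℕ}
noncomputable def qf (z : 𝕍 (k+1)) : ℝ := ∑ j : Fin k, normSq (z j.succ)
lemma qf_sm : SMO (qf (k := k)) := ContDiff.sum fun j _ => normSq_sm (by fun_prop)
lemma qf_nn (z : 𝕍 (k+1)) : 0 ≤ qf z := Finset.sum_nonneg fun j _ => normSq_nonneg _
lemma dz_co {n : ℕ} (j i : Fin n) (z : 𝕍 n) : dz j (fun z => z i) z = if j = i then 1 else 0 := by
  rw [dz, show fderiv ℝ (fun z : 𝕍 n => z i) z = ContinuousLinearMap.proj i from (ContinuousLinearMap.proj (R := ℝ) (φ := fun _ : Fin n => ℂ) i).hasFDerivAt.fderiv]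
  by_cases h : j = i
  · subst h; simp; norm_num
  · simp [h, Pi.single_apply, Ne.symm h, eq_comm]
lemma db_co {n : ℕ} (j i : Fin n) (z : 𝕍 n) : db j (fun z => z i) z = 0 := by
  rw [db, show fderiv ℝ (fun z : 𝕍 n => z i) z = ContinuousLinearMap.proj i from (ContinuousLinearMap.proj (R := ℝ) (φ := fun _ : Fin n => ℂ) i).hasFDerivAt.fderiv]
  by_cases h : j = i
  · subst h; simp
  · simp [h, Pi.single_apply, Ne.symm h, eq_comm]
lemma co_da {n : ℕ} (i : Fin n) (z : 𝕍 n) : DifferentiableAt ℝ (fun z : 𝕍 n => z i) z := by fun_prop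
lemma db_qf (j : Fin (k+1)) : db j (fun z => (qf z : ℂ)) = fun z => if j = 0 then 0 else z j := by
  ext z
  have : (fun z : 𝕍 (k+1) => (qf z : ℂ)) = fun z => ∑ i : Fin k, z i.succ * conj (z i.succ) := by
    ext z; simp [qf, mul_conj]
  rw [this]
  have s : db j (fun z : 𝕍 (k+1) => ∑ i : Fin k, z i.succ * conj (z i.succ)) z
      = ∑ i : Fin k, db j (fun z : 𝕍 (k+1) => z i.succ * conj (z i.succ)) z := by
    unfold db
    rw [fderiv_fun_sum (A := fun (i : Fin k) (z : 𝕍 (k+1)) => z i.succ * conj (z i.succ)) fun i _ => (co_da _ z).mul (conj_da (co_da _ z))]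
    simp [Finset.mul_sum, Finset.sum_add_distrib, mul_add]
  have t : ∀ i : Fin k, db j (fun z : 𝕍 (k+1) => z i.succ * conj (z i.succ)) z = if j = i.succ then z i.succ else 0 := by
    intro i
    rw [db_mul j (co_da _ z) (conj_da (co_da _ z)), db_co, db_conj j (co_da _ z), dz_co]
    split_ifs <;> simp
  rw [s]; simp only [t]
  refine Fin.cases ?_ (fun i => ?_) j
  · simp [Fin.succ_ne_zero, eq_comm]
  · simp [Fin.succ_ne_zero]
lemma Lev_qf (z ξ : 𝕍 (k+1)) : Lev qf z ξ = ∑ j : Fin k, ‖ξ j.succ‖^2 := by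
  rw [Lev]
  have : ∀ i j : Fin (k+1), dz i (db j (fun z => (qf z : ℂ))) z = if j = 0 then 0 else if i = j then 1 else 0 := by
    intro i j
    rw [db_qf]
    by_cases h : j = 0
    · simp only [h, if_true]; exact dz_const i 0
    · simp only [h, if_false]; exact dz_co i j z
  simp only [this]
  rw [Finset.sum_comm, Fin.sum_univ_succ]
  simp [Fin.succ_ne_zero, mul_conj, ← Complex.sq_norm, ← ofReal_pow]
lemma dl_qf (z ξ : 𝕍 (k+1)) : ‖dl qf z ξ‖^2 ≤ qf z * ∑ j : Fin k, ‖ξ j.succ‖^2 := by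
  have : ∀ j : Fin (k+1), dz j (fun z => (qf z : ℂ)) z = conj (if j = 0 then 0 else z j) := by
    intro j
    have := db_real j (qf_sm.differentiable (by simp) z)
    rw [db_qf] at this
    simp only at this
    rw [this, conj_conj]
  rw [dl]; simp only [this]
  rw [Fin.sum_univ_succ]
  simp only [Fin.succ_ne_zero, if_true, if_false, map_zero, zero_mul, zero_add]
  have h1 : ‖∑ i : Fin k, conj (z i.succ) * ξ i.succ‖ ≤ ∑ i : Fin k, ‖z i.succ‖ * ‖ξ i.succ‖ := by
    refine (norm_sum_le _ _).trans_eq ?_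
    simp
  refine (pow_le_pow_left₀ (norm_nonneg _) h1 2).trans ((Finset.sum_mul_sq_le_sq_mul_sq _ _ _).trans_eq ?_)
  simp [qf, Complex.normSq_eq_norm_sq]
noncomputable def Gm (t : ℝ) : ℝ := 1 + (t - 1) * Real.smoothTransition (t - 1)
lemma Gm_one (t : ℝ) : 1 ≤ Gm t := by
  rw [Gm]
  rcases le_total t 1 with h | h
  · rw [Real.smoothTransition.zero_of_nonpos (by linarith)]; simp
  · nlinarith [Real.smoothTransition.nonneg (t-1)]
lemma Gm_id {t : ℝ} (h : 2 ≤ t) : Gm t = t := by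
  rw [Gm, Real.smoothTransition.one_of_one_le (by linarith)]; ring
lemma Gm_sm : SMO Gm :=
  contDiff_const.add ((contDiff_id.sub contDiff_const).mul (Real.smoothTransition.contDiff.comp (contDiff_id.sub contDiff_const)))
noncomputable def etaf (B δ : ℝ) (z : 𝕍 (k+1)) : ℝ := Gm (B - rlog (qf z + δ^2) - qf z)
lemma qd_pos {δ : ℝ} (d0 : 0 < δ) (z : 𝕍 (k+1)) : 0 < qf z + δ^2 := by have := qf_nn z; positivity
lemma log_sm {δ : ℝ} (d0 : 0 < δ) : SMO (fun z : 𝕍 (k+1) => rlog (qf z + δ^2)) :=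
  (qf_sm.add contDiff_const).log fun z => (qd_pos d0 z).ne'
lemma etaf_sm {B δ : ℝ} (d0 : 0 < δ) : SMO (etaf (k := k) B δ) :=
  Gm_sm.comp ((contDiff_const.sub (log_sm d0)).sub qf_sm)
lemma etaf_id {B δ Q : ℝ} (d0 : 0 < δ) (d1 : δ ≤ 1) (hB : 3 + rlog (Q+1) + Q ≤ B) {t : ℝ} (t0 : 0 ≤ t) (tQ : t ≤ Q) :
    3 ≤ B - rlog (t + δ^2) - t := by
  have : rlog (t + δ^2) ≤ rlog (Q + 1) := Real.log_le_log (by positivity) (by nlinarith)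
  linarith
lemma lev_phi {κ δ : ℝ} (d0 : 0 < δ) (k0 : 0 ≤ κ) (z ξ : 𝕍 (k+1)) : 0 ≤ Lev (fun z => κ * rlog (qf z + δ^2)) z ξ := by
  have hp := qd_pos d0 z
  have h1 : ∀ᶠ t in 𝓝 (qf z), HasDerivAt (fun t => κ * rlog (t + δ^2)) (κ * (t + δ^2)⁻¹) t := by
    have : ∀ᶠ t in 𝓝 (qf z), 0 < t + δ^2 := (continuous_id.add continuous_const).continuousAt.eventually (lt_mem_nhds hp)
    filter_upwards [this] with t ht
    simpa using (((hasDerivAt_id t).add_const (δ^2)).log ht.ne').const_mul κ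
  have h2 : HasDerivAt (fun t => κ * (t + δ^2)⁻¹) (κ * (-1 / (qf z + δ^2)^2)) (qf z) :=
    (((hasDerivAt_id _).add_const (δ^2)).inv hp.ne').const_mul κ
  rw [Lev_comp qf_sm (G := fun t => κ * rlog (t + δ^2)) h1 h2, Lev_qf]
  have := dl_qf z ξ
  have A0 : 0 ≤ ∑ j : Fin k, ‖ξ j.succ‖^2 := by positivity
  generalize (∑ j : Fin k, ‖ξ j.succ‖^2) = A at *
  generalize ‖dl qf z ξ‖^2 = b at *
  have e : κ * (qf z + δ^2)⁻¹ * A + κ * (-1 / (qf z + δ^2)^2) * b = κ * ((qf z + δ^2) * A - b) / (qf z + δ^2)^2 := by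
    field_simp; ring
  rw [e]
  have : 0 ≤ (qf z + δ^2) * A - b := by nlinarith [mul_nonneg (sq_nonneg δ) A0]
  positivity
lemma lev_eta {B δ Q : ℝ} (d0 : 0 < δ) (d1 : δ ≤ 1) (hB : 3 + rlog (Q+1) + Q ≤ B) {z : 𝕍 (k+1)} (hQ : qf z ≤ Q) (ξ : 𝕍 (k+1)) :
    δ^2 / (qf z + δ^2)^2 * ∑ j : Fin k, ‖ξ j.succ‖^2 ≤ - Lev (etaf B δ) z ξ - ‖dl (etaf B δ) z ξ‖^2 / ((2 + Q)^2 / (qf z + δ^2)) := by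
  have hp := qd_pos d0 z
  have h3 := etaf_id d0 d1 hB (qf_nn z) hQ
  have h1 : ∀ᶠ t in 𝓝 (qf z), HasDerivAt (fun t => Gm (B - rlog (t + δ^2) - t)) (- (t + δ^2)⁻¹ - 1) t := by
    have a1 : ∀ᶠ t in 𝓝 (qf z), 0 < t + δ^2 := (continuous_id.add continuous_const).continuousAt.eventually (lt_mem_nhds hp)
    have a2 : ContinuousAt (fun t => B - rlog (t + δ^2) - t) (qf z) :=
      by fun_prop (disch := exact hp.ne')
    have a3 := (a2.eventually (lt_mem_nhds (show (2:ℝ) < B - rlog (qf z + δ^2) - qf z by linarith))).eventually_nhds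
    filter_upwards [a1, a3] with t ht h2
    have e : (fun t => Gm (B - rlog (t + δ^2) - t)) =ᶠ[𝓝 t] fun t => B - rlog (t + δ^2) - t := by
      filter_upwards [h2] with s hs using Gm_id hs.le
    refine HasDerivAt.congr_of_eventuallyEq ?_ e
    refine HasDerivAt.congr_deriv (((((hasDerivAt_id t).add_const (δ^2)).log ht.ne').const_sub B).sub (hasDerivAt_id t)) ?_
    simp
  have h2 : HasDerivAt (fun t => - (t + δ^2)⁻¹ - 1) (- (-1 / (qf z + δ^2)^2)) (qf z) :=
    ((((hasDerivAt_id _).add_const (δ^2)).inv hp.ne').neg).sub_const 1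
  have L := Lev_comp qf_sm h1 h2 ξ
  have M := dl_comp qf_sm h1.self_of_nhds ξ
  change Lev (etaf B δ) z ξ = _ at L
  change dl (etaf B δ) z ξ = _ at M
  rw [L, M, Lev_qf, norm_mul, mul_pow, norm_real, Real.norm_eq_abs, sq_abs]
  have hb := dl_qf z ξ
  have A0 : 0 ≤ ∑ j : Fin k, ‖ξ j.succ‖^2 := by positivity
  have b0 : 0 ≤ ‖dl qf z ξ‖^2 := by positivity
  have q0 := qf_nn z
  generalize (∑ j : Fin k, ‖ξ j.succ‖^2) = A at *
  generalize ‖dl qf z ξ‖^2 = b at *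
  generalize qf z = q at *
  have Q0 : 0 ≤ Q := q0.trans hQ
  have e1 : (-(q + δ^2)⁻¹ - 1)^2 * b / ((2 + Q)^2 / (q + δ^2)) = ((1 + (q + δ^2))^2 / (2 + Q)^2) * (b / (q + δ^2)) := by
    field_simp; ring
  have e2 : (1 + (q + δ^2))^2 / (2 + Q)^2 ≤ 1 := by
    rw [div_le_one (by positivity)]
    have : δ^2 ≤ 1 := by nlinarith
    exact pow_le_pow_left₀ (by positivity) (by linarith) 2
  have e3 : b / (q + δ^2) ≤ A := by
    rw [div_le_iff₀ hp]; nlinarith [mul_nonneg (sq_nonneg δ) A0]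
  have e4 : ((1 + (q + δ^2))^2 / (2 + Q)^2) * (b / (q + δ^2)) ≤ A :=
    (mul_le_of_le_one_left (by positivity) e2).trans e3
  rw [e1]
  have e5 : δ^2 / (q + δ^2)^2 * A ≤ (q + δ^2)⁻¹ * A - b / (q + δ^2)^2 := by
    have : (q + δ^2)⁻¹ * A - b / (q + δ^2)^2 = ((q + δ^2) * A - b) / (q + δ^2)^2 := by field_simp
    rw [this, div_mul_eq_mul_div]
    gcongr
    linarith
  have e6 : - (-1 / (q + δ^2)^2) * b = b / (q + δ^2)^2 := by ring
  linarith
lemma eta_ub {B δ Q : ℝ} (d0 : 0 < δ) (d1 : δ ≤ 1) (hB : 3 + rlog (Q+1) + Q ≤ B) {z : 𝕍 (k+1)} (hQ : qf z ≤ Q) :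
    etaf B δ z + (2 + Q)^2 / (qf z + δ^2) ≤ (B * (Q + 1) + 1 + (2 + Q)^2) / (qf z + δ^2) := by
  have hp := qd_pos d0 z
  have h3 := etaf_id d0 d1 hB (qf_nn z) hQ
  have q0 := qf_nn z
  rw [etaf, Gm_id (by linarith)]
  generalize qf z = q at *
  have l := Real.one_sub_inv_le_log_of_pos hp
  have : B ≤ B * (Q + 1) / (q + δ^2) := by
    rw [le_div_iff₀ hp]
    have : 0 ≤ B := by
      have : 0 ≤ rlog (Q + 1) := Real.log_nonneg (by linarith)
      linarith
    gcongr
    nlinarith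
  rw [add_div, add_div, one_div]
  linarith
end qq


section hh
variable {k : ℕ}
lemma db_holo {n : ℕ} {F : 𝕍 n → ℂ} {z : 𝕍 n} (h : DifferentiableAt ℂ F z) (j : Fin n) : db j F z = 0 := by
  rw [db, h.fderiv_restrictScalars ℝ]
  have : (Pi.single j I : 𝕍 n) = I • Pi.single j 1 := by rw [← Pi.single_smul]; simp
  rw [this]
  simp only [ContinuousLinearMap.coe_restrictScalars', map_smul, smul_eq_mul]
  linear_combination (1/2) * (fderiv ℂ F z (Pi.single j 1)) * I_mul_I
lemma slab_int {a : ℂ → ℝ} (ha : Integrable a) {δ : ℝ} (d0 : 0 ≤ δ) :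
    Integrable (fun z : 𝕍 (k+1) => a (z 0) * ∏ j : Fin k, (closedBall (0:ℂ) δ).indicator (fun _ => (1:ℝ)) (z j.succ)) ∧
    ∫ z : 𝕍 (k+1), a (z 0) * ∏ j : Fin k, (closedBall (0:ℂ) δ).indicator (fun _ => (1:ℝ)) (z j.succ) = (∫ x, a x) * (π * δ^2)^k := by
  let F : Fin (k+1) → ℂ → ℝ := Fin.cons a fun _ => (closedBall (0:ℂ) δ).indicator (fun _ => (1:ℝ))
  have e : (fun z : 𝕍 (k+1) => a (z 0) * ∏ j : Fin k, (closedBall (0:ℂ) δ).indicator (fun _ => (1:ℝ)) (z j.succ)) = fun z => ∏ i, F i (z i) := by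
    ext z; rw [Fin.prod_univ_succ]; simp [F]
  rw [e]
  have i1 : Integrable ((closedBall (0:ℂ) δ).indicator (fun _ => (1:ℝ))) :=
    (integrableOn_const (by exact (measure_closedBall_lt_top).ne)).integrable_indicator measurableSet_closedBall
  constructor
  · refine Integrable.fintype_prod (f := F) fun i => ?_
    refine Fin.cases ?_ (fun j => ?_) i
    · simpa [F] using ha
    · simpa [F] using i1
  · rw [integral_fintype_prod_volume_eq_prod, Fin.prod_univ_succ]
    simp only [F, Fin.cons_zero, Fin.cons_succ, Finset.prod_const, Finset.card_univ, Fintype.card_fin]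
    congr 2
    rw [integral_indicator measurableSet_closedBall, setIntegral_const]
    simp [Measure.real, Complex.volume_closedBall, mul_comm, d0]
lemma qf_coord {z : 𝕍 (k+1)} {δ : ℝ} (d0 : 0 ≤ δ) (h : qf z ≤ δ^2) (j : Fin k) : ‖z j.succ‖ ≤ δ := by
  have : normSq (z j.succ) ≤ qf z := Finset.single_le_sum (f := fun j : Fin k => normSq (z j.succ)) (fun j _ => normSq_nonneg _) (Finset.mem_univ j)
  rw [normSq_eq_norm_sq] at this
  exact abs_le_of_sq_le_sq' (this.trans h) d0 |>.2
noncomputable def hf (f : ℂ → ℂ) (ρ : 𝕍 (k+1) → ℝ) (δ : ℝ) (z : 𝕍 (k+1)) : ℂ :=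
  f (z 0) * (Real.smoothTransition (3 - 4 * (qf z / δ^2)) * Real.smoothTransition (2 - ρ z) : ℝ)
structure HD (f : ℂ → ℂ) (ρ : 𝕍 (k+1) → ℝ) (δ : ℝ) (U Rg : Set ℂ) : Prop where
  uo : IsOpen U
  fd : DifferentiableOn ℂ f U
  sm : SMO ρ
  cp : IsCompact {z | ρ z ≤ 2}
  d0 : 0 < δ
  d1 : δ ≤ 1
  rg : ∀ z, ρ z ≤ 2 → qf z ≤ δ^2 → z 0 ∈ Rg
  ru : Rg ⊆ U
  rc : IsCompact Rg
variable {f : ℂ → ℂ} {ρ : 𝕍 (k+1) → ℝ} {δ : ℝ} {U Rg : Set ℂ}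
lemma HD.z1 (h : HD f ρ δ U Rg) {z : 𝕍 (k+1)} (hz : 2 < ρ z) : hf f ρ δ z = 0 := by
  rw [hf, Real.smoothTransition.zero_of_nonpos (x := 2 - ρ z) (by linarith)]; simp
lemma HD.z2 (h : HD f ρ δ U Rg) {z : 𝕍 (k+1)} (hz : 3/4 * δ^2 < qf z) : hf f ρ δ z = 0 := by
  have d := h.d0
  have : 3/4 < qf z / δ^2 := by rw [lt_div_iff₀ (by positivity)]; exact hz
  rw [hf, Real.smoothTransition.zero_of_nonpos (by linarith)]; simp
lemma HD.z2e (h : HD f ρ δ U Rg) {z : 𝕍 (k+1)} (hz : 3/4 * δ^2 < qf z) : hf f ρ δ =ᶠ[𝓝 z] fun _ => 0 := by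
  filter_upwards [qf_sm.continuous.continuousAt.eventually (lt_mem_nhds hz)] with y hy using h.z2 hy
lemma HD.nrm (h : HD f ρ δ U Rg) (z : 𝕍 (k+1)) : ‖hf f ρ δ z‖ ≤ ‖f (z 0)‖ := by
  rw [hf, norm_mul, norm_real, Real.norm_eq_abs, abs_of_nonneg (mul_nonneg (Real.smoothTransition.nonneg _) (Real.smoothTransition.nonneg _))]
  exact mul_le_of_le_one_right (norm_nonneg _) (mul_le_one₀ (Real.smoothTransition.le_one _) (Real.smoothTransition.nonneg _) (Real.smoothTransition.le_one _))
lemma HD.test (h : HD f ρ δ U Rg) : Test (hf f ρ δ) := by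
  refine ⟨contDiff_iff_contDiffAt.2 fun z => ?_, HasCompactSupport.intro h.cp fun z hz => h.z1 (by simpa using hz)⟩
  have d := h.d0
  by_cases h1 : 2 < ρ z
  · have : hf f ρ δ =ᶠ[𝓝 z] fun _ => 0 := by
      filter_upwards [h.sm.continuous.continuousAt.eventually (lt_mem_nhds h1)] with y hy using h.z1 hy
    exact contDiffAt_const.congr_of_eventuallyEq this
  by_cases h2 : 3/4 * δ^2 < qf z
  · exact contDiffAt_const.congr_of_eventuallyEq (h.z2e h2)
  have zu : z 0 ∈ U := h.ru (h.rg z (not_lt.1 h1) (by nlinarith [not_lt.1 h2, sq_nonneg δ]))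
  have fc : ContDiffAt ℝ ∞ f (z 0) := ((h.fd.contDiffOn h.uo (n := ∞)).contDiffAt (h.uo.mem_nhds zu)).restrict_scalars ℝ
  have f2 : ContDiffAt ℝ ∞ (fun z : 𝕍 (k+1) => f (z 0)) z := ContDiffAt.comp z fc (by fun_prop)
  refine f2.mul (ContDiff.contDiffAt ?_)
  refine ofReal_sm ((Real.smoothTransition.contDiff.comp ?_).mul (Real.smoothTransition.contDiff.comp ?_))
  · exact contDiff_const.sub (contDiff_const.mul (qf_sm.div_const _))
  · exact contDiff_const.sub h.sm
lemma HD.fda (h : HD f ρ δ U Rg) {z : 𝕍 (k+1)} (h1 : ρ z ≤ 2) (h2 : qf z ≤ δ^2) : DifferentiableAt ℂ (fun z : 𝕍 (k+1) => f (z 0)) z :=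
  DifferentiableAt.comp z (h.fd.differentiableAt (h.uo.mem_nhds (h.ru (h.rg z h1 h2)))) (by fun_prop)
lemma HD.near (h : HD f ρ δ U Rg) {z : 𝕍 (k+1)} (h1 : ρ z < 1) (h2 : qf z < δ^2/2) : hf f ρ δ =ᶠ[𝓝 z] fun z => f (z 0) := by
  have d := h.d0
  filter_upwards [h.sm.continuous.continuousAt.eventually (gt_mem_nhds h1), qf_sm.continuous.continuousAt.eventually (gt_mem_nhds h2)] with y hy h3
  have : qf y / δ^2 ≤ 1/2 := by rw [div_le_iff₀ (by positivity)]; linarith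
  rw [hf, Real.smoothTransition.one_of_one_le (by linarith), Real.smoothTransition.one_of_one_le (by linarith)]; simp
lemma HD.dbj (h : HD f ρ δ U Rg) {z : 𝕍 (k+1)} (h1 : ρ z < 1) (h2 : qf z < δ^2) (j : Fin (k+1)) :
    db j (hf f ρ δ) z = f (z 0) * ((deriv Real.smoothTransition (3 - 4 * (qf z / δ^2)) * (-4 / δ^2) : ℝ) * db j (fun z => (qf z : ℂ)) z) := by
  have e : hf f ρ δ =ᶠ[𝓝 z] fun z => f (z 0) * (Real.smoothTransition (3 - 4 * (qf z / δ^2)) : ℝ) := by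
    filter_upwards [h.sm.continuous.continuousAt.eventually (gt_mem_nhds h1)] with y hy
    rw [hf, Real.smoothTransition.one_of_one_le (x := 2 - ρ y) (by linarith), mul_one]
  have hd : HasDerivAt (fun t => Real.smoothTransition (3 - 4 * (t / δ^2))) (deriv Real.smoothTransition (3 - 4 * (qf z / δ^2)) * (-4 / δ^2)) (qf z) := by
    refine HasDerivAt.comp (h₂ := Real.smoothTransition) (qf z) ((Real.smoothTransition.contDiff (n := 1)).differentiable (by simp) _).hasDerivAt ?_
    refine ((((hasDerivAt_id (qf z)).div_const (δ^2)).const_mul 4).const_sub 3).congr_deriv (by ring)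
  have a := h.fda (h1.le.trans (by norm_num)) h2.le
  have b : DifferentiableAt ℝ (fun z : 𝕍 (k+1) => ((Real.smoothTransition (3 - 4 * (qf z / δ^2)) : ℝ) : ℂ)) z :=
    ofReal_da (hd.differentiableAt.comp z (qf_sm.differentiable (by simp) z))
  rw [db_congr j e, db_mul j (a.restrictScalars ℝ) b, db_holo a, db_comp j (qf_sm.differentiable (by simp) z) hd]
  ring
lemma HD.db0 (h : HD f ρ δ U Rg) {z : 𝕍 (k+1)} (h1 : ρ z < 1) : db 0 (hf f ρ δ) z = 0 := by
  have d := h.d0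
  by_cases h2 : qf z < δ^2
  · rw [h.dbj h1 h2, db_qf]; simp
  · rw [db_congr 0 (h.z2e (by nlinarith [sq_pos_of_pos d]))]; exact db_const 0 0
lemma HD.dbs (h : HD f ρ δ U Rg) {M : ℝ} (hM : ∀ t ∈ Icc (-1:ℝ) 3, |deriv Real.smoothTransition t| ≤ M) {z : 𝕍 (k+1)} (h1 : ρ z < 1) :
    ∑ j : Fin k, ‖db j.succ (hf f ρ δ) z‖^2 ≤ 16 * M^2 / δ^2 * ‖f (z 0)‖^2 ∧ (¬ (δ^2/2 ≤ qf z ∧ qf z ≤ δ^2) → ∑ j : Fin k, ‖db j.succ (hf f ρ δ) z‖^2 = 0) := by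
  have d := h.d0
  have dp := sq_pos_of_pos d
  by_cases h2 : qf z < δ^2
  · have e : ∑ j : Fin k, ‖db j.succ (hf f ρ δ) z‖^2 = ‖f (z 0)‖^2 * (deriv Real.smoothTransition (3 - 4 * (qf z / δ^2)))^2 * (16 / δ^2) * (qf z / δ^2) := by
      have : ∀ j : Fin k, ‖db j.succ (hf f ρ δ) z‖^2 = ‖f (z 0)‖^2 * (deriv Real.smoothTransition (3 - 4 * (qf z / δ^2)))^2 * (16 / (δ^2 * δ^2)) * normSq (z j.succ) := by
        intro j
        rw [h.dbj h1 h2, db_qf, normSq_eq_norm_sq]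
        simp only [Fin.succ_ne_zero, if_false, norm_mul, norm_real, mul_pow, Real.norm_eq_abs, sq_abs, div_pow]
        field_simp; ring
      simp only [this, ← Finset.mul_sum]
      change _ * qf z = _
      field_simp
    rw [e]
    have q0 := qf_nn z
    have t0 : 0 ≤ qf z / δ^2 := by positivity
    have t1 : qf z / δ^2 ≤ 1 := by rw [div_le_one dp]; exact h2.le
    constructor
    · have hm := hM (3 - 4 * (qf z / δ^2)) ⟨by linarith, by linarith⟩
      have : (deriv Real.smoothTransition (3 - 4 * (qf z / δ^2)))^2 ≤ M^2 := sq_le_sq' (by linarith [(abs_le.1 hm).1]) (abs_le.1 hm).2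
      calc _ ≤ ‖f (z 0)‖^2 * M^2 * (16 / δ^2) * 1 := by gcongr
        _ = _ := by ring
    · intro hn
      have h3 : qf z < δ^2/2 := by by_contra h4; exact hn ⟨not_lt.1 h4, h2.le⟩
      have h4 : qf z / δ^2 < 1/2 := by rw [div_lt_iff₀ dp]; linarith
      have : deriv Real.smoothTransition (3 - 4 * (qf z / δ^2)) = 0 := by
        have : Real.smoothTransition =ᶠ[𝓝 (3 - 4 * (qf z / δ^2))] fun _ => 1 := by
          filter_upwards [lt_mem_nhds (show 1 < 3 - 4 * (qf z / δ^2) by linarith)] with t ht using Real.smoothTransition.one_of_one_le ht.le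
        rw [this.deriv_eq]; simp
      rw [this]; ring
  · have : ∑ j : Fin k, ‖db j.succ (hf f ρ δ) z‖^2 = 0 := Finset.sum_eq_zero fun j _ => by
      rw [db_congr _ (h.z2e (by nlinarith)), db_const]; simp
    exact ⟨by rw [this]; positivity, fun _ => this⟩
lemma HD.fint (h : HD f ρ δ U Rg) : Integrable (Rg.indicator fun x => ‖f x‖^2) :=
  ((((h.fd.continuousOn.mono h.ru).norm).pow 2).integrableOn_compact h.rc).integrable_indicator h.rc.measurableSet
lemma HD.slab (h : HD f ρ δ U Rg) {c : ℝ} (c0 : 0 ≤ c) {A : 𝕍 (k+1) → ℝ} (A0 : ∀ z, 0 ≤ A z)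
    (hA : ∀ z, A z ≤ c * ‖f (z 0)‖^2) (hA2 : ∀ z, ¬ (ρ z ≤ 2 ∧ qf z ≤ δ^2) → A z = 0) :
    ∫ z, A z ≤ c * ((∫ x in Rg, ‖f x‖^2) * (π * δ^2)^k) := by
  obtain ⟨i1, i2⟩ := slab_int (k := k) h.fint h.d0.le
  rw [integral_indicator h.rc.measurableSet] at i2
  rw [← i2, ← integral_const_mul]
  refine integral_mono_of_nonneg (ae_of_all _ A0) (i1.const_mul c) (ae_of_all _ fun z => ?_)
  by_cases hz : ρ z ≤ 2 ∧ qf z ≤ δ^2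
  · simp only
    rw [indicator_of_mem (h.rg z hz.1 hz.2), Finset.prod_eq_one fun j _ => ?_, mul_one]
    · exact hA z
    · exact indicator_of_mem (by simpa using qf_coord h.d0.le hz.2 j) _
  · simp only; rw [hA2 z hz]
    refine mul_nonneg c0 (mul_nonneg (indicator_nonneg (fun _ _ => by positivity) _) (Finset.prod_nonneg fun j _ => indicator_nonneg (fun _ _ => by norm_num) _))
lemma HD.sq (h : HD f ρ δ U Rg) : ∫ z, ‖hf f ρ δ z‖^2 ≤ (∫ x in Rg, ‖f x‖^2) * (π * δ^2)^k := by
  have := h.slab (c := 1) zero_le_one (A := fun z => ‖hf f ρ δ z‖^2) (fun z => by positivity)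
    (fun z => by rw [one_mul]; exact pow_le_pow_left₀ (norm_nonneg _) (h.nrm z) 2) (fun z hz => by
      by_cases h1 : ρ z ≤ 2
      · have : ¬ qf z ≤ δ^2 := fun h2 => hz ⟨h1, h2⟩
        rw [h.z2 (by nlinarith [sq_nonneg δ])]; simp
      · rw [h.z1 (not_le.1 h1)]; simp)
  rwa [one_mul] at this
end hh


section oo
variable {k : ℕ}
noncomputable def bq (Q : ℝ) : ℝ := 3 + rlog (Q+1) + Q
noncomputable def mm (Q ε δ t : ℝ) (z : 𝕍 (k+1)) : ℝ := (etaf (bq Q) δ z + (2 + Q)^2 / (qf z + δ^2)) * (qf z + t^2)^((k:ℝ)+ε)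
variable {f : ℂ → ℂ} {ρ : 𝕍 (k+1) → ℝ} {δ Q ε t M : ℝ} {U Rg : Set ℂ}
lemma mm_cont (d0 : 0 < δ) (t0 : 0 < t) : Continuous (mm (k := k) Q ε δ t) := by
  refine ((etaf_sm d0).continuous.add (continuous_const.div (qf_sm.continuous.add continuous_const) fun z => (qd_pos d0 z).ne')).mul ?_
  exact (qf_sm.continuous.add continuous_const).rpow_const fun z => Or.inl (qd_pos t0 z).ne'
lemma mm_pos (d0 : 0 < δ) (t0 : 0 < t) (z : 𝕍 (k+1)) : 0 < mm Q ε δ t z := by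
  have := Gm_one (bq Q - rlog (qf z + δ^2) - qf z)
  have h := qd_pos d0 z
  exact mul_pos (add_pos_of_pos_of_nonneg (by rw [etaf]; linarith) (by positivity)) (Real.rpow_pos_of_pos (qd_pos t0 z) _)
lemma mm_ub (d0 : 0 < δ) (d1 : δ ≤ 1) (t0 : 0 < t) {z : 𝕍 (k+1)} (hQ : qf z ≤ Q) :
    mm Q ε δ t z ≤ (bq Q * (Q + 1) + 1 + (2 + Q)^2) / (qf z + δ^2) * (qf z + t^2)^((k:ℝ)+ε) :=
  mul_le_mul_of_nonneg_right (eta_ub d0 d1 le_rfl hQ) (Real.rpow_nonneg (qd_pos t0 z).le _)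
lemma HD.sol (h : HD f ρ δ U Rg) (hL : ∀ z, ρ z < 2 → ∀ ξ, 0 ≤ Lev ρ z ξ) (hQ : ∀ z, ρ z ≤ 2 → qf z ≤ Q) (Q0 : 0 ≤ Q)
    (hM : ∀ t ∈ Icc (-1:ℝ) 3, |deriv Real.smoothTransition t| ≤ M) (e0 : 0 < ε) (he : (2/δ^2)^ε ≤ 2) (t0 : 0 < t) :
    ∃ V : 𝕍 (k+1) → ℂ, MemLp V 2 ∧ ∫ z, ‖V z‖^2 ≤ 4 * rexp 1^2 * (k * (128 * M^2 * (2 * π)^k * ∫ x in Rg, ‖f x‖^2)) ∧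
      ∀ (j) (τ : 𝕍 (k+1) → ℂ), Test τ → tsupport τ ⊆ {z | ρ z < 0} →
      ∫ x, db j (hf f ρ δ) x * τ x = ∫ x, (rsqrt (mm Q ε δ t x) : ℂ) * V x * db j τ x := by
  have d := h.d0
  have I0 : 0 ≤ ∫ x in Rg, ‖f x‖^2 := integral_nonneg fun _ => by positivity
  refine riesz_u (fun j => h.test.db j) (mm_cont d t0) (mm_pos d t0) (by positivity) fun α hα sα => ?_
  have c1 : IsCompact {z | ρ z ≤ 1} := h.cp.of_isClosed_subset (isClosed_le h.sm.continuous continuous_const) fun z (hz : ρ z ≤ 1) => show ρ z ≤ 2 by linarith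
  have cq : Continuous fun z : 𝕍 (k+1) => qf z + δ^2 := qf_sm.continuous.add continuous_const
  refine (tdual (φ := fun z => ((k:ℝ)+ε) * rlog (qf z + t^2)) (η := etaf (bq Q) δ) (lam := fun z => (2 + Q)^2 / (qf z + δ^2))
    (om := fun z => δ^2 / (qf z + δ^2)^2) (contDiff_const.mul (log_sm t0)) h.sm (etaf_sm d)
    (continuous_const.div cq fun z => (qd_pos d z).ne')
    (continuous_const.div (cq.pow 2) fun z => (pow_pos (qd_pos d z) 2).ne')
    (fun z => Gm_one _) (fun z => div_pos (by positivity) (qd_pos d z)) (fun z => div_pos (by positivity) (pow_pos (qd_pos d z) 2)) c1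
    (fun z hz => hL z (by linarith)) (fun z hz => lev_phi t0 (by positivity) z) (fun z hz => lev_eta d h.d1 le_rfl (hQ z (by linarith)))
    h.test (fun z hz => h.db0 hz) (Cg := k * (128 * M^2 * (2 * π)^k * ∫ x in Rg, ‖f x‖^2)) ?_ hα sα).trans_eq ?_
  · have hp := h.slab (c := k * (128 * M^2 * (2/δ^2)^k)) (by positivity)
      (A := {z | ρ z < 1}.indicator fun z => (δ^2 / (qf z + δ^2)^2)⁻¹ * (∑ j : Fin k, ‖db j.succ (hf f ρ δ) z‖^2) * rexp (-(((k:ℝ)+ε) * rlog (qf z + t^2)))) ?_ ?_ ?_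
    · rw [integral_indicator (measurableSet_lt h.sm.continuous.measurable measurable_const)] at hp
      refine hp.trans_eq ?_
      rw [show (2 * π)^k = (2/δ^2)^k * (π * δ^2)^k by rw [← mul_pow]; congr 1; field_simp]
      ring
    · exact fun z => indicator_nonneg (fun z _ => by positivity) z
    · intro z
      refine indicator_apply_le' (fun hz => ?_) fun _ => by positivity
      obtain ⟨a1, a2⟩ := h.dbs hM hz
      by_cases hz2 : δ^2/2 ≤ qf z ∧ qf z ≤ δ^2
      · rcases Nat.eq_zero_or_pos k with rfl | hk
        · simp
        have hk1 : (1:ℝ) ≤ k := by exact_mod_cast hk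
        have b1 : (δ^2 / (qf z + δ^2)^2)⁻¹ ≤ 4 * δ^2 := by
          rw [inv_div, div_le_iff₀ (by positivity)]
          nlinarith [qf_nn z]
        have b2 : rexp (-(((k:ℝ)+ε) * rlog (qf z + t^2))) ≤ 2 * (2/δ^2)^k := by
          have : rexp (-(((k:ℝ)+ε) * rlog (qf z + t^2))) = ((qf z + t^2)⁻¹)^((k:ℝ)+ε) := by
            rw [Real.rpow_def_of_pos (inv_pos.2 (qd_pos t0 z)), Real.log_inv]; congr 1; ring
          rw [this]
          have i1 : (qf z + t^2)⁻¹ ≤ 2/δ^2 := by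
            rw [inv_le_comm₀ (qd_pos t0 z) (by positivity), inv_div]; nlinarith
          refine (Real.rpow_le_rpow (inv_pos.2 (qd_pos t0 z)).le i1 (by positivity)).trans ?_
          rw [Real.rpow_add (by positivity), Real.rpow_natCast, mul_comm]
          gcongr
        calc _ ≤ 4 * δ^2 * (16 * M^2 / δ^2 * ‖f (z 0)‖^2) * (2 * (2/δ^2)^k) := by gcongr
          _ = 1 * (128 * M^2 * (2/δ^2)^k) * ‖f (z 0)‖^2 := by field_simp; ring
          _ ≤ _ := by gcongr
      · rw [a2 hz2]; simp; positivity
    · intro z hz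
      refine indicator_apply_eq_zero.2 fun h1 => ?_
      rw [(h.dbs hM h1).2 fun h2 => hz ⟨by have : ρ z < 1 := h1; linarith, h2.2⟩]; simp
  · congr 2; ext z
    rw [mm, Real.rpow_def_of_pos (qd_pos t0 z), mul_comm (rlog _)]; ring
end oo


section pp
variable {k : ℕ}
lemma pd_sw (l0 : ℂ) {t r : ℝ} (t0 : 0 < t) (tr : t ≤ r) : ∃ W : 𝕍 (k+1) → ℂ, SW W (Pi.single 0 l0) r ∧ ∫ z, W z = 1 ∧
    (∀ z, W z ≠ 0 → qf z ≤ k * t^2) ∧ ∫ z, ‖W z‖^2 = (π * r^2 * (π * t^2)^k)⁻¹ := by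
  have r0 := t0.trans_le tr
  have ia : Integrable ((closedBall l0 r).indicator (fun _ => (1:ℝ))) :=
    (integrableOn_const (by exact (measure_closedBall_lt_top).ne)).integrable_indicator measurableSet_closedBall
  obtain ⟨i1, i2⟩ := slab_int (k := k) ia t0.le
  rw [integral_indicator measurableSet_closedBall, setIntegral_const] at i2
  replace i2 := i2.trans (b := _) (c := π * r^2 * (π * t^2)^k) (by simp [Measure.real, Complex.volume_closedBall, mul_comm, r0.le])
  let v := π * r^2 * (π * t^2)^k
  have v0 : 0 < v := by positivity
  let T : 𝕍 (k+1) → ℝ := fun z => (closedBall l0 r).indicator (fun _ => (1:ℝ)) (z 0) * ∏ j : Fin k, (closedBall (0:ℂ) t).indicator (fun _ => (1:ℝ)) (z j.succ)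
  have T1 : ∀ z, (‖z 0 - l0‖ ≤ r ∧ ∀ j : Fin k, ‖z j.succ‖ ≤ t) → T z = 1 := fun z hz => by simp [T, indicator, mem_closedBall, dist_eq, hz.1, hz.2]
  have T2 : ∀ z, ¬ (‖z 0 - l0‖ ≤ r ∧ ∀ j : Fin k, ‖z j.succ‖ ≤ t) → T z = 0 := fun z hz => by
    rw [not_and_or] at hz
    rcases hz with hz | hz
    · simp [T, indicator, mem_closedBall, dist_eq, hz]
    · push Not at hz
      obtain ⟨j, hj⟩ := hz
      exact mul_eq_zero_of_right _ (Finset.prod_eq_zero (Finset.mem_univ j) (by simp [indicator, not_le.2 hj]))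
  have Tsq : ∀ z, T z ^ 2 = T z := fun z => by
    by_cases hz : (‖z 0 - l0‖ ≤ r ∧ ∀ j : Fin k, ‖z j.succ‖ ≤ t)
    · rw [T1 z hz]; norm_num
    · rw [T2 z hz]; norm_num
  have nW : ∀ z, ‖((v⁻¹ * T z : ℝ) : ℂ)‖^2 = v⁻¹^2 * T z := fun z => by
    rw [norm_real, Real.norm_eq_abs, sq_abs, mul_pow, Tsq]
  have iW : Integrable fun z => ((v⁻¹ * T z : ℝ) : ℂ) := (i1.const_mul v⁻¹).ofReal
  refine ⟨fun z => (v⁻¹ * T z : ℝ), ⟨?_, fun x hx => ?_, fun c hc y => ?_⟩, ?_, fun z hz => ?_, ?_⟩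
  · rw [memLp_two_iff_integrable_sq_norm iW.1]
    simp_rw [nW]; exact i1.const_mul _
  · rw [T2, mul_zero, ofReal_zero]
    rintro ⟨h1, h2⟩
    refine hx.not_ge ((pi_norm_le_iff_of_nonneg r0.le).2 fun i => ?_)
    refine Fin.cases ?_ (fun j => ?_) i
    · simpa using h1
    · simpa using (h2 j).trans tr
  · have : T (Pi.single 0 l0 + c • y) = T (Pi.single 0 l0 + y) := by
      have q : ∀ c : ℂ, ‖c‖ = 1 → ((‖(Pi.single 0 l0 + c • y : 𝕍 (k+1)) 0 - l0‖ ≤ r ∧ ∀ j : Fin k, ‖(Pi.single 0 l0 + c • y : 𝕍 (k+1)) j.succ‖ ≤ t) ↔ (‖y 0‖ ≤ r ∧ ∀ j : Fin k, ‖y j.succ‖ ≤ t)) := fun c hc => by simp [hc]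
      have q1 := q 1 (by simp); rw [one_smul] at q1
      by_cases hy : (‖y 0‖ ≤ r ∧ ∀ j : Fin k, ‖y j.succ‖ ≤ t)
      · rw [T1 _ ((q c hc).2 hy), T1 _ (q1.2 hy)]
      · rw [T2 _ (mt (q c hc).1 hy), T2 _ (mt q1.1 hy)]
    simp only [this]
  · refine integral_complex_ofReal.trans ?_
    rw [integral_const_mul, i2, inv_mul_cancel₀ v0.ne', ofReal_one]
  · by_cases h : (‖z 0 - l0‖ ≤ r ∧ ∀ j : Fin k, ‖z j.succ‖ ≤ t)
    · calc qf z ≤ ∑ j : Fin k, t^2 := Finset.sum_le_sum fun j _ => by rw [normSq_eq_norm_sq]; exact pow_le_pow_left₀ (norm_nonneg _) (h.2 j) 2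
        _ = _ := by simp
    · simp only [T2 z h, mul_zero, ofReal_zero, ne_eq, not_true] at hz
  · simp_rw [nW]
    rw [integral_const_mul, i2]
    change v⁻¹^2 * v = v⁻¹
    field_simp
lemma l2_cs {X : Type*} [MeasurableSpace X] {μ : Measure X} {f g : X → ℂ} (hf : MemLp f 2 μ) (hg : MemLp g 2 μ) :
    ‖∫ x, f x * g x ∂μ‖^2 ≤ (∫ x, ‖f x‖^2 ∂μ) * ∫ x, ‖g x‖^2 ∂μ := by
  have hc : MemLp (fun x => conj (f x)) 2 μ := hf.star
  simpa using cs_sum (κ := Unit) (fun _ => hc) (fun _ => hg)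
end pp


section rr
variable {k : ℕ} {f : ℂ → ℂ} {ρ : 𝕍 (k+1) → ℝ} {δ Q ε t M : ℝ} {U Rg : Set ℂ}
noncomputable def c2 (Q : ℝ) : ℝ := bq Q * (Q + 1) + 1 + (2 + Q)^2
noncomputable def c3 (k : ℕ) (Q M : ℝ) : ℝ := 2 * π^k + 2 * (4 * rexp 1^2 * (k * (c2 Q * (Q+1)^k) * (128 * M^2 * (2 * π)^k)))
lemma c2_nn (Q0 : 0 ≤ Q) : 0 ≤ c2 Q := by
  have := Real.log_nonneg (show 1 ≤ Q + 1 by linarith)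
  rw [c2, bq]; positivity
lemma mm_sup (d0 : 0 < δ) (d1 : δ ≤ 1) (t0 : 0 < t) (td : t ≤ δ) (Q0 : 0 ≤ Q) (e0 : 0 < ε) (e1 : ε ≤ 1) :
    ∃ B : ℝ, 0 ≤ B ∧ (∀ z : 𝕍 (k+1), qf z ≤ Q → mm Q ε δ t z ≤ B) ∧ B * k ≤ k * (c2 Q * (Q+1)^k) := by
  have C0 := c2_nn Q0
  rcases Nat.eq_zero_or_pos k with rfl | hk
  · refine ⟨c2 Q / δ^2 * (Q+1)^ε, by positivity, fun z hz => (mm_ub d0 d1 t0 hz).trans ?_, by simp⟩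
    have := qf_nn z
    have : t^2 ≤ 1 := by nlinarith
    simp only [CharP.cast_eq_zero, zero_add]
    rw [← c2]
    gcongr <;> linarith
  · refine ⟨c2 Q * (Q+1)^k, by positivity, fun z hz => (mm_ub d0 d1 t0 hz).trans ?_, by rw [mul_comm]⟩
    have hk1 : (1:ℝ) ≤ k := by exact_mod_cast hk
    have hp := qd_pos d0 z
    have := qf_nn z
    have td2 : t^2 ≤ δ^2 := by gcongr
    rw [← c2]
    calc _ ≤ c2 Q / (qf z + δ^2) * (qf z + δ^2)^((k:ℝ)+ε) := by gcongr
      _ = c2 Q * (qf z + δ^2)^((k:ℝ)+ε-1) := by rw [Real.rpow_sub_one hp.ne']; ring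
      _ ≤ c2 Q * (Q+1)^((k:ℝ)+ε-1) := by
        gcongr
        · linarith
        · nlinarith
      _ ≤ _ := by
        rw [← Real.rpow_natCast]
        gcongr
        · linarith
        · linarith
lemma HD.ev (h : HD f ρ δ U Rg) (hL : ∀ z, ρ z < 2 → ∀ ξ, 0 ≤ Lev ρ z ξ) (hQ : ∀ z, ρ z ≤ 2 → qf z ≤ Q) (Q0 : 0 ≤ Q)
    (hM : ∀ t ∈ Icc (-1:ℝ) 3, |deriv Real.smoothTransition t| ≤ M) (e0 : 0 < ε) (e1 : ε ≤ 1) (he : (2/δ^2)^ε ≤ 2) (t0 : 0 < t)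
    (td : t ≤ δ) {l0 : ℂ} {r r' : ℝ} {χ : 𝕍 (k+1) → ℂ} {β : Fin (k+1) → 𝕍 (k+1) → ℂ}
    (hr : closedBall (Pi.single 0 l0) r ⊆ {z | ρ z < 0}) (hχ : SW χ (Pi.single 0 l0) r) (χ1 : ∫ z, χ z = 1) (hβ : ∀ j, Test (β j))
    (sβ : ∀ j, tsupport (β j) ⊆ {z | ρ z < 0}) (tr : t ≤ r') (hr' : closedBall (Pi.single 0 l0) r' ⊆ {z | ρ z < 0})
    (hq : ∀ z ∈ closedBall (Pi.single 0 l0 : 𝕍 (k+1)) r', qf z < δ^2/2) :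
    ‖f l0‖ ≤ rsqrt (c3 k Q M * (∫ x in Rg, ‖f x‖^2) * ∫ z, ‖χ z - ∑ j, db j (β j) z‖^2)
      + rsqrt (4 * rexp 1^2 * (k * (128 * M^2 * (2 * π)^k * ∫ x in Rg, ‖f x‖^2)) * (c2 Q / δ^2 * ((k+1) * t^2)^((k:ℝ)+ε) * (π * r'^2 * (π * t^2)^k)⁻¹)) := by
  have d := h.d0
  have C0 := c2_nn Q0
  have r'0 := t0.trans_le tr
  have hd : Pi.single 0 l0 ∈ closedBall (Pi.single 0 l0 : 𝕍 (k+1)) r' := mem_closedBall_self r'0.le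
  have Qs : ∀ z, ρ z < 0 → qf z ≤ Q := fun z hz => hQ z (by linarith)
  obtain ⟨V, mV, nV, hV⟩ := h.sol hL hQ Q0 hM e0 he t0
  obtain ⟨B, B0, hB, Bk⟩ := mm_sup (k := k) d h.d1 t0 td Q0 e0 e1
  obtain ⟨W, sW, W1, qW, nW⟩ := pd_sw (k := k) l0 t0 tr
  have mp := mm_pos (k := k) (Q := Q) (ε := ε) d t0
  have mc := mm_cont (k := k) (Q := Q) (ε := ε) d t0
  have So : IsOpen {z | ρ z < 0} := isOpen_lt h.sm.continuous continuous_const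
  have Sm := So.measurableSet
  have I0 : 0 ≤ ∫ x in Rg, ‖f x‖^2 := integral_nonneg fun _ => by positivity
  let m := mm (k := k) Q ε δ t
  let u : 𝕍 (k+1) → ℂ := fun z => (rsqrt (m z) : ℂ) * V z
  have nu : ∀ z, ‖u z‖^2 = m z * ‖V z‖^2 := fun z => by simp [u, mul_pow, abs_of_nonneg (Real.sqrt_nonneg _), Real.sq_sqrt (mp z).le, m]
  have su : AEStronglyMeasurable u := (continuous_ofReal.comp mc.sqrt).aestronglyMeasurable.mul mV.1
  have bu : ∀ z, ‖{z | ρ z < 0}.indicator u z‖^2 ≤ B * ‖V z‖^2 := fun z => by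
    by_cases hz : ρ z < 0
    · rw [indicator_of_mem (by exact hz), nu]; gcongr; exact hB z (Qs z hz)
    · rw [indicator_of_notMem (by exact hz)]; simp; positivity
  have mu : MemLp ({z | ρ z < 0}.indicator u) 2 := mV.of_le_mul (c := rsqrt B) (su.indicator Sm) (ae_of_all _ fun z =>
    abs_le_of_sq_le_sq' (by rw [mul_pow, Real.sq_sqrt B0]; exact bu z) (by positivity) |>.2)
  let F : 𝕍 (k+1) → ℂ := {z | ρ z < 0}.indicator (fun z => hf f ρ δ z + u z)
  have mh : MemLp ({z | ρ z < 0}.indicator (hf f ρ δ)) 2 := h.test.memlp.indicator Sm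
  have Fe : F = {z | ρ z < 0}.indicator (hf f ρ δ) + {z | ρ z < 0}.indicator u := indicator_add ..
  have mF : MemLp F 2 := Fe ▸ mh.add mu
  have nF : ∫ z, ‖F z‖^2 ≤ c3 k Q M * ∫ x in Rg, ‖f x‖^2 := by
    have ih := h.test.memlp.integrable_norm_pow (p := 2) (by norm_num)
    have iV := mV.integrable_norm_pow (p := 2) (by norm_num)
    calc ∫ z, ‖F z‖^2 ≤ ∫ z, 2 * ‖hf f ρ δ z‖^2 + 2 * (B * ‖V z‖^2) := by
          refine integral_mono (mF.integrable_norm_pow (p := 2) (by norm_num)) ((ih.const_mul 2).add ((iV.const_mul B).const_mul 2)) fun z => ?_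
          have h1 := bu z
          have h2 : ‖{z | ρ z < 0}.indicator (hf f ρ δ) z‖ ≤ ‖hf f ρ δ z‖ := norm_indicator_le_norm_self _ _
          have h3 := norm_add_le ({z | ρ z < 0}.indicator (hf f ρ δ) z) ({z | ρ z < 0}.indicator u z)
          simp only [Fe, Pi.add_apply]
          have := pow_le_pow_left₀ (norm_nonneg _) h3 2
          nlinarith [norm_nonneg ({z | ρ z < 0}.indicator (hf f ρ δ) z), sq_nonneg (‖{z | ρ z < 0}.indicator (hf f ρ δ) z‖ - ‖{z | ρ z < 0}.indicator u z‖)]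
      _ = 2 * (∫ z, ‖hf f ρ δ z‖^2) + 2 * (B * ∫ z, ‖V z‖^2) := by
          rw [integral_add (ih.const_mul 2) ((iV.const_mul B).const_mul 2)]; simp only [integral_const_mul]
      _ ≤ 2 * ((∫ x in Rg, ‖f x‖^2) * (π * 1^2)^k) + 2 * (B * (4 * rexp 1^2 * (k * (128 * M^2 * (2 * π)^k * ∫ x in Rg, ‖f x‖^2)))) := by
          gcongr
          refine h.sq.trans ?_
          gcongr; exact h.d1
      _ = 2 * π^k * (∫ x in Rg, ‖f x‖^2) + (B * k) * (2 * (4 * rexp 1^2 * (128 * M^2 * (2 * π)^k * ∫ x in Rg, ‖f x‖^2))) := by ring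
      _ ≤ 2 * π^k * (∫ x in Rg, ‖f x‖^2) + (k * (c2 Q * (Q+1)^k)) * (2 * (4 * rexp 1^2 * (128 * M^2 * (2 * π)^k * ∫ x in Rg, ‖f x‖^2))) := by gcongr
      _ = _ := by rw [c3]; ring
  have wF : WH F {z | ρ z < 0} := fun τ hτ sτ j => by
    have e1 : ∀ x, F x * db j τ x = hf f ρ δ x * db j τ x + u x * db j τ x := fun x => by
      by_cases hx : ρ x < 0
      · simp only [F]; rw [indicator_of_mem (by exact hx), add_mul]
      · rw [db_zero j fun hh => hx (sτ hh)]; simp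
    simp_rw [e1]
    rw [integral_add, ibp_db j h.test.1 hτ.1 hτ.2, hV j τ hτ sτ]
    · simp only [u, m]; ring
    · exact h.test.memlp.integrable_mul (hτ.db j).memlp
    · have : Continuous fun x => (rsqrt (m x) : ℂ) * db j τ x := (continuous_ofReal.comp mc.sqrt).mul (hτ.db j).1.continuous
      refine (mV.integrable_mul (q := 2) (this.memLp_of_hasCompactSupport (hτ.db j).2.mul_left)).congr (ae_of_all _ fun x => ?_)
      simp only [u, Pi.mul_apply]; ring
  have X1 : ∫ z, F z * χ z = ∫ z, F z * (χ z - ∑ j, db j (β j) z) := by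
    simp_rw [mul_sub, Finset.mul_sum]
    have ij : ∀ j ∈ (Finset.univ : Finset (Fin (k+1))), Integrable fun z => F z * db j (β j) z := fun j _ => mF.integrable_mul ((hβ j).db j).memlp
    rw [integral_sub (f := fun z => F z * χ z) (mF.integrable_mul hχ.mem) (integrable_finsetSum _ ij), integral_finsetSum _ ij, Finset.sum_eq_zero fun j _ => wF _ (hβ j) (sβ j) j, sub_zero]
  have X2 := wh_indep So wF mF hr hr' hχ sW W1
  rw [χ1, mul_one, X1] at X2
  have mX : MemLp (fun z => χ z - ∑ j, db j (β j) z) 2 := hχ.mem.sub (memLp_finsetSum _ fun j _ => ((hβ j).db j).memlp)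
  have A1 : ‖∫ z, F z * W z‖ ≤ rsqrt (c3 k Q M * (∫ x in Rg, ‖f x‖^2) * ∫ z, ‖χ z - ∑ j, db j (β j) z‖^2) := by
    rw [← X2]
    refine Real.le_sqrt_of_sq_le ((l2_cs mF mX).trans ?_)
    gcongr
  have Wz : ∀ z, W z ≠ 0 → z ∈ closedBall (Pi.single 0 l0) r' := fun z hz => by
    rw [mem_closedBall, dist_eq_norm]; by_contra! hc; exact hz (sW.supp z hc)
  have bW : ∀ z, ‖(rsqrt (m z) : ℂ) * W z‖^2 ≤ c2 Q / δ^2 * ((k+1) * t^2)^((k:ℝ)+ε) * ‖W z‖^2 := fun z => by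
    by_cases hz : W z = 0
    · simp [hz]
    rw [norm_mul, mul_pow, norm_real, Real.norm_eq_abs, sq_abs, Real.sq_sqrt (mp z).le]
    gcongr
    refine (mm_ub d h.d1 t0 (Qs z (hr' (Wz z hz)))).trans ?_
    have := qf_nn z
    have := qW z hz
    rw [← c2]
    gcongr <;> linarith
  have mW : MemLp (fun z => (rsqrt (m z) : ℂ) * W z) 2 := sW.mem.of_le_mul (c := rsqrt (c2 Q / δ^2 * ((k+1) * t^2)^((k:ℝ)+ε)))
    ((continuous_ofReal.comp mc.sqrt).aestronglyMeasurable.mul sW.mem.1) (ae_of_all _ fun z =>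
    abs_le_of_sq_le_sq' (by rw [mul_pow, Real.sq_sqrt (by positivity)]; exact bW z) (by positivity) |>.2)
  have Y1 : ∫ z, F z * W z = f l0 + ∫ z, V z * ((rsqrt (m z) : ℂ) * W z) := by
    have G : ∫ z, hf f ρ δ z * W z = f l0 := by
      rw [mv h.test.1.continuous (fun z hz => ?_) sW, W1, mul_one, (h.near (lt_trans (show ρ (Pi.single 0 l0) < 0 from hr' hd) one_pos) (hq _ hd)).eq_of_nhds]
      · simp
      · have h1 : ρ z < 0 := hr' hz
        exact (h.fda (by linarith) (by nlinarith [hq z hz])).congr_of_eventuallyEq (h.near (by linarith) (hq z hz))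
    rw [← G, ← integral_add (f := fun z => hf f ρ δ z * W z) (g := fun z => V z * ((rsqrt (m z) : ℂ) * W z)) (h.test.memlp.integrable_mul sW.mem) (mV.integrable_mul mW)]
    congr 1; ext z
    by_cases hz : W z = 0
    · simp [hz]
    · simp only [F]
      rw [indicator_of_mem (hr' (Wz z hz))]; simp only [u]; ring
  have A2 : ‖∫ z, V z * ((rsqrt (m z) : ℂ) * W z)‖ ≤ rsqrt (4 * rexp 1^2 * (k * (128 * M^2 * (2 * π)^k * ∫ x in Rg, ‖f x‖^2)) * (c2 Q / δ^2 * ((k+1) * t^2)^((k:ℝ)+ε) * (π * r'^2 * (π * t^2)^k)⁻¹)) := by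
    refine Real.le_sqrt_of_sq_le ((l2_cs mV mW).trans ?_)
    gcongr
    · rw [← nW, ← integral_const_mul]
      exact integral_mono (mW.integrable_norm_pow (p := 2) (by norm_num)) ((sW.mem.integrable_norm_pow (p := 2) (by norm_num)).const_mul _) bW
  rw [show f l0 = (∫ z, F z * W z) - ∫ z, V z * ((rsqrt (m z) : ℂ) * W z) by rw [Y1]; ring]
  exact (norm_sub_le _ _).trans (add_le_add A1 A2)
end rr


section ss
variable {k : ℕ}
def Rgs (U : Set ℂ) (R s : ℝ) : Set ℂ := {x | ‖x‖ ≤ R ∧ ball x s ⊆ U}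
lemma Rgs_cp (U : Set ℂ) (R s : ℝ) : IsCompact (Rgs U R s) := by
  refine (isCompact_closedBall (0:ℂ) R).of_isClosed_subset ?_ fun x hx => by simpa using hx.1
  refine (isClosed_le continuous_norm continuous_const).inter (isClosed_of_closure_subset fun x hx y hy => ?_)
  obtain ⟨x', hx', hd⟩ := Metric.mem_closure_iff.1 hx (s - dist y x) (by have := mem_ball.1 hy; linarith)
  exact hx' (mem_ball.2 (by linarith [dist_triangle y x x']))
lemma OT {D : Set (𝕍 (k+1))} {ρ0 : 𝕍 (k+1) → ℝ} (hD : Exh D ρ0) {R : ℝ} (hR : ∀ z ∈ D, ‖z‖ ≤ R) :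
    ∃ C : ℝ, ∀ K0 : Set (𝕍 (k+1)), IsCompact K0 → K0 ⊆ D → ∃ s > 0, ∀ f : ℂ → ℂ, DifferentiableOn ℂ f {x | Pi.single 0 x ∈ D} →
      ∀ (l0 : ℂ) (r : ℝ) (χ : 𝕍 (k+1) → ℂ) (β : Fin (k+1) → 𝕍 (k+1) → ℂ), 0 < r → closedBall (Pi.single 0 l0) r ⊆ K0 → SW χ (Pi.single 0 l0) r →
      ∫ z, χ z = 1 → (∀ j, Test (β j)) → (∀ j, tsupport (β j) ⊆ K0) →
      ‖f l0‖^2 ≤ C * (∫ x in Rgs {x | Pi.single 0 x ∈ D} R s, ‖f x‖^2) * ∫ z, ‖χ z - ∑ j, db j (β j) z‖^2 := by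
  obtain ⟨M, hM⟩ := (isCompact_Icc (a := (-1:ℝ)) (b := 3)).exists_bound_of_continuousOn ((Real.smoothTransition.contDiff (n := 1)).continuous_deriv le_rfl).continuousOn
  have Q0 : 0 ≤ k * R^2 := by positivity
  refine ⟨c3 k (k * R^2) M, fun K0 hK KD => ?_⟩
  obtain ⟨ρ, sm, ρ0', cp, ρD, hL⟩ := hD.smooth hK KD
  obtain ⟨s, s0, hs⟩ := cp.exists_thickening_subset_open hD.op ρD
  refine ⟨s, s0, fun f hf' l0 r χ β r0 hr hχ χ1 hβ sβ => ?_⟩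
  let δ := min (s/2) 1
  have d0 : 0 < δ := by positivity
  have h : HD f ρ δ {x | Pi.single 0 x ∈ D} (Rgs {x | Pi.single 0 x ∈ D} R s) := by
    refine ⟨hD.op.preimage (continuous_single 0), hf', sm, cp, d0, min_le_right _ _, fun z h1 h2 => ⟨(norm_le_pi_norm z 0).trans (hR z (ρD h1)), fun y hy => hs ?_⟩, fun x hx => hx.2 (mem_ball_self s0), Rgs_cp _ _ _⟩
    refine mem_thickening_iff.2 ⟨z, h1, ?_⟩
    rw [dist_pi_lt_iff s0]
    refine Fin.cases (by simpa using hy) fun j => ?_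
    have := qf_coord d0.le h2 j
    have : δ ≤ s/2 := min_le_left _ _
    simp; linarith
  have hQ : ∀ z, ρ z ≤ 2 → qf z ≤ k * R^2 := fun z hz => by
    calc qf z ≤ ∑ j : Fin k, R^2 := Finset.sum_le_sum fun j _ => by
          rw [normSq_eq_norm_sq]; exact pow_le_pow_left₀ (norm_nonneg _) ((norm_le_pi_norm z j.succ).trans (hR z (ρD hz))) 2
      _ = _ := by simp
  obtain ⟨ε, he, e0, e1⟩ : ∃ ε : ℝ, (2/δ^2)^ε ≤ 2 ∧ 0 < ε ∧ ε < 1 := by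
    have := (Real.continuous_const_rpow (a := 2/δ^2) (by positivity)).tendsto' 0 1 (Real.rpow_zero _)
    exact (((this.eventually_le_const one_lt_two).filter_mono nhdsWithin_le_nhds).and (Ioo_mem_nhdsGT one_pos)).exists
  obtain ⟨r1, r10, hr1⟩ : ∃ r1 > 0, closedBall (Pi.single 0 l0 : 𝕍 (k+1)) r1 ⊆ {z | qf z < δ^2/2} :=
    nhds_basis_closedBall.mem_iff.1 ((isOpen_lt qf_sm.continuous continuous_const).mem_nhds (by
      have : qf (Pi.single 0 l0 : 𝕍 (k+1)) = 0 := by simp [qf]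
      simp only [mem_ofPred_eq, this]; positivity))
  have r'0 : 0 < min r r1 := by positivity
  let A := c3 k (k * R^2) M * (∫ x in Rgs {x | Pi.single 0 x ∈ D} R s, ‖f x‖^2) * ∫ z, ‖χ z - ∑ j, db j (β j) z‖^2
  let G := 4 * rexp 1^2 * (k * (128 * M^2 * (2 * π)^k * ∫ x in Rgs {x | Pi.single 0 x ∈ D} R s, ‖f x‖^2)) * (c2 (k * R^2) / δ^2 * ((k+1) / π)^k * (π * (min r r1)^2)⁻¹)
  have key : ∀ t ∈ Ioo 0 (min (min r r1) δ), ‖f l0‖ ≤ rsqrt A + rsqrt (G * ((k+1) * t^2)^ε) := fun t ht => by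
    have t0 := ht.1
    have tm := ht.2.le
    refine (h.ev hL hQ Q0 hM e0 e1.le he t0 (tm.trans (min_le_right _ _)) (hr.trans fun z hz => ρ0' z hz) hχ χ1 hβ (fun j => (sβ j).trans fun z hz => ρ0' z hz)
      (tm.trans (min_le_left _ _)) ((closedBall_subset_closedBall (min_le_left _ _)).trans (hr.trans fun z hz => ρ0' z hz)) fun z hz => hr1 (closedBall_subset_closedBall (min_le_right _ _) hz)).trans_eq ?_
    congr 2
    have e : (((k:ℝ)+1) * t^2)^k * ((π * t^2)^k)⁻¹ = ((k+1) / π)^k := by rw [← inv_pow, ← mul_pow]; congr 1; field_simp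
    rw [Real.rpow_add (by positivity), Real.rpow_natCast, mul_inv]
    simp only [G]
    rw [← e]; ring
  have T0 : Tendsto (fun t : ℝ => rsqrt A + rsqrt (G * ((k+1) * t^2)^ε)) (𝓝[>] 0) (𝓝 (rsqrt A)) := by
    have c : Continuous (fun t : ℝ => rsqrt A + rsqrt (G * ((k+1) * t^2)^ε)) := by
      have : Continuous (fun t : ℝ => (((k:ℝ)+1) * t^2)^ε) := (by fun_prop : Continuous fun t : ℝ => ((k:ℝ)+1) * t^2).rpow_const fun _ => Or.inr e0.le
      fun_prop
    exact (c.tendsto' 0 _ (by simp [Real.zero_rpow e0.ne'])).mono_left nhdsWithin_le_nhds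
  have := ge_of_tendsto T0 (by filter_upwards [Ioo_mem_nhdsGT (show (0:ℝ) < min (min r r1) δ by positivity)] with t ht using key t ht)
  have A0 : 0 ≤ A := by
    have : 0 ≤ c2 (k * R^2) := c2_nn Q0
    refine mul_nonneg (mul_nonneg (by rw [c3]; positivity) (integral_nonneg fun _ => by positivity)) (integral_nonneg fun _ => by positivity)
  calc ‖f l0‖^2 ≤ rsqrt A ^2 := by gcongr
    _ = A := Real.sq_sqrt A0
end ss


section kk
variable {n : ℕ}
noncomputable def NN (D : Set (𝕍 n)) : Submodule ℂ (Lp ℂ 2 (volume : Measure (𝕍 n))) where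
  carrier := {x | ∃ β : Fin n → 𝕍 n → ℂ, (∀ j, Test (β j)) ∧ (∀ j, tsupport (β j) ⊆ D) ∧ x =ᵐ[volume] fun z => ∑ j, db j (β j) z}
  zero_mem' := ⟨fun _ _ => 0, fun _ => ⟨contDiff_const, HasCompactSupport.zero⟩, fun _ => by simp [tsupport], by
    filter_upwards [Lp.coeFn_zero ℂ 2 (volume : Measure (𝕍 n))] with z hz
    simp [hz, db_const]⟩
  add_mem' := by
    rintro x y ⟨β, h1, h2, h3⟩ ⟨γ, g1, g2, g3⟩
    refine ⟨fun j => β j + γ j, fun j => (h1 j).add (g1 j), fun j => (tsupport_add _ _).trans (union_subset (h2 j) (g2 j)), ?_⟩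
    filter_upwards [Lp.coeFn_add x y, h3, g3] with z e1 e2 e3
    rw [e1, Pi.add_apply, e2, e3, ← Finset.sum_add_distrib]
    exact Finset.sum_congr rfl fun j _ => (db_add j (sm_da (h1 j).1 z) (sm_da (g1 j).1 z)).symm
  smul_mem' := by
    rintro c x ⟨β, h1, h2, h3⟩
    refine ⟨fun j z => c * β j z, fun j => (h1 j).mul contDiff_const, fun j => (tsupport_mul_subset_right ..).trans (h2 j), ?_⟩
    filter_upwards [Lp.coeFn_smul c x, h3] with z e1 e2
    rw [e1, Pi.smul_apply, e2, smul_eq_mul, Finset.mul_sum]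
    exact Finset.sum_congr rfl fun j _ => (db_cmul j c (sm_da (h1 j).1 z)).symm
lemma l2_nsq {f : 𝕍 n → ℂ} (hf : MemLp f 2) : ‖hf.toLp f‖^2 = ∫ z, ‖f z‖^2 := by
  have h := l2_inner hf hf
  rw [inner_self_eq_norm_sq_to_K] at h
  simp_rw [conj_mul', ← ofReal_pow] at h
  rw [integral_complex_ofReal] at h
  have := congrArg re h
  simpa [← ofReal_pow] using this
lemma kuse {D : Set (𝕍 n)} (hD : IsOpen D) {z0 : 𝕍 n} {C0 r : ℝ} (hr : closedBall z0 r ⊆ D)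
    (hk : ∀ H : 𝕍 n → ℂ, DifferentiableOn ℂ H D → IntegrableOn (fun z => ‖H z‖^2) D → ‖H z0‖^2 ≤ C0 * ∫ z in D, ‖H z‖^2)
    {χ : 𝕍 n → ℂ} (hχ : SW χ z0 r) (χ1 : ∫ z, χ z = 1) (C00 : 0 ≤ C0) :
    ∃ β : Fin n → 𝕍 n → ℂ, (∀ j, Test (β j)) ∧ (∀ j, tsupport (β j) ⊆ D) ∧ ∫ z, ‖χ z - ∑ j, db j (β j) z‖^2 ≤ C0 + 1 := by
  have : CompleteSpace (NN D).topologicalClosure := (NN D).isClosed_topologicalClosure.completeSpace_coe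
  obtain ⟨p, hp, q, hq, e⟩ := (NN D).topologicalClosure.exists_add_mem_mem_orthogonal (hχ.mem.toLp χ)
  have mq : MemLp q 2 := Lp.memLp q
  have tq : mq.toLp q = q := Lp.toLp_coeFn q mq
  have mF : MemLp (fun z => conj (q z)) 2 := mq.star
  have wF : WH (fun z => conj (q z)) D := fun τ hτ sτ j => by
    have h1 : (hτ.db j).memlp.toLp ∈ (NN D) := by
      refine ⟨fun i => if i = j then τ else fun _ => 0, fun i => ?_, fun i => ?_, ?_⟩
      · dsimp only; split_ifs
        exacts [hτ, ⟨contDiff_const, HasCompactSupport.zero⟩]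
      · dsimp only; split_ifs
        exacts [sτ, by simp [tsupport]]
      · filter_upwards [(hτ.db j).memlp.coeFn_toLp] with z hz
        rw [hz, Finset.sum_eq_single j (fun i _ hi => by rw [if_neg hi, db_const]) (by simp), if_pos rfl]
    have := (Submodule.mem_orthogonal' _ _).1 hq _ (subset_closure h1)
    rwa [← tq, l2_inner mq] at this
  obtain ⟨H, dH, Hae, Hv⟩ := weyl hD wF mF
  have nq : ‖q‖^2 = ∫ z, ‖q z‖^2 := by rw [← l2_nsq mq, tq]
  have hz0 : H z0 = (‖q‖^2 : ℝ) := by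
    rw [Hv z0 r hr χ hχ χ1, ← l2_inner mq hχ.mem, tq, e, inner_add_right, (Submodule.mem_orthogonal' _ _).1 hq p hp, zero_add, inner_self_eq_norm_sq_to_K]
    simp
  have eH : ∀ᵐ z ∂volume.restrict D, ‖H z‖^2 = ‖q z‖^2 := by filter_upwards [Hae] with z hz; rw [hz, RCLike.norm_conj]
  have iq := mq.integrable_norm_pow (p := 2) (by norm_num)
  have k1 := hk H dH ((integrable_congr eH).2 iq.integrableOn)
  rw [hz0, norm_real, Real.norm_eq_abs, sq_abs, integral_congr_ae eH] at k1
  have k2 : ∫ z in D, ‖q z‖^2 ≤ ‖q‖^2 := nq ▸ setIntegral_le_integral iq (ae_of_all _ fun z => by positivity)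
  have k3 : ‖q‖^2 ≤ C0 := by
    by_contra! hc
    have := mul_le_mul_of_nonneg_left k2 C00
    nlinarith [sq_nonneg ‖q‖]
  obtain ⟨y, hy, hd⟩ := Metric.mem_closure_iff.1 hp 1 one_pos
  obtain ⟨β, b1, b2, b3⟩ := hy
  refine ⟨β, b1, b2, ?_⟩
  have mS : MemLp (fun z => ∑ j, db j (β j) z) 2 := memLp_finsetSum _ fun j _ => ((b1 j).db j).memlp
  have ey : mS.toLp _ = y := by
    rw [← Lp.toLp_coeFn y (Lp.memLp y)]; exact (MemLp.toLp_eq_toLp_iff _ _).2 b3.symm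
  have := l2_nsq (hχ.mem.sub mS)
  simp only [Pi.sub_apply] at this
  rw [← this, MemLp.toLp_sub hχ.mem mS, ey, e, show p + q - y = q + (p - y) by abel]
  have o : inner ℂ q (p - y) = 0 := (Submodule.mem_orthogonal' _ _).1 hq _ (Submodule.sub_mem _ hp (subset_closure ⟨β, b1, b2, b3⟩))
  have := norm_add_sq_eq_norm_sq_add_norm_sq_of_inner_eq_zero _ _ o
  rw [dist_eq_norm] at hd
  nlinarith [norm_nonneg (p - y)]
end kk
section st
variable {k : ℕ}
lemma OT_use {D : Set (𝕍 (k+1))} {ρ0 : 𝕍 (k+1) → ℝ} (hD : Exh D ρ0) {R : ℝ} (hR : ∀ z ∈ D, ‖z‖ ≤ R) {C0 : ℝ} (C00 : 0 ≤ C0) :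
    ∃ C : ℝ, ∀ l0 : ℂ, Pi.single 0 l0 ∈ D →
    (∀ H : 𝕍 (k+1) → ℂ, DifferentiableOn ℂ H D → IntegrableOn (fun z => ‖H z‖^2) D → ‖H (Pi.single 0 l0)‖^2 ≤ C0 * ∫ z in D, ‖H z‖^2) →
    ∃ s > 0, ∀ f : ℂ → ℂ, DifferentiableOn ℂ f {x | Pi.single 0 x ∈ D} →
      ‖f l0‖^2 ≤ C * ∫ x in Rgs {x | Pi.single 0 x ∈ D} R s, ‖f x‖^2 := by
  obtain ⟨C, hC⟩ := OT hD hR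
  refine ⟨max C 0 * (C0 + 1), fun l0 hl hk => ?_⟩
  obtain ⟨r, r0, hr⟩ := nhds_basis_closedBall.mem_iff.1 (hD.op.mem_nhds hl)
  obtain ⟨χ, hχ, χ1, -, -⟩ := pd_sw (k := k) l0 r0 le_rfl
  obtain ⟨β, b1, b2, b3⟩ := kuse hD.op hr hk hχ χ1 C00
  obtain ⟨s, s0, hs⟩ := hC (closedBall (Pi.single 0 l0) r ∪ ⋃ j, tsupport (β j)) ((isCompact_closedBall _ _).union (isCompact_iUnion fun j => (b1 j).2.isCompact)) (union_subset hr (iUnion_subset b2))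
  refine ⟨s, s0, fun f hf => (hs f hf l0 r χ β r0 subset_union_left hχ χ1 b1 fun j => (subset_iUnion (fun j => tsupport (β j)) j).trans subset_union_right).trans ?_⟩
  have I0 : 0 ≤ ∫ x in Rgs {x | Pi.single 0 x ∈ D} R s, ‖f x‖^2 := integral_nonneg fun _ => by positivity
  have X0 : 0 ≤ ∫ z, ‖χ z - ∑ j, db j (β j) z‖^2 := integral_nonneg fun _ => by positivity
  calc _ ≤ max C 0 * (∫ x in Rgs {x | Pi.single 0 x ∈ D} R s, ‖f x‖^2) * (C0 + 1) := by gcongr; exact le_max_left _ _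
    _ = _ := by ring
end st


section co
variable {k : ℕ}
lemma psc_exh {D : Set (𝕍 (k+1))} (hopen : IsOpen D) (hbd : Bornology.IsBounded D) (hpsc : IsPseudoconvex D)
    (M : (𝕍 (k+1)) ≃L[ℂ] (𝕍 (k+1))) (a : 𝕍 (k+1)) :
    Exh {y | a + M y ∈ D} (fun y => - rlog (infDist (a + M y) Dᶜ)) := by
  have hne : (Dᶜ).Nonempty := by
    rw [nonempty_compl]; rintro rfl; exact NormedSpace.unbounded_univ ℂ _ hbd
  have pos : ∀ x ∈ D, 0 < infDist x Dᶜ := fun x hx => (hopen.isClosed_compl.notMem_iff_infDist_pos hne).1 (by simpa using hx)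
  have mem : ∀ x, 0 < infDist x Dᶜ → x ∈ D := fun x hx => by
    have := (hopen.isClosed_compl.notMem_iff_infDist_pos hne).2 hx; simpa using this
  have cΦ : Continuous fun y => a + M y := continuous_const.add M.continuous
  have co : ContinuousOn (fun y => - rlog (infDist (a + M y) Dᶜ)) {y | a + M y ∈ D} :=
    (ContinuousOn.log (f := fun y => infDist (a + M y) Dᶜ) ((continuous_infDist_pt Dᶜ).comp cΦ).continuousOn fun y hy => (pos (a + M y) hy).ne').neg
  refine ⟨hopen.preimage cΦ, co, fun c => ?_, fun z ξ h => ?_⟩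
  · have h1 : {x | rexp (-c) ≤ infDist x Dᶜ} ⊆ D := fun x hx => mem x ((Real.exp_pos _).trans_le hx)
    have h2 : IsCompact {x | rexp (-c) ≤ infDist x Dᶜ} := isCompact_of_isClosed_isBounded (isClosed_le continuous_const (continuous_infDist_pt _)) (hbd.subset h1)
    convert (M.toHomeomorph.trans (Homeomorph.addLeft a)).isCompact_preimage.2 h2 using 1
    ext y
    simp only [mem_ofPred_eq, mem_preimage, Homeomorph.trans_apply, Homeomorph.coe_addLeft, ContinuousLinearEquiv.coe_toHomeomorph]
    refine ⟨fun hy => ?_, fun hy => ?_⟩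
    · rw [← Real.le_log_iff_exp_le (pos _ hy.1)]; linarith [hy.2]
    · have := h1 hy
      refine ⟨this, ?_⟩
      rw [← Real.le_log_iff_exp_le (pos _ this)] at hy; linarith
  · let g : ℝ → ℝ := fun θ => - rlog (infDist (a + M (z + exp (θ * I) • ξ)) Dᶜ)
    have cg : Continuous g := co.comp_continuous (by fun_prop) fun θ => h _ (by simp [norm_exp_ofReal_mul_I])
    obtain ⟨B, hB⟩ := (isCompact_Icc (a := (0:ℝ)) (b := 2 * π)).exists_bound_of_continuousOn cg.continuousOn
    obtain ⟨N, hN⟩ := exists_nat_ge B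
    have hh : ∀ l ∈ closedBall (0:ℂ) 1, a + M z + l • M ξ ∈ D := fun l hl => by
      have : a + M (z + l • ξ) ∈ D := h l (by simpa using hl)
      rwa [map_add, map_smul, ← add_assoc] at this
    have h3 : SubharmonicOn (fun l : ℂ => ((- rlog (Metric.infDist (a + M z + l • M ξ) Dᶜ) : ℝ) : EReal)) {l | a + M z + l • M ξ ∈ D} := hpsc.2.2 (a + M z) (M ξ)
    have := (h3.2.2 0 (hh 0 (by simp)) 1 one_pos hh).trans (iInf_le _ N)
    clear h3
    simp only [zero_smul, add_zero, EReal.coe_le_coe_iff, circleAvgTrunc, ofReal_one, one_mul, zero_add] at this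
    refine this.trans_eq ?_
    congr 1
    refine intervalIntegral.integral_congr fun θ hθ => ?_
    rw [uIcc_of_le (by positivity)] at hθ
    have e : - rlog (infDist (a + M z + exp (θ * I) • M ξ) Dᶜ) = g θ := by simp only [g]; rw [map_add, map_smul, add_assoc]
    have : (-(N:ℝ) : EReal) ≤ (g θ : EReal) := by
      rw [← EReal.coe_neg, EReal.coe_le_coe_iff]
      have := neg_le_of_abs_le (hB θ hθ)
      linarith
    simp only [e]
    rw [max_eq_left this, EReal.toReal_coe]
lemma ker_tr {D P : Set (𝕍 (k+1))} (hopen : IsOpen D) (hK : (⨆ z ∈ D ∩ P, bergmanKernel D z) < (⊤ : ℝ≥0∞))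
    (M : (𝕍 (k+1)) ≃L[ℂ] (𝕍 (k+1))) (a : 𝕍 (k+1)) : ∃ C0 : ℝ, 0 ≤ C0 ∧ ∀ y, a + M y ∈ D ∩ P →
    ∀ H : 𝕍 (k+1) → ℂ, DifferentiableOn ℂ H {y | a + M y ∈ D} → IntegrableOn (fun z => ‖H z‖^2) {y | a + M y ∈ D} →
      ‖H y‖^2 ≤ C0 * ∫ z in {y | a + M y ∈ D}, ‖H z‖^2 := by
  let Ψ : (𝕍 (k+1)) ≃ₜ (𝕍 (k+1)) := (Homeomorph.subRight a).trans M.symm.toHomeomorph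
  have Ψe : ∀ x, Ψ x = M.symm (x - a) := fun x => rfl
  have ΨD : Ψ ⁻¹' {y | a + M y ∈ D} = D := by ext x; simp [Ψe]
  obtain ⟨c, hc⟩ : ∃ c : ℝ≥0, Measure.map Ψ volume = c • volume := by
    have : Measure.map Ψ volume = Measure.map M.symm volume := by
      conv_rhs => rw [← (measurePreserving_sub_right (volume : Measure (𝕍 (k+1))) a).map_eq, Measure.map_map M.symm.continuous.measurable (measurable_sub_const a)]
      rfl
    rw [this]
    exact ⟨_, Measure.isAddLeftInvariant_eq_smul _ _⟩
  let S := ⨆ z ∈ D ∩ P, bergmanKernel D z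
  have So : MeasurableSet {y | a + M y ∈ D} := (hopen.preimage (continuous_const.add M.continuous)).measurableSet
  refine ⟨(S * c).toReal, ENNReal.toReal_nonneg, fun y hy H dH iH => ?_⟩
  have e1 : ∫⁻ x in D, (‖H (Ψ x)‖₊ : ℝ≥0∞)^2 = c * ∫⁻ z in {y | a + M y ∈ D}, (‖H z‖₊ : ℝ≥0∞)^2 := by
    have := Ψ.measurableEmbedding.lintegral_map (μ := volume.restrict D) (fun z => (‖H z‖₊ : ℝ≥0∞)^2)
    have h2 := Ψ.measurableEmbedding.restrict_map volume {y | a + M y ∈ D}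
    rw [ΨD, hc] at h2
    rw [← this, ← h2, Measure.restrict_smul, lintegral_smul_measure]; rfl
  have e2 : ∫⁻ z in {y | a + M y ∈ D}, (‖H z‖₊ : ℝ≥0∞)^2 = ofR (∫ z in {y | a + M y ∈ D}, ‖H z‖^2) := by
    rw [ofReal_integral_eq_lintegral_ofReal iH (ae_of_all _ fun _ => by positivity)]
    refine lintegral_congr fun z => ?_
    rw [ENNReal.ofReal_pow (norm_nonneg _), ofReal_norm]; rfl
  have I0 : 0 ≤ ∫ z in {y | a + M y ∈ D}, ‖H z‖^2 := integral_nonneg fun _ => by positivity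
  by_cases hz : H y = 0
  · rw [hz]; simp; positivity
  have fin : ∫⁻ x in D, (‖H (Ψ x)‖₊ : ℝ≥0∞)^2 < ⊤ := by rw [e1, e2]; exact ENNReal.mul_lt_top ENNReal.coe_lt_top ENNReal.ofReal_lt_top
  have Ψy : Ψ (a + M y) = y := by simp [Ψe]
  have l : (fun x => H (Ψ x)) ∈ L2h D := by
    refine ⟨dH.comp ?_ fun x hx => by simpa [Ψe] using hx, fin⟩
    exact (M.symm.differentiable.comp (differentiable_id.sub_const a)).differentiableOn
  have b1 : (‖H y‖₊ : ℝ≥0∞)^2 / (∫⁻ x in D, (‖H (Ψ x)‖₊ : ℝ≥0∞)^2) ≤ S := by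
    have h1 : bergmanKernel D (a + M y) ≤ S := le_iSup₂ (f := fun z (_ : z ∈ D ∩ P) => bergmanKernel D z) _ hy
    refine le_trans ?_ h1
    have := le_iSup₂_of_le (f := fun (f : 𝕍 (k+1) → ℂ) (_ : f ∈ L2h D) => ⨆ (_ : ∃ w ∈ D, f w ≠ 0), (‖f (a + M y)‖₊ : ℝ≥0∞) ^ 2 / ∫⁻ w in D, (‖f w‖₊ : ℝ≥0∞) ^ 2)
      _ l (le_iSup_of_le (⟨_, hy.1, by rw [Ψy]; exact hz⟩ : ∃ w ∈ D, H (Ψ w) ≠ 0) le_rfl)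
    rwa [Ψy] at this
  rw [ENNReal.div_le_iff_le_mul (Or.inr hK.ne) (Or.inl fin.ne), e1, e2, ← mul_assoc] at b1
  have := ENNReal.toReal_mono (ENNReal.mul_ne_top (ENNReal.mul_ne_top hK.ne ENNReal.coe_ne_top) ENNReal.ofReal_ne_top) b1
  rw [ENNReal.toReal_mul, ENNReal.toReal_ofReal I0] at this
  rw [show ((‖H y‖₊:ℝ≥0∞)^2).toReal = ‖H y‖^2 by simp] at this
  exact this
theorem line_bound {n : ℕ} {D P : Set (𝕍 n)} (hopen : IsOpen D) (hbd : Bornology.IsBounded D)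
    (hpsc : IsPseudoconvex D) (hK : (⨆ z ∈ D ∩ P, bergmanKernel D z) < (⊤ : ℝ≥0∞)) (a b : 𝕍 n) (hb : b ≠ 0) :
    ∃ R C : ℝ, ∀ l0 : ℂ, a + l0 • b ∈ D ∩ P → ∃ s > 0, ∀ f : ℂ → ℂ, DifferentiableOn ℂ f {x | a + x • b ∈ D} →
      ‖f l0‖^2 ≤ C * ∫ x in Rgs {x | a + x • b ∈ D} R s, ‖f x‖^2 := by
  obtain _ | k := n
  · exact absurd (Subsingleton.elim b 0) hb
  have h0 : (Pi.single 0 1 : 𝕍 (k+1)) ≠ 0 := by simp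
  obtain ⟨M, hM⟩ := SeparatingDual.exists_continuousLinearEquiv_apply_eq (R := ℂ) h0 hb
  have hs : ∀ x : ℂ, M (Pi.single 0 x) = x • b := fun x => by
    rw [← hM, ← map_smul, ← Pi.single_smul]; simp
  have hE := psc_exh hopen hbd hpsc M a
  obtain ⟨C0, C00, hk⟩ := ker_tr hopen hK M a
  obtain ⟨R, hR⟩ : ∃ R, ∀ z ∈ {y | a + M y ∈ D}, ‖z‖ ≤ R := by
    obtain ⟨B, hB⟩ := hbd.exists_norm_le
    refine ⟨‖(M.symm : 𝕍 (k+1) →L[ℂ] (𝕍 (k+1)))‖ * (B + ‖a‖), fun z hz => ?_⟩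
    have h1 := (M.symm : 𝕍 (k+1) →L[ℂ] (𝕍 (k+1))).le_opNorm (M z)
    have h2 : ‖M z‖ ≤ B + ‖a‖ := by
      have := norm_sub_le (a + M z) a
      rw [add_sub_cancel_left] at this
      linarith [hB _ hz]
    simp only [ContinuousLinearEquiv.coe_coe, ContinuousLinearEquiv.symm_apply_apply] at h1
    exact h1.trans (by gcongr)
  obtain ⟨C, hC⟩ := OT_use hE hR C00
  refine ⟨R, C, fun l0 hl => ?_⟩
  rw [← hs] at hl
  have := hC l0 hl.1 fun H => hk _ hl H
  simpa only [mem_ofPred_eq, hs] using this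
end co


section pot
lemma rad {φ : ℝ → ℝ} (hφ : Continuous φ) (y : ℂ) {ρ : ℝ} (hρ : 0 ≤ ρ) :
    IntegrableOn (fun z : ℂ => φ ‖z - y‖ / ‖z - y‖) (closedBall y ρ) ∧
    ∫ z in closedBall y ρ, φ ‖z - y‖ / ‖z - y‖ = 2 * π * ∫ r in (0:ℝ)..ρ, φ r := by
  let F : ℝ → ℝ := (Iic ρ).indicator fun r => φ r / r
  have e1 : (closedBall y ρ).indicator (fun z : ℂ => φ ‖z - y‖ / ‖z - y‖) = fun z => F ‖z - y‖ := by
    ext z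
    simp only [F, indicator, mem_closedBall, dist_eq_norm, mem_Iic]
  have e2 : EqOn (fun r : ℝ => r ^ (Module.finrank ℝ ℂ - 1) • F r) ((Iic ρ).indicator φ) (Ioi 0) := fun r hr => by
    have : r ≠ 0 := (mem_Ioi.1 hr).ne'
    simp only [F, indicator, finrank_real_complex, smul_eq_mul]
    split_ifs
    · rw [show 2 - 1 = 1 from rfl, pow_one]; field_simp
    · simp
  have i0 : IntegrableOn φ (Ioc 0 ρ) := hφ.integrableOn_Ioc
  have i1 : Integrable (fun z : ℂ => F ‖z‖) := by
    rw [integrable_fun_norm_addHaar, integrableOn_congr_fun e2 measurableSet_Ioi, IntegrableOn, integrable_indicator_iff measurableSet_Iic, IntegrableOn, Measure.restrict_restrict measurableSet_Iic, inter_comm, Ioi_inter_Iic]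
    exact i0
  refine ⟨?_, ?_⟩
  · rw [← integrable_indicator_iff measurableSet_closedBall, e1]
    exact i1.comp_sub_right y
  · rw [← integral_indicator measurableSet_closedBall, e1, integral_sub_right_eq_self (fun z => F ‖z‖) y, integral_fun_norm_addHaar, setIntegral_congr_fun measurableSet_Ioi e2, setIntegral_indicator measurableSet_Iic, Ioi_inter_Iic, intervalIntegral.integral_of_le hρ]
    simp [Measure.real, Complex.volume_ball, mul_assoc]
lemma radk {d R : ℝ} (hd : 0 < d) (dR : d ≤ 2 * R) : ∫ r in (0:ℝ)..(2*R), 4 / max r d ≤ 4 * rlog (8 * R / d) := by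
  have c : Continuous fun r : ℝ => 4 / max r d := continuous_const.div (by fun_prop) fun r => (hd.trans_le (le_max_right _ _)).ne'
  rw [← intervalIntegral.integral_add_adjacent_intervals (c.intervalIntegrable 0 d) (c.intervalIntegrable d _),
    intervalIntegral.integral_congr (g := fun _ => 4 / d) fun r hr => by
      rw [uIcc_of_le hd.le] at hr; simp only [max_eq_right hr.2],
    intervalIntegral.integral_congr (a := d) (g := fun r => 4 * r⁻¹) fun r hr => by
      rw [uIcc_of_le dR] at hr; simp only [max_eq_left hr.1]; rfl,
    intervalIntegral.integral_const, intervalIntegral.integral_const_mul, integral_inv_of_pos hd (hd.trans_le dR)]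
  have h4 : (1:ℝ) ≤ rlog 4 := by
    rw [show (4:ℝ) = 2^2 by norm_num, Real.log_pow]; push_cast; linarith [Real.log_two_gt_d9]
  rw [show 8 * R / d = 4 * (2 * R / d) by ring, Real.log_mul (by norm_num) (div_pos (hd.trans_le dR) hd).ne']
  have : (d - 0) • (4 / d) = 4 := by rw [smul_eq_mul]; field_simp; ring
  linarith
lemma pair {s : ℝ} (hs : 0 < s) {x y z : ℂ} (hx : s ≤ ‖z - x‖) (hy : s ≤ ‖z - y‖) :
    ‖z - x‖⁻¹ * ‖z - y‖⁻¹ ≤ 4 / max ‖z - x‖ (max ‖x - y‖ s) / ‖z - x‖ + 4 / max ‖z - y‖ (max ‖x - y‖ s) / ‖z - y‖ := by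
  have t : ‖x - y‖ ≤ ‖z - x‖ + ‖z - y‖ := by
    have := norm_sub_le (z - y) (z - x)
    rw [sub_sub_sub_cancel_left] at this; linarith
  wlog h : ‖z - x‖ ≤ ‖z - y‖ generalizing x y
  · have := this hy hx (by rw [norm_sub_rev]; linarith) (le_of_not_ge h)
    rw [norm_sub_rev y x] at this
    linarith
  have a0 := hs.trans_le hx
  have b0 := hs.trans_le hy
  have hm : max ‖z - x‖ (max ‖x - y‖ s) ≤ 4 * ‖z - y‖ := max_le (by linarith) (max_le (by linarith) (by linarith))
  have m0 : 0 < max ‖z - x‖ (max ‖x - y‖ s) := a0.trans_le (le_max_left _ _)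
  have : 0 ≤ 4 / max ‖z - y‖ (max ‖x - y‖ s) / ‖z - y‖ := by positivity
  have : ‖z - x‖⁻¹ * ‖z - y‖⁻¹ ≤ 4 / max ‖z - x‖ (max ‖x - y‖ s) / ‖z - x‖ := by
    rw [div_eq_mul_inv _ ‖z - x‖, mul_comm]
    gcongr
    rw [le_div_iff₀ m0, inv_mul_le_iff₀ b0]; linarith
  linarith
lemma en {R s : ℝ} (hs : 0 < s) (sR : s ≤ 2 * R) (X : Finset ℂ) {p : ℂ → ℝ} (hp : ∀ x, 0 ≤ p x) (hX : ∀ x ∈ X, ‖x‖ ≤ R)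
    {A : Set ℂ} (mA : MeasurableSet A) (hA : ∀ z ∈ A, ‖z‖ ≤ R ∧ ∀ x ∈ X, s ≤ ‖z - x‖) :
    ∫ z in A, ‖∑ x ∈ X, (p x : ℂ) / (z - x)‖^2 ≤ 16 * π * ∑ x ∈ X, ∑ y ∈ X, p x * p y * rlog (8 * R / max ‖x - y‖ s) := by
  let k : ℂ → ℂ → ℂ → ℝ := fun x y z => 4 / max ‖z - x‖ (max ‖x - y‖ s) / ‖z - x‖
  have ik : ∀ x ∈ X, ∀ y ∈ X, IntegrableOn (k x y) A ∧ ∫ z in A, k x y z ≤ 8 * π * rlog (8 * R / max ‖x - y‖ s) := by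
    intro x hx y hy
    have d0 : 0 < max ‖x - y‖ s := hs.trans_le (le_max_right _ _)
    have dR : max ‖x - y‖ s ≤ 2 * R := max_le (by linarith [norm_sub_le x y, hX x hx, hX y hy]) sR
    have := rad (φ := fun r => 4 / max r (max ‖x - y‖ s)) (continuous_const.div (by fun_prop) fun r => (d0.trans_le (le_max_right _ _)).ne') x (d0.le.trans dR)
    have AB : A ⊆ closedBall x (2 * R) := fun z hz => by
      rw [mem_closedBall, dist_eq_norm]; linarith [norm_sub_le z x, hX x hx, (hA z hz).1]
    refine ⟨this.1.mono_set AB, (setIntegral_mono_set this.1 (ae_of_all _ fun z => by positivity) AB.eventuallyLE).trans ?_⟩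
    rw [this.2]
    nlinarith [radk d0 dR, Real.pi_pos]
  have h : ∀ z ∈ A, ‖∑ x ∈ X, (p x : ℂ) / (z - x)‖^2 ≤ ∑ x ∈ X, ∑ y ∈ X, p x * p y * (k x y z + k y x z) := fun z hz => by
    have : ‖∑ x ∈ X, (p x : ℂ) / (z - x)‖ ≤ ∑ x ∈ X, p x * ‖z - x‖⁻¹ := (norm_sum_le _ _).trans_eq (Finset.sum_congr rfl fun x _ => by
      rw [norm_div, norm_real, Real.norm_of_nonneg (hp x)]; rfl)
    refine (pow_le_pow_left₀ (norm_nonneg _) this 2).trans ?_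
    rw [sq, Finset.sum_mul_sum]
    refine Finset.sum_le_sum fun x hx => Finset.sum_le_sum fun y hy => ?_
    rw [mul_mul_mul_comm]
    refine mul_le_mul_of_nonneg_left ?_ (mul_nonneg (hp x) (hp y))
    have := pair hs ((hA z hz).2 x hx) ((hA z hz).2 y hy)
    simp only [k]; rwa [norm_sub_rev y x]
  have i2 : ∀ x ∈ X, ∀ y ∈ X, IntegrableOn (fun z => p x * p y * (k x y z + k y x z)) A := fun x hx y hy => ((ik x hx y hy).1.add (ik y hy x hx).1).const_mul _
  refine (integral_mono_of_nonneg (ae_of_all _ fun z => by positivity) (integrable_finsetSum _ fun x hx => integrable_finsetSum _ (i2 x hx)) (ae_restrict_of_forall_mem mA h)).trans ?_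
  rw [integral_finsetSum _ fun x hx => integrable_finsetSum _ (i2 x hx), Finset.mul_sum]
  refine Finset.sum_le_sum fun x hx => ?_
  rw [integral_finsetSum _ (i2 x hx), Finset.mul_sum]
  refine Finset.sum_le_sum fun y hy => ?_
  rw [integral_const_mul, integral_add (ik x hx y hy).1 (ik y hy x hx).1]
  have h1 := (ik x hx y hy).2
  have h2 := (ik y hy x hx).2
  rw [norm_sub_rev y x] at h2
  nlinarith [mul_nonneg (hp x) (hp y)]
end pot


lemma mn {X : Finset ℂ} (hX : X.Nonempty) (K : ℂ → ℂ → ℝ) (sym : ∀ x y, K x y = K y x) :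
    ∃ p : ℂ → ℝ, (∀ x, 0 ≤ p x) ∧ ∑ x ∈ X, p x = 1 ∧ ∀ x ∈ X, ∑ a ∈ X, p a * ∑ b ∈ X, p b * K a b ≤ ∑ b ∈ X, p b * K x b := by
  classical
  let S : Set (ℂ → ℝ) := {p | p ∈ univ.pi (fun _ => Icc (0:ℝ) 1) ∧ ∑ x ∈ X, p x = 1}
  have cS : IsCompact S := (isCompact_univ_pi fun _ => isCompact_Icc).inter_right (isClosed_eq (by fun_prop) continuous_const)
  obtain ⟨x0, hx0⟩ := hX
  have nS : S.Nonempty := ⟨Pi.single x0 1, fun y _ => by by_cases h : y = x0 <;> simp [Pi.single_apply, h], by simp [Pi.single_apply, hx0]⟩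
  obtain ⟨p, pS, hp⟩ := cS.exists_isMinOn nS (f := fun p => ∑ a ∈ X, p a * ∑ b ∈ X, p b * K a b) (by fun_prop)
  refine ⟨p, fun x => (pS.1 x trivial).1, pS.2, fun x hx => ?_⟩
  have key : ∀ t ∈ Icc (0:ℝ) 1, ∑ a ∈ X, p a * ∑ b ∈ X, p b * K a b ≤ (1-t) * ((1-t) * (∑ a ∈ X, p a * ∑ b ∈ X, p b * K a b) + t * ∑ b ∈ X, p b * K x b)
      + t * ((1-t) * (∑ b ∈ X, p b * K x b) + t * K x x) := by
    intro t ht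
    let q : ℂ → ℝ := fun y => (1-t) * p y + t * if y = x then 1 else 0
    have hq : ∀ g : ℂ → ℝ, ∑ y ∈ X, q y * g y = (1-t) * (∑ y ∈ X, p y * g y) + t * g x := fun g => by
      simp [q, add_mul, Finset.sum_add_distrib, Finset.mul_sum, hx, mul_assoc]
    have qS : q ∈ S := ⟨fun y _ => by
      have := pS.1 y trivial
      simp only [q]
      split_ifs
      · constructor <;> nlinarith [this.1, this.2, ht.1, ht.2]
      · constructor <;> nlinarith [this.1, this.2, ht.1, ht.2], by
      have := hq fun _ => 1
      simp only [mul_one, pS.2] at this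
      linarith⟩
    have := isMinOn_iff.1 hp q qS
    refine this.trans_eq ?_
    rw [hq, hq]
    simp only [hq, mul_add, Finset.sum_add_distrib]
    have e1 : ∑ a ∈ X, p a * ((1-t) * ∑ b ∈ X, p b * K a b) = (1-t) * ∑ a ∈ X, p a * ∑ b ∈ X, p b * K a b := by
      rw [Finset.mul_sum]; exact Finset.sum_congr rfl fun _ _ => by ring
    have e2 : ∑ a ∈ X, p a * (t * K a x) = t * ∑ b ∈ X, p b * K x b := by
      rw [Finset.mul_sum]; exact Finset.sum_congr rfl fun a _ => by rw [sym a x]; ring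
    rw [e1, e2]
  generalize (∑ a ∈ X, p a * ∑ b ∈ X, p b * K a b) = I0 at *
  generalize (∑ b ∈ X, p b * K x b) = h at *
  by_contra! hh
  have B0 : 0 < |I0 - 2 * h + K x x| + 1 := by positivity
  have d0 : 0 < I0 - h := by linarith
  let t := min 1 ((I0 - h) / (|I0 - 2 * h + K x x| + 1))
  have t0 : 0 < t := lt_min one_pos (by positivity)
  have h1 : t * (|I0 - 2 * h + K x x| + 1) ≤ I0 - h := (le_div_iff₀ B0).1 (min_le_right _ _)
  have h2 := key t ⟨t0.le, min_le_left _ _⟩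
  have h3 : 0 ≤ t * (-2 * (I0 - h) + t * (I0 - 2 * h + K x x)) := by nlinarith
  have h4 := nonneg_of_mul_nonneg_right h3 t0
  have := mul_le_mul_of_nonneg_left (le_abs_self (I0 - 2 * h + K x x)) t0.le
  linarith


structure LB (U Q : Set ℂ) (R1 R C : ℝ) : Prop where
  oU : IsOpen U
  oQ : IsOpen Q
  cQ : IsPreconnected Q
  ne : (Q ∩ U).Nonempty
  R0 : 0 < R
  C0 : 0 < C
  hR : R1 ≤ R
  QR : ∀ z ∈ Q, ‖z‖ ≤ R
  bd : ∀ l ∈ Q ∩ U, ∃ s > 0, ∀ f : ℂ → ℂ, DifferentiableOn ℂ f U → ‖f l‖^2 ≤ C * ∫ x in Rgs U R1 s, ‖f x‖^2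
section lb
variable {U Q : Set ℂ} {R1 R C : ℝ}
lemma LB.en (h : LB U Q R1 R C) {l : ℂ} (hl : l ∈ Q ∩ U) : ∃ s0 > 0, ∀ s > 0, s ≤ 2 * R → ∀ (X : Finset ℂ) (p : ℂ → ℝ), (∀ x, 0 ≤ p x) →
    (∀ x ∈ X, x ∈ Q \ U ∧ ∀ z ∈ U, s0 ≤ ‖z - x‖ → s ≤ ‖z - x‖) →
    ‖∑ x ∈ X, (p x : ℂ) / (l - x)‖^2 ≤ C * (16 * π) * ∑ x ∈ X, p x * ∑ y ∈ X, p y * rlog (8 * R / max ‖x - y‖ s) := by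
  obtain ⟨s0, s00, hs0⟩ := h.bd l hl
  refine ⟨s0, s00, fun s hs sR X p hp hX => ?_⟩
  refine (hs0 (fun z => ∑ x ∈ X, (p x : ℂ) / (z - x)) (DifferentiableOn.fun_sum fun x hx => (differentiableOn_const _).div (by fun_prop) fun z hz e => (hX x hx).1.2 (by rwa [← sub_eq_zero.1 e]))).trans ?_
  rw [mul_assoc]
  refine mul_le_mul_of_nonneg_left ((_root_.en hs sR X hp (fun x hx => h.QR x (hX x hx).1.1) (Rgs_cp U R1 s0).measurableSet fun z hz => ⟨hz.1.trans h.hR, fun x hx => (hX x hx).2 z (hz.2 (mem_ball_self s00)) ?_⟩).trans_eq ?_) h.C0.le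
  · by_contra! hh
    exact (hX x hx).1.2 (hz.2 (by rwa [mem_ball, dist_comm, dist_eq_norm]))
  · simp only [Finset.mul_sum, mul_assoc]
lemma LB.dn (h : LB U Q R1 R C) : Q ⊆ closure (Q ∩ U) := by
  refine (h.cQ.subset_of_closure_inter_subset (u := interior (closure (Q ∩ U))) isOpen_interior ?_ ?_).trans interior_subset
  · obtain ⟨x, hx⟩ := h.ne
    exact ⟨x, hx.1, (h.oQ.inter h.oU).subset_interior_closure hx⟩
  rintro p ⟨hp, pQ⟩
  replace hp : p ∈ closure (Q ∩ U) := closure_minimal interior_subset isClosed_closure hp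
  by_contra hn
  rw [mem_interior_iff_mem_nhds, Metric.mem_nhds_iff] at hn
  push Not at hn
  obtain ⟨r, r0, hr⟩ := Metric.isOpen_iff.1 h.oQ p pQ
  let A := C * (16 * π)
  have A0 : 0 < A := mul_pos h.C0 (by positivity)
  have R0 := h.R0
  let η := min (r / 2) (min (2 * R) (1 / (32 * A * R)))
  have η0 : 0 < η := lt_min (by positivity) (lt_min (by positivity) (by positivity))
  obtain ⟨q, qb, hq⟩ := not_subset.1 (hn η η0)
  have d0 : 0 < infDist q (Q ∩ U) := by
    rw [← infDist_closure]; exact (isClosed_closure.notMem_iff_infDist_pos ⟨p, hp⟩).1 hq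
  have dη : infDist q (Q ∩ U) < η := by
    rw [← infDist_closure]; exact (infDist_le_dist_of_mem hp).trans_lt qb
  obtain ⟨l, hl, ld⟩ := (infDist_lt_iff h.ne).1 (show infDist q (Q ∩ U) < 2 * infDist q (Q ∩ U) by linarith)
  generalize hd : infDist q (Q ∩ U) = d at *
  have ηr : η ≤ r / 2 := min_le_left _ _
  have far : ∀ z ∈ U, d ≤ ‖z - q‖ := fun z hz => by
    by_contra! hh
    have zQ : z ∈ Q := hr (by rw [mem_ball]; rw [mem_ball] at qb; rw [← dist_eq_norm] at hh; linarith [dist_triangle z q p])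
    have := infDist_le_dist_of_mem (x := q) (show z ∈ Q ∩ U from ⟨zQ, hz⟩)
    rw [dist_comm, dist_eq_norm] at this
    linarith
  have qQ : q ∈ Q \ U := ⟨hr (ball_subset_ball (by linarith) qb), fun hU => by have := far q hU; simp at this; linarith⟩
  obtain ⟨s0, s00, hs⟩ := h.en hl
  have := hs d d0 (dη.le.trans ((min_le_right _ _).trans (min_le_left _ _))) {q} (fun _ => 1) (fun _ => zero_le_one) fun x hx => by
    rw [Finset.mem_singleton.1 hx]; exact ⟨qQ, fun z hz _ => far z hz⟩
  simp only [Finset.sum_singleton, ofReal_one, one_mul, sub_self, norm_zero, max_eq_right d0.le, norm_div, norm_one, one_div, norm_inv, inv_pow] at this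
  have l0 : 0 < ‖l - q‖ := d0.trans_le (far l hl.2)
  have l2 : ‖l - q‖ < 2 * d := by rwa [← dist_eq_norm, dist_comm]
  have h1 : ((2 * d)^2)⁻¹ ≤ A * (8 * R / d) := by
    refine le_trans (inv_anti₀ (by positivity) (pow_le_pow_left₀ l0.le l2.le 2)) (this.trans ?_)
    gcongr
    exact (Real.log_le_sub_one_of_pos (by positivity)).trans (by linarith)
  have h2 : d < 1 / (32 * A * R) := dη.trans_le ((min_le_right _ _).trans (min_le_right _ _))
  rw [lt_div_iff₀ (by positivity)] at h2
  rw [inv_le_iff_one_le_mul₀ (by positivity)] at h1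
  have : A * (8 * R / d) * (2 * d)^2 = d * (32 * A * R) := by field_simp; ring
  linarith
lemma LB.loc (h : LB U Q R1 R C) : ∃ c1 > 0, ∀ c ∈ Q \ U, ∀ ε > 0, closedBall c (4 * ε) ⊆ Q → ∃ s > 0, s ≤ 2 * R ∧ ∃ (X : Finset ℂ) (p : ℂ → ℝ),
    (∀ x ∈ X, x ∈ Q \ U) ∧ (∀ x ∈ X, x ∈ closedBall c ε) ∧ (∀ x, 0 ≤ p x) ∧ ∑ x ∈ X, p x = 1 ∧
    ∀ z ∈ closedBall c ε \ U, c1 / ε^2 ≤ ∑ y ∈ X, p y * rlog (8 * R / max ‖z - y‖ s) := by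
  let A := C * (16 * π)
  have A0 : 0 < A := mul_pos h.C0 (by positivity)
  have R0 := h.R0
  refine ⟨1 / (1250 * A), by positivity, fun c hc ε ε0 hQ => ?_⟩
  have cQ : c + 3 * ε ∈ Q := hQ (by simp [abs_of_pos ε0]; linarith)
  obtain ⟨l, hl, ld⟩ := Metric.mem_closure_iff.1 (h.dn cQ) ε ε0
  obtain ⟨s0, s00, hs⟩ := h.en hl
  let s := min s0 (2 * R)
  have hs0 : 0 < s := lt_min s00 (by positivity)
  let η := s * (1 / (1250 * A) / ε^2)
  have η0 : 0 < η := by positivity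
  have TQ : closedBall c ε ⊆ Q := (closedBall_subset_closedBall (by linarith)).trans hQ
  have Tc : IsCompact (closedBall c ε \ U) := (isCompact_closedBall c ε).diff h.oU
  obtain ⟨t, tT, tf, tc⟩ := Tc.finite_cover_balls η0
  have mt : ∀ x ∈ tf.toFinset, x ∈ closedBall c ε \ U := fun x hx => tT (tf.mem_toFinset.1 hx)
  have tn : tf.toFinset.Nonempty := by
    have := tc (show c ∈ closedBall c ε \ U from ⟨mem_closedBall_self ε0.le, hc.2⟩)
    simp only [mem_iUnion] at this
    obtain ⟨x, hx, -⟩ := this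
    exact ⟨x, tf.mem_toFinset.2 hx⟩
  obtain ⟨p, p0, p1, hp⟩ := mn tn (fun x y => rlog (8 * R / max ‖x - y‖ s)) fun x y => by simp only [norm_sub_rev]
  have mQ : ∀ x ∈ tf.toFinset, x ∈ Q \ U := fun x hx => ⟨TQ (mt x hx).1, (mt x hx).2⟩
  refine ⟨s, hs0, min_le_right _ _, tf.toFinset, p, mQ, fun x hx => (mt x hx).1, p0, p1, fun z hz => ?_⟩
  have e1 := hs s hs0 (min_le_right _ _) tf.toFinset p p0 fun x hx => ⟨mQ x hx, fun z _ h => (min_le_left _ _).trans h⟩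
  have e2 : 1 / (25 * ε) ≤ ‖∑ x ∈ tf.toFinset, (p x : ℂ) / (l - x)‖ := by
    refine le_trans ?_ (re_le_norm _)
    rw [re_sum, ← one_mul (1 / (25 * ε)), ← p1, Finset.sum_mul]
    refine Finset.sum_le_sum fun x hx => ?_
    rw [div_eq_mul_inv (p x : ℂ), re_ofReal_mul]
    refine mul_le_mul_of_nonneg_left ?_ (p0 x)
    have hw : ‖l - x - 3 * ε‖ ≤ 2 * ε := by
      have h1 := (mt x hx).1
      rw [mem_closedBall, dist_eq_norm] at h1
      rw [dist_comm, dist_eq_norm] at ld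
      have := norm_sub_le (l - (c + 3 * ε)) (x - c)
      rw [show l - (c + 3 * ε) - (x - c) = l - x - 3 * ε by ring] at this
      linarith
    have r1 : ε ≤ (l - x).re := by
      have := (abs_le.1 ((abs_re_le_norm _).trans hw)).1
      simp at this ⊢; linarith
    have r2 : ‖l - x‖ ≤ 5 * ε := by
      have := norm_add_le (l - x - 3 * ε) (3 * ε)
      rw [sub_add_cancel] at this
      simp [abs_of_pos ε0] at this hw; linarith
    rw [inv_re, normSq_eq_norm_sq]
    have r3 : 0 < ‖l - x‖ := (ε0.trans_le r1).trans_le (re_le_norm _)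
    rw [div_le_div_iff₀ (by positivity) (by positivity)]
    nlinarith
  have e3 : (1 / (25 * ε))^2 ≤ A * ∑ x ∈ tf.toFinset, p x * ∑ y ∈ tf.toFinset, p y * rlog (8 * R / max ‖x - y‖ s) := (pow_le_pow_left₀ (by positivity) e2 2).trans e1
  obtain ⟨x, xt, hx⟩ := mem_iUnion₂.1 (tc hz)
  have e4 := hp x (tf.mem_toFinset.2 xt)
  have e5 : ∑ b ∈ tf.toFinset, p b * rlog (8 * R / max ‖x - b‖ s) ≤ (∑ b ∈ tf.toFinset, p b * rlog (8 * R / max ‖z - b‖ s)) + η / s := by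
    rw [← one_mul (η / s), ← p1, Finset.sum_mul, ← Finset.sum_add_distrib]
    refine Finset.sum_le_sum fun b _ => ?_
    rw [← mul_add]
    refine mul_le_mul_of_nonneg_left ?_ (p0 b)
    have m1 : 0 < max ‖x - b‖ s := hs0.trans_le (le_max_right _ _)
    have m2 : 0 < max ‖z - b‖ s := hs0.trans_le (le_max_right _ _)
    have m3 : max ‖z - b‖ s ≤ max ‖x - b‖ s + η := by
      rw [mem_ball, dist_eq_norm] at hx
      have := norm_add_le (z - x) (x - b)
      rw [sub_add_sub_cancel] at this
      refine max_le ?_ ?_ <;> linarith [le_max_left ‖x - b‖ s, le_max_right ‖x - b‖ s]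
    rw [Real.log_div (by positivity) m1.ne', Real.log_div (by positivity) m2.ne']
    have := Real.log_le_sub_one_of_pos (div_pos m2 m1)
    rw [Real.log_div m2.ne' m1.ne'] at this
    have : max ‖z - b‖ s / max ‖x - b‖ s - 1 ≤ η / s := by
      rw [div_sub_one m1.ne']
      exact div_le_div₀ η0.le (by linarith) hs0 (le_max_right _ _)
    linarith
  have e6 : η / s = 1 / (1250 * A) / ε^2 := by simp only [η]; field_simp
  rw [← div_le_iff₀' A0] at e3
  have e7 : (1 / (25 * ε))^2 / A = 2 * (1 / (1250 * A) / ε^2) := by field_simp; norm_num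
  linarith
end lb


section lb2
variable {U Q : Set ℂ} {R1 R C : ℝ}
lemma LB.vol (h : LB U Q R1 R C) : ∃ C3 : ℝ, ∀ c ∈ Q \ U, ∀ ε > 0, closedBall c (4 * ε) ⊆ Q → volume (closedBall c ε \ U) ≤ ofR (C3 * ε^3) := by
  obtain ⟨c1, c10, hc1⟩ := h.loc
  have R0 := h.R0
  refine ⟨32 * π * R / c1, fun c hc ε ε0 hQ => ?_⟩
  obtain ⟨s, s0, sR, X, p, XQ, Xc, p0, p1, hp⟩ := hc1 c hc ε ε0 hQ
  let T := closedBall c ε \ U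
  have mT : MeasurableSet T := measurableSet_closedBall.diff h.oU.measurableSet
  have fT : volume T ≠ ⊤ := ((measure_mono diff_subset).trans_lt measure_closedBall_lt_top).ne
  have ib : ∀ y ∈ X, IntegrableOn (fun z => p y * (8 * R / ‖z - y‖)) T ∧ ∫ z in T, p y * (8 * R / ‖z - y‖) ≤ p y * (32 * π * R * ε) := fun y hy => by
    have h1 := rad (φ := fun _ => 8 * R) continuous_const y (show 0 ≤ 2 * ε by positivity)
    have TB : T ⊆ closedBall y (2 * ε) := fun z hz => by
      have := hz.1; have h2 := Xc y hy
      rw [mem_closedBall] at *; linarith [dist_triangle_right z y c]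
    refine ⟨(h1.1.mono_set TB).const_mul _, ?_⟩
    rw [integral_const_mul]
    refine mul_le_mul_of_nonneg_left ((setIntegral_mono_set h1.1 (ae_of_all _ fun z => by positivity) TB.eventuallyLE).trans_eq ?_) (p0 y)
    rw [h1.2, intervalIntegral.integral_const, smul_eq_mul]; ring
  have key : ∫ z in T, c1 / ε^2 ≤ ∫ z in T, ∑ y ∈ X, p y * (8 * R / ‖z - y‖) := by
    refine integral_mono_ae (integrableOn_const fT) (integrable_finsetSum _ fun y hy => (ib y hy).1) ?_
    filter_upwards [ae_restrict_mem mT, ae_restrict_of_ae (X.countable_toSet.ae_notMem volume)] with z hz hX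
    refine (hp z hz).trans (Finset.sum_le_sum fun y hy => mul_le_mul_of_nonneg_left ?_ (p0 y))
    have : 0 < ‖z - y‖ := norm_pos_iff.2 (sub_ne_zero.2 fun e => hX (e ▸ hy))
    refine (Real.log_le_sub_one_of_pos (by positivity)).trans ?_
    have : 8 * R / max ‖z - y‖ s ≤ 8 * R / ‖z - y‖ := by gcongr; exact le_max_left _ _
    linarith
  rw [integral_finsetSum _ fun y hy => (ib y hy).1, setIntegral_const, smul_eq_mul] at key
  have k2 := key.trans (Finset.sum_le_sum fun y hy => (ib y hy).2)
  rw [← Finset.sum_mul, p1, one_mul, ← le_div_iff₀ (by positivity)] at k2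
  rw [← ENNReal.ofReal_toReal fT]
  refine ENNReal.ofReal_le_ofReal (k2.trans_eq ?_)
  field_simp
lemma LB.null (h : LB U Q R1 R C) : volume (Q \ U) = 0 := by
  obtain ⟨C3, hC⟩ := h.vol
  have mE : MeasurableSet (Q \ U) := h.oQ.measurableSet.diff h.oU.measurableSet
  rw [← Measure.restrict_eq_zero, ← ae_eq_bot, ← Filter.eventually_false_iff_eq_bot]
  filter_upwards [Besicovitch.ae_tendsto_measure_inter_div volume (Q \ U), ae_restrict_mem mE] with x hx xE
  have t0 : Tendsto (fun r : ℝ => ofR (C3 / π * r)) (𝓝[>] 0) (𝓝 0) := by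
    have : Tendsto (fun r : ℝ => ofR (C3 / π * r)) (𝓝 0) (𝓝 (ofR (C3 / π * 0))) := (ENNReal.continuous_ofReal.comp (by fun_prop)).tendsto _
    rw [mul_zero, ENNReal.ofReal_zero] at this
    exact this.mono_left nhdsWithin_le_nhds
  obtain ⟨r0, r00, hr0⟩ := Metric.nhds_basis_closedBall.mem_iff.1 (h.oQ.mem_nhds xE.1)
  have := le_of_tendsto_of_tendsto hx t0 (by
    filter_upwards [Ioo_mem_nhdsGT (show 0 < r0 / 4 by positivity)] with r hr
    refine ENNReal.div_le_of_le_mul ((measure_mono (fun z hz => ⟨hz.2, hz.1.2⟩ : Q \ U ∩ closedBall x r ⊆ closedBall x r \ U)).trans ((hC x xE r hr.1 ((closedBall_subset_closedBall (by linarith [hr.2])).trans hr0)).trans_eq ?_))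
    rw [Complex.volume_closedBall, ← ENNReal.ofReal_pow hr.1.le, show ((NNReal.pi : ℝ≥0∞)) = ofR π from (ENNReal.ofReal_coe_nnreal (p := NNReal.pi)).symm, ← ENNReal.ofReal_mul (sq_nonneg _), ← ENNReal.ofReal_mul' (by positivity)]
    congr 1
    field_simp)
  simp at this
end lb2
structure Pt (E : Set ℂ) (R : ℝ) (v : ℂ → ℝ) : Prop where
  co : Continuous v
  le : ∀ z, ‖z‖ ≤ R → v z ≤ 0
  sm : ∀ (c : ℂ) (r : ℝ), 0 < r → v c ≤ (2 * π)⁻¹ * ∫ θ in (0:ℝ)..(2 * π), v (c + r * exp (θ * I))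
  lo : ∀ z d, 0 < d → d ≤ 8 * R → (∀ y ∈ E, d ≤ ‖z - y‖) → rlog (d / (8 * R)) ≤ v z
lemma Pt.sum {E : Set ℂ} {R : ℝ} {ι : Type*} (s : Finset ι) {w : ι → ℝ} {v : ι → ℂ → ℝ} (hv : ∀ i ∈ s, Pt E R (v i)) (w0 : ∀ i, 0 ≤ w i) (w1 : ∑ i ∈ s, w i ≤ 1) :
    Pt E R fun z => ∑ i ∈ s, w i * v i z where
  co := continuous_finsetSum _ fun i hi => continuous_const.mul (hv i hi).co
  le z hz := Finset.sum_nonpos fun i hi => mul_nonpos_of_nonneg_of_nonpos (w0 i) ((hv i hi).le z hz)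
  sm c r hr := by
    have cc : Continuous fun θ : ℝ => c + r * exp (θ * I) := by fun_prop
    rw [intervalIntegral.integral_finsetSum (f := fun i (θ : ℝ) => w i * v i (c + r * exp (θ * I))) fun i hi => ((continuous_const.mul ((hv i hi).co.comp cc)).intervalIntegrable _ _), Finset.mul_sum]
    refine Finset.sum_le_sum fun i hi => ?_
    rw [intervalIntegral.integral_const_mul, mul_left_comm]
    exact mul_le_mul_of_nonneg_left ((hv i hi).sm c r hr) (w0 i)
  lo z d d0 dR hd := by
    have : rlog (d / (8 * R)) ≤ 0 := Real.log_nonpos (by have := d0.trans_le dR; positivity) ((div_le_one (d0.trans_le dR)).2 dR)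
    refine le_trans ?_ (Finset.sum_le_sum fun i hi => mul_le_mul_of_nonneg_left ((hv i hi).lo z d d0 dR hd) (w0 i))
    rw [← Finset.sum_mul]
    nlinarith
lemma Pt.base {E : Set ℂ} {R s : ℝ} {y : ℂ} (hy : y ∈ E) (s0 : 0 < s) (sR : s ≤ 2 * R) (yR : ‖y‖ ≤ R) : Pt E R fun z => - rlog (8 * R / max ‖z - y‖ s) := by
  have m0 : ∀ z, 0 < max ‖z - y‖ s := fun z => s0.trans_le (le_max_right _ _)
  have R0 : 0 < 8 * R := by linarith
  have e : ∀ z, - rlog (8 * R / max ‖z - y‖ s) = rlog (max ‖z - y‖ s) - rlog (8 * R) := fun z => by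
    rw [Real.log_div R0.ne' (m0 z).ne']; ring
  simp only [e]
  have cl : Continuous fun z => rlog (max ‖z - y‖ s) := Continuous.log (by fun_prop) fun z => (m0 z).ne'
  refine ⟨cl.sub continuous_const, fun z hz => sub_nonpos.2 (Real.log_le_log (m0 z) (max_le ?_ ?_)), fun c r hr => ?_, fun z d d0 _ hd => ?_⟩
  · linarith [norm_sub_le z y]
  · linarith
  · have cc : Continuous fun θ : ℝ => c + r * exp (θ * I) := by fun_prop
    have ic : IntervalIntegrable (fun θ : ℝ => rlog (max ‖c + r * exp (θ * I) - y‖ s)) volume 0 (2 * π) := (cl.comp cc).intervalIntegrable _ _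
    rw [intervalIntegral.integral_sub ic intervalIntegrable_const, intervalIntegral.integral_const, smul_eq_mul, mul_sub, sub_zero, inv_mul_cancel_left₀ (by positivity)]
    refine sub_le_sub_right ?_ _
    rcases le_total ‖c - y‖ s with hc | hc
    · rw [max_eq_right hc]
      have := intervalIntegral.integral_mono_on (by positivity) intervalIntegrable_const ic (f := fun _ => rlog s) fun θ _ => Real.log_le_log s0 (le_max_right _ _)
      rw [intervalIntegral.integral_const, smul_eq_mul, sub_zero] at this
      rw [inv_mul_eq_div, le_div_iff₀ (by positivity), mul_comm]
      exact this
    · rw [max_eq_left hc]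
      have J := circleAverage_log_norm_sub_const_eq_log_radius_add_posLog (c := c) (a := y) hr.ne'
      have ii := circleIntegrable_log_norm_sub_const (c := c) (a := y) r
      have n0 := s0.trans_le hc
      have : rlog ‖c - y‖ ≤ rlog r + Real.posLog (r⁻¹ * ‖c - y‖) := by
        have : rlog (r⁻¹ * ‖c - y‖) ≤ Real.posLog (r⁻¹ * ‖c - y‖) := le_max_right _ _
        rw [Real.log_mul (inv_pos.2 hr).ne' n0.ne', Real.log_inv] at this
        linarith
      refine this.trans ?_
      rw [← J, Real.circleAverage, smul_eq_mul]
      refine mul_le_mul_of_nonneg_left ?_ (by positivity)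
      refine intervalIntegral.integral_mono_ae (by positivity) ii ic ?_
      filter_upwards [((countable_singleton y).preimage_circleMap c hr.ne').ae_notMem volume] with θ hθ
      exact Real.log_le_log (norm_pos_iff.2 (sub_ne_zero.2 hθ)) (le_max_left _ _)
  · rw [Real.log_div d0.ne' R0.ne']
    exact sub_le_sub_right (Real.log_le_log d0 ((hd y hy).trans (le_max_left _ _))) _


section lb3
variable {U Q : Set ℂ} {R1 R C : ℝ}
lemma LB.cap (h : LB U Q R1 R C) {K : Set ℂ} (hK : IsCompact K) (KQ : K ⊆ Q \ U) {V : ℝ} (V0 : 0 < V) : ∃ v, Pt (Q \ U) R v ∧ ∀ z ∈ K, v z ≤ -V := by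
  obtain ⟨c1, c10, hc1⟩ := h.loc
  obtain ⟨t, r, -, tK, hr, tc, ts⟩ := Besicovitch.exists_closedBall_covering_tsum_measure_le volume (ε := ofR (c1 / (4 * V) * π)) (by simp; positivity)
    (fun x => {r | 0 < r ∧ closedBall x (8 * r) ⊆ Q}) K fun x hx δ δ0 => by
      obtain ⟨r0, r00, hr0⟩ := Metric.nhds_basis_closedBall.mem_iff.1 (h.oQ.mem_nhds (KQ hx).1)
      have : 0 < min (r0 / 8) (δ / 2) := lt_min (by positivity) (by positivity)
      refine ⟨min (r0 / 8) (δ / 2), ⟨this, (closedBall_subset_closedBall ?_).trans hr0⟩, this, ?_⟩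
      · linarith [min_le_left (r0 / 8) (δ / 2)]
      · linarith [min_le_right (r0 / 8) (δ / 2)]
  rw [measure_mono_null KQ h.null, zero_add] at ts
  obtain ⟨b, bt, bf, bc⟩ := hK.elim_finite_subcover_image (b := t) (c := fun x => ball x (2 * r x)) (fun x _ => isOpen_ball) (tc.trans (iUnion₂_mono fun x hx => closedBall_subset_ball (by linarith [(hr x hx).1])))
  have ex : ∀ x ∈ t, ∃ v, Pt (Q \ U) R v ∧ ∀ z ∈ closedBall x (2 * r x) \ U, v z ≤ - (c1 / (2 * r x)^2) := fun x hx => by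
    obtain ⟨s, s0, sR, X, p, XQ, -, p0, p1, hp⟩ := hc1 x (KQ (tK hx)) (2 * r x) (by linarith [(hr x hx).1]) (by rw [show 4 * (2 * r x) = 8 * r x by ring]; exact (hr x hx).2)
    refine ⟨_, Pt.sum X (fun y hy => Pt.base (XQ y hy) s0 sR (h.QR y (XQ y hy).1)) p0 p1.le, fun z hz => ?_⟩
    have := hp z hz
    simp only [mul_neg, Finset.sum_neg_distrib]
    linarith
  choose! v hv hv2 using ex
  have mb : ∀ x ∈ bf.toFinset, x ∈ t := fun x hx => bt (bf.mem_toFinset.1 hx)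
  refine ⟨_, Pt.sum bf.toFinset (w := fun x => 4 * V / c1 * r x ^2) (fun x hx => hv x (mb x hx)) (fun x => by positivity) ?_, fun z hz => ?_⟩
  · rw [tsum_subtype t fun x => volume (closedBall x (r x))] at ts
    have h1 := (ENNReal.sum_le_tsum bf.toFinset).trans ts
    have h2 : ∑ x ∈ bf.toFinset, t.indicator (fun x => volume (closedBall x (r x))) x = ofR (∑ x ∈ bf.toFinset, r x ^ 2 * π) := by
      rw [ENNReal.ofReal_sum_of_nonneg fun x _ => by positivity]
      refine Finset.sum_congr rfl fun x hx => ?_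
      rw [indicator_of_mem (mb x hx), Complex.volume_closedBall, ENNReal.ofReal_mul (sq_nonneg _), ENNReal.ofReal_pow (hr x (mb x hx)).1.le]
      congr 1
      exact (ENNReal.ofReal_coe_nnreal (p := NNReal.pi)).symm
    rw [h2, ENNReal.ofReal_le_ofReal_iff (by positivity), ← Finset.sum_mul, mul_le_mul_iff_left₀ Real.pi_pos] at h1
    rw [← Finset.mul_sum]
    calc _ ≤ 4 * V / c1 * (c1 / (4 * V)) := by gcongr
      _ = 1 := by field_simp
  · obtain ⟨x, xb, hx⟩ := mem_iUnion₂.1 (bc hz)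
    have xb' : x ∈ bf.toFinset := bf.mem_toFinset.2 xb
    have rx := (hr x (bt xb)).1
    have h1 := mul_le_mul_of_nonneg_left (hv2 x (bt xb) z ⟨ball_subset_closedBall hx, (KQ hz).2⟩) (show 0 ≤ 4 * V / c1 * r x ^2 by positivity)
    rw [show 4 * V / c1 * r x ^2 * -(c1 / (2 * r x)^2) = -V by field_simp; norm_num] at h1
    refine le_trans ?_ h1
    rw [← Finset.add_sum_erase _ _ xb']
    have := Finset.sum_nonpos (s := bf.toFinset.erase x) (f := fun i => 4 * V / c1 * r i ^ 2 * v i z) fun i hi => mul_nonpos_of_nonneg_of_nonpos (by positivity) ((hv i (mb i (Finset.mem_of_mem_erase hi))).le z (h.QR z (KQ hz).1))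
    linarith
theorem LB.polar (h : LB U Q R1 R C) : PolarSet (Q \ U) := by
  intro z0 hz0
  obtain ⟨ρ, ρ0, hρ⟩ := Metric.nhds_basis_closedBall.mem_iff.1 (h.oQ.mem_nhds hz0.1)
  have hc : ∀ j : ℕ, ∃ v, Pt (Q \ U) R v ∧ ∀ z ∈ closedBall z0 ρ \ U, v z ≤ -(2:ℝ)^(j+1) := fun j =>
    h.cap ((isCompact_closedBall _ _).diff h.oU) (diff_subset_diff_left hρ) (by positivity)
  choose v hv hv2 using hc
  let S : ℕ → ℂ → ℝ := fun n z => ∑ j ∈ Finset.range n, (2⁻¹:ℝ)^(j+1) * v j z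
  have hS : ∀ n, Pt (Q \ U) R (S n) := fun n => Pt.sum _ (fun j _ => hv j) (fun j => by positivity) (by
    have : ∀ n, ∑ j ∈ Finset.range n, (2⁻¹:ℝ)^(j+1) = 1 - 2⁻¹^n := fun n => by
      induction n with
      | zero => simp
      | succ n ih => rw [Finset.sum_range_succ, ih]; ring
    rw [this]
    have : (0:ℝ) ≤ 2⁻¹^n := by positivity
    linarith)
  have bR : ∀ z ∈ closedBall z0 ρ, ‖z‖ ≤ R := fun z hz => h.QR z (hρ hz)
  have an : ∀ z ∈ closedBall z0 ρ, Antitone fun n => S n z := fun z hz => antitone_nat_of_succ_le fun n => by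
    simp only [S, Finset.sum_range_succ]
    have := mul_nonpos_of_nonneg_of_nonpos (show (0:ℝ) ≤ 2⁻¹^(n+1) by positivity) ((hv n).le z (bR z hz))
    linarith
  let u : ℂ → EReal := fun z => ⨅ n, (S n z : EReal)
  have ut : ∀ z, u z < ⊤ := fun z => (iInf_le (fun n => (S n z : EReal)) 0).trans_lt (EReal.coe_lt_top _)
  refine ⟨ball z0 ρ, isOpen_ball, (convex_ball z0 ρ).isConnected ⟨z0, mem_ball_self ρ0⟩, mem_ball_self ρ0, u, ⟨?_, fun z _ => ut z, fun c hcb r r0 hr => ?_⟩, ?_, fun z hz => ?_⟩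
  · exact upperSemicontinuousOn_iInf fun n => ((continuous_coe_real_ereal.comp (hS n).co).upperSemicontinuous).upperSemicontinuousOn _
  · refine le_iInf fun N => ?_
    have cc : Continuous fun θ : ℝ => c + r * exp (θ * I) := by fun_prop
    have mem : ∀ θ : ℝ, c + r * exp (θ * I) ∈ closedBall z0 ρ := fun θ => ball_subset_closedBall (hr (by simp [norm_exp_ofReal_mul_I, abs_of_pos r0]))
    let F : ℕ → ℝ → ℝ := fun n θ => max (S n (c + r * exp (θ * I))) (-N)
    have cF : ∀ n, Continuous (F n) := fun n => ((hS n).co.comp cc).max continuous_const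
    have lim : Tendsto (fun n => ∫ θ in (0:ℝ)..(2 * π), F n θ) atTop (𝓝 (∫ θ in (0:ℝ)..(2 * π), (max (u (c + r * exp (θ * I))) (-(N : ℝ) : EReal)).toReal)) := by
      refine intervalIntegral.tendsto_integral_filter_of_dominated_convergence (fun _ => (N:ℝ)) (.of_forall fun n => (cF n).aestronglyMeasurable) (.of_forall fun n => ae_of_all _ fun θ _ => ?_) intervalIntegrable_const (ae_of_all _ fun θ _ => ?_)
      · rw [Real.norm_eq_abs, abs_le]
        exact ⟨le_max_right _ _, max_le (((hS n).le _ (bR _ (mem θ))).trans (Nat.cast_nonneg N)) (by linarith [(Nat.cast_nonneg N : (0:ℝ) ≤ N)])⟩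
      · have t1 : Tendsto (fun n => (S n (c + r * exp (θ * I)) : EReal)) atTop (𝓝 (u (c + r * exp (θ * I)))) :=
          tendsto_atTop_iInf fun a b hab => EReal.coe_le_coe_iff.2 (an _ (mem θ) hab)
        have t2 := t1.max (tendsto_const_nhds (x := (-(N : ℝ) : EReal)))
        have ne1 : max (u (c + r * exp (θ * I))) (-(N : ℝ) : EReal) ≠ ⊤ := (max_lt (ut _) (EReal.coe_lt_top (-N))).ne
        have ne2 : max (u (c + r * exp (θ * I))) (-(N : ℝ) : EReal) ≠ ⊥ := ((EReal.bot_lt_coe (-N)).trans_le (le_max_right _ _)).ne'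
        refine ((EReal.tendsto_toReal ne1 ne2).comp t2).congr fun n => ?_
        simp only [Function.comp, F]
        rw [← EReal.coe_neg, ← EReal.coe_strictMono.monotone.map_max, EReal.toReal_coe]
    have : Tendsto (fun n => (((2 * π)⁻¹ * ∫ θ in (0:ℝ)..(2 * π), F n θ : ℝ) : EReal)) atTop (𝓝 (circleAvgTrunc u c r N : EReal)) :=
      (continuous_coe_real_ereal.tendsto _).comp (lim.const_mul _)
    refine ge_of_tendsto' this fun n => (iInf_le _ n).trans (EReal.coe_le_coe_iff.2 (((hS n).sm c r r0).trans ?_))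
    refine mul_le_mul_of_nonneg_left ?_ (by positivity)
    exact intervalIntegral.integral_mono (by positivity) (((hS n).co.comp cc).intervalIntegrable _ _) ((cF n).intervalIntegrable _ _) fun θ => le_max_left _ _
  · obtain ⟨l, hl, ld⟩ := Metric.mem_closure_iff.1 (h.dn hz0.1) ρ ρ0
    refine ⟨l, mem_ball'.2 ld, ?_⟩
    obtain ⟨d, d0, hd⟩ := Metric.isOpen_iff.1 h.oU l hl.2
    have d0' : 0 < min d (8 * R) := lt_min d0 (by linarith [h.R0])
    refine ((EReal.bot_lt_coe (rlog (min d (8 * R) / (8 * R)))).trans_le (le_iInf fun n => EReal.coe_le_coe_iff.2 ((hS n).lo l _ d0' (min_le_right _ _) fun y hy => (min_le_left _ _).trans ?_))).ne'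
    by_contra! hh
    exact hy.2 (hd (by rwa [mem_ball', dist_eq_norm]))
  · have : ∀ n : ℕ, u z ≤ ((-n : ℝ) : EReal) := fun n => (iInf_le _ n).trans (EReal.coe_le_coe_iff.2 (by
      have : S n z ≤ ∑ j ∈ Finset.range n, (-1:ℝ) := Finset.sum_le_sum fun j _ => by
        have := mul_le_mul_of_nonneg_left (hv2 j z ⟨ball_subset_closedBall hz.2, hz.1.2⟩) (show (0:ℝ) ≤ 2⁻¹^(j+1) by positivity)
        rwa [mul_neg, ← mul_pow, inv_mul_cancel₀ two_ne_zero, one_pow] at this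
      simpa using this))
    rw [EReal.eq_bot_iff_forall_lt]
    intro y
    obtain ⟨n, hn⟩ := exists_nat_gt (-y)
    exact (this n).trans_lt (EReal.coe_lt_coe_iff.2 (by linarith))
end lb3


/-- If `D ⊆ ℂⁿ` is a bounded pseudoconvex domain, `w ∈ ∂D`, and `P` is a polydisc centered at
`w` on which the Bergman kernel of `D` is bounded, then for every complex line `L` meeting `P`
either `L ∩ P ∩ D = ∅` or `(L ∩ P) \ D` is polar (in the line coordinate). -/
theorem lines_polar_of_bounded_kernel {n : ℕ} (D : Set (Fin n → ℂ))
    (hopen : IsOpen D) (hconn : IsConnected D) (hbd : Bornology.IsBounded D)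
    (hpsc : IsPseudoconvex D) (w : Fin n → ℂ) (hw : w ∈ frontier D)
    (r : Fin n → ℝ) (hr : ∀ i, 0 < r i)
    (hK : (⨆ z ∈ D ∩ polydisc w r, bergmanKernel D z) < (⊤ : ℝ≥0∞)) :
    ∀ a b : Fin n → ℂ, b ≠ 0 → (∃ lam : ℂ, a + lam • b ∈ polydisc w r) →
      (∀ lam : ℂ, a + lam • b ∈ polydisc w r → a + lam • b ∉ D) ∨
      PolarSet {lam : ℂ | a + lam • b ∈ polydisc w r ∧ a + lam • b ∉ D} := by
  intro a b hb _
  by_cases hne : ∀ lam : ℂ, a + lam • b ∈ polydisc w r → a + lam • b ∉ D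
  · exact Or.inl hne
  push Not at hne
  obtain ⟨l1, l1P, l1D⟩ := hne
  obtain ⟨R1, C, hC⟩ := line_bound hopen hbd hpsc hK a b hb
  have cΦ : Continuous fun l : ℂ => a + l • b := by fun_prop
  obtain ⟨i, hi⟩ := Function.ne_iff.1 hb
  have bi : 0 < ‖b i‖ := norm_pos_iff.2 hi
  have hQ : {l : ℂ | a + l • b ∈ polydisc w r} = ⋂ i, {l : ℂ | ‖a i + l * b i - w i‖ < r i} := by
    ext l; simp [polydisc]
  have QR : ∀ l ∈ {l : ℂ | a + l • b ∈ polydisc w r}, ‖l‖ ≤ (r i + ‖a i - w i‖) / ‖b i‖ := fun l hl => by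
    have h1 : ‖a i + l * b i - w i‖ < r i := hl i
    rw [le_div_iff₀ bi, ← norm_mul]
    have := norm_sub_le (a i + l * b i - w i) (a i - w i)
    rw [show a i + l * b i - w i - (a i - w i) = l * b i by ring] at this
    linarith
  have hL : LB {l : ℂ | a + l • b ∈ D} {l : ℂ | a + l • b ∈ polydisc w r} R1 (max (max R1 1) ((r i + ‖a i - w i‖) / ‖b i‖)) (|C| + 1) := by
    refine ⟨hopen.preimage cΦ, ?_, ?_, ⟨l1, l1P, l1D⟩, ?_, by positivity, (le_max_left _ _).trans (le_max_left _ _), fun z hz => (QR z hz).trans (le_max_right _ _), fun l hl => ?_⟩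
    · rw [hQ]
      exact isOpen_iInter_of_finite fun i => isOpen_lt (by fun_prop) continuous_const
    · refine Convex.isPreconnected fun x hx y hy s t hs ht hst j => ?_
      have h1 : ‖a j + x * b j - w j‖ < r j := hx j
      have h2 : ‖a j + y * b j - w j‖ < r j := hy j
      have := (convex_ball (0:ℂ) (r j)) (mem_ball_zero_iff.2 h1) (mem_ball_zero_iff.2 h2) hs ht hst
      rw [mem_ball_zero_iff] at this
      have hst' : (s:ℂ) + t = 1 := by exact_mod_cast hst
      have e : a j + (s • x + t • y) * b j - w j = s • (a j + x * b j - w j) + t • (a j + y * b j - w j) := by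
        simp only [real_smul]; linear_combination (w j - a j) * hst'
      rw [← e] at this
      exact this
    · exact one_pos.trans_le ((le_max_right _ _).trans (le_max_left _ _))
    · obtain ⟨s, s0, hs⟩ := hC l ⟨hl.2, hl.1⟩
      refine ⟨s, s0, fun f hf => (hs f hf).trans (mul_le_mul_of_nonneg_right ?_ (integral_nonneg fun _ => by positivity))⟩
      linarith [le_abs_self C]
  exact Or.inr hL.polar
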